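/- Let G = W(H4) ⊂ GL₄(ℝ) be the Weyl group of type H4 (generated by the four explicit matrices below). For a pair of natural numbers (d, m), there exists a G-invariant homogeneous polynomial of degree d in ℝ[x,y,z,w] whose order of vanishing at the point (0,0,0,1) is exactly m, if and only if (d, m) belongs to the additive submonoid of ℕ × ℕ generated by the twelve pairs (2,0), (12,2), (20,4), (24,6), (30,6), (32,8), (36,10), (42,10), (44,12), (54,14), (60,16), (66,18). -/

import Mathlib

open MvPolynomial Matrix

/-- The golden ratio. -/
noncomputable def gr : ℝ := (1 + Real.sqrt 5) / 2

/-- The first generator of `W(H4)`: `diag(−1,1,1,1)`. -/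
def m1 : Matrix (Fin 4) (Fin 4) ℝ :=
  ![![-1, 0, 0, 0], ![0, 1, 0, 0], ![0, 0, 1, 0], ![0, 0, 0, 1]]

/-- The second generator of `W(H4)`: `diag(1,−1,1,1)`. -/
def m2 : Matrix (Fin 4) (Fin 4) ℝ :=
  ![![1, 0, 0, 0], ![0, -1, 0, 0], ![0, 0, 1, 0], ![0, 0, 0, 1]]

/-- The third generator of `W(H4)`:
`(1/2)·[[φ, φ−1, −1, 0], [φ−1, 1, φ, 0], [−1, φ, 1−φ, 0], [0, 0, 0, 2]]`. -/
noncomputable def m3 : Matrix (Fin 4) (Fin 4) ℝ :=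
  (1 / 2 : ℝ) • ![![gr, gr - 1, -1, 0], ![gr - 1, 1, gr, 0],
    ![-1, gr, 1 - gr, 0], ![0, 0, 0, 2]]

/-- The fourth generator of `W(H4)`. -/
def m4 : Matrix (Fin 4) (Fin 4) ℝ :=
  ![![0, 0, -1, 0], ![0, 0, 0, 1], ![1, 0, 0, 0], ![0, -1, 0, 0]]

/-- The Weyl group `W(H4) ≤ GL₄(ℝ)`, generated by the four matrices above. -/
noncomputable def WH4 : Subgroup (GL (Fin 4) ℝ) :=
  Subgroup.closure { g : GL (Fin 4) ℝ |
    (↑g : Matrix (Fin 4) (Fin 4) ℝ) = m1 ∨ (↑g : Matrix (Fin 4) (Fin 4) ℝ) = m2 ∨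
    (↑g : Matrix (Fin 4) (Fin 4) ℝ) = m3 ∨ (↑g : Matrix (Fin 4) (Fin 4) ℝ) = m4 }

/-- The action of `g ∈ GL₄(ℝ)` on polynomials by linear change of variables:
`(g · F)(v) = F(g⁻¹ v)`. -/
noncomputable def polyActR (g : GL (Fin 4) ℝ) (F : MvPolynomial (Fin 4) ℝ) :
    MvPolynomial (Fin 4) ℝ :=
  aeval (fun i : Fin 4 =>
    ∑ j : Fin 4, ((↑(g⁻¹) : Matrix (Fin 4) (Fin 4) ℝ) i j) • (X j : MvPolynomial (Fin 4) ℝ)) F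

abbrev P4 := MvPolynomial (Fin 4) ℝ

theorem comp_mul_mem {w : Fin 4 → ℕ} {f : P4} {d : ℕ} (hf : IsWeightedHomogeneous w f d)
    (hd : 0 < d) (n : ℕ) (A : Subalgebra ℝ P4) (hfA : f ∈ A) (M : Submodule A P4)
    (ih : ∀ k < n, ∀ p : P4, IsWeightedHomogeneous w p k → p ∈ M) (g : P4) :
    weightedHomogeneousComponent w n (g * f) ∈ M := by
  induction g using MvPolynomial.induction_on' with
  | monomial μ r =>
    have hm : IsWeightedHomogeneous w (monomial μ r) (Finsupp.weight w μ) :=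
      isWeightedHomogeneous_monomial w μ r rfl
    have hmf := hm.mul hf
    rw [weightedHomogeneousComponent_of_mem (m := n) hmf]
    split_ifs with h
    · have h1 := ih (Finsupp.weight w μ) (by omega) _ hm
      have h2 := M.smul_mem (⟨f, hfA⟩ : A) h1
      have : (⟨f, hfA⟩ : A) • (monomial μ r : P4) = monomial μ r * f := by
        rw [Subalgebra.smul_def, smul_eq_mul, mul_comm]
      rwa [this] at h2
    · exact M.zero_mem
  | add p q hp hq =>
    rw [add_mul, map_add]
    exact M.add_mem hp hq

theorem graded_nakayama {ι κ : Type*} [Fintype ι] [Fintype κ] {w : Fin 4 → ℕ}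
    (f : ι → P4) (d : ι → ℕ) (hd : ∀ i, 0 < d i)
    (hf : ∀ i, IsWeightedHomogeneous w (f i) (d i)) (B : κ → P4) (dB : κ → ℕ)
    (hB : ∀ i, IsWeightedHomogeneous w (B i) (dB i))
    (h : ∀ p : P4, ∃ (x : κ → ℝ) (y : ι → P4), p = ∑ i, x i • B i + ∑ i, y i * f i) (p : P4) :
    p ∈ Submodule.span (Algebra.adjoin ℝ (Set.range f)) (Set.range B) := by
  set A := Algebra.adjoin ℝ (Set.range f)
  set M := Submodule.span A (Set.range B)
  have hsm : ∀ (r : ℝ) (q : P4), q ∈ M → r • q ∈ M := by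
    intro r q hq
    have h2 := M.smul_mem (algebraMap ℝ A r) hq
    rwa [algebraMap_smul] at h2
  have main : ∀ n, ∀ q : P4, IsWeightedHomogeneous w q n → q ∈ M := by
    intro n
    induction n using Nat.strong_induction_on with
    | _ n ih =>
      intro q hq
      obtain ⟨x, y, hxy⟩ := h q
      have e1 : q = weightedHomogeneousComponent w n q :=
        (weightedHomogeneousComponent_eq_self hq).symm
      rw [e1, hxy, map_add, map_sum, map_sum]
      refine M.add_mem (M.sum_mem fun i _ => ?_) (M.sum_mem fun i _ => ?_)
      · rw [map_smul]
        refine hsm _ _ ?_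
        rw [weightedHomogeneousComponent_of_mem (m := n) (hB i)]
        split_ifs
        · exact Submodule.subset_span ⟨i, rfl⟩
        · exact M.zero_mem
      · exact comp_mul_mem (hf i) (hd i) n A (Algebra.subset_adjoin ⟨i, rfl⟩) M ih _
  induction p using MvPolynomial.induction_on' with
  | monomial μ r => exact main _ _ (isWeightedHomogeneous_monomial w μ r rfl)
  | add p q hp hq => exact M.add_mem hp hq

theorem algInd_of_integral (f : Fin 4 → P4)
    (h : Algebra.IsIntegral (Algebra.adjoin ℝ (Set.range f)) P4) : AlgebraicIndependent ℝ f := by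
  have : Algebra.IsAlgebraic (Algebra.adjoin ℝ (Set.range f)) P4 := inferInstance
  refine (Algebra.IsAlgebraic.isTranscendenceBasis_of_le_trdeg_of_finite ℝ f ?_).1
  rw [MvPolynomial.trdeg_of_isDomain]
  simp

theorem integrallyClosed_of_algInd {R : Type*} [CommRing R] [Algebra ℝ R] (f : Fin 4 → R)
    (h : AlgebraicIndependent ℝ f) :
    IsIntegrallyClosed (Algebra.adjoin ℝ (Set.range f)) := by
  have e := h.aevalEquiv
  exact IsIntegrallyClosed.of_equiv e.toRingEquiv

theorem descend {R S : Type*} [CommRing R] [IsDomain R] [Algebra ℝ R] [CommRing S] [IsDomain S]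
    (A : Subalgebra ℝ R) [IsIntegrallyClosed A] [Algebra.IsIntegral A R] (n : ℕ) {κ : Type*}
    [Fintype κ] (hκ : Fintype.card κ = n)
    (B : κ → R) (hB : ∀ p : R, p ∈ Submodule.span A (Set.range B))
    (j : R →+* S) (hj : Function.Injective j) (F θ : R) (σ : Fin n → S →+* S)
    (hA : ∀ i, ∀ x ∈ A, σ i (j x) = j x) (hF : ∀ i, σ i (j F) = j F)
    (hθ : Function.Injective fun i => σ i (j θ)) : F ∈ A := by
  classical
  let g : Option (Fin n) → R := fun o => o.elim F (fun k => θ ^ (k : ℕ))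
  have hnot : ¬ LinearIndependent A g := by
    intro hl
    have h1 := linearIndependent_le_span_aux' g hl (Set.range B) (by
      intro x _; exact hB x)
    have h2 : Fintype.card (Set.range B) ≤ Fintype.card κ := Fintype.card_range_le B
    rw [Fintype.card_option, Fintype.card_fin] at h1
    have h3 : ∀ (i1 i2 : Fintype (Set.range B)), @Fintype.card _ i1 = @Fintype.card _ i2 :=
      fun i1 i2 => by congr!
    rw [h3 _ (Set.fintypeRange B)] at h1
    rw [h3 _ (Set.fintypeRange B)] at h2
    omega
  rw [Fintype.not_linearIndependent_iff] at hnot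
  obtain ⟨c, hc, i0, hi0⟩ := hnot
  rw [Fintype.sum_option] at hc
  simp only [g, Option.elim, Subalgebra.smul_def, smul_eq_mul] at hc
  let pol : Polynomial S := Polynomial.C (j (c none * F)) +
    ∑ k : Fin n, Polynomial.C (j (c (some k))) * Polynomial.X ^ (k : ℕ)
  have hroot : ∀ i, pol.eval (σ i (j θ)) = 0 := by
    intro i
    have := congrArg (fun r => σ i (j r)) hc
    simp only [map_add, map_sum, map_mul, map_pow, map_zero] at this
    simp only [pol, Polynomial.eval_add, Polynomial.eval_C, Polynomial.eval_finsetSum,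
      Polynomial.eval_mul, Polynomial.eval_pow, Polynomial.eval_X]
    rw [← this, hF, hA i _ (c none).2, map_mul]
    congr 1
    refine Finset.sum_congr rfl fun k _ => ?_
    rw [hA i _ (c (some k)).2]
  rcases Nat.eq_zero_or_pos n with hn | hn
  · subst hn
    have : Subsingleton R := by
      have : IsEmpty κ := Fintype.card_eq_zero_iff.mp hκ
      refine ⟨fun a b => ?_⟩
      have ha := hB a
      have hb := hB b
      simp only [Set.range_eq_empty, Submodule.span_empty, Submodule.mem_bot] at ha hb
      rw [ha, hb]
    exact absurd this (not_subsingleton R)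
  have hdeg : pol.natDegree < n := by
    refine lt_of_le_of_lt (Polynomial.natDegree_add_le _ _) (max_lt ?_ ?_)
    · rw [Polynomial.natDegree_C]; exact hn
    · refine lt_of_le_of_lt (Polynomial.natDegree_sum_le_of_forall_le (n := n - 1) _ _ ?_) (by omega)
      intro k _
      refine (Polynomial.natDegree_C_mul_X_pow_le _ _).trans (by have := k.2; omega)
  have hzero : pol = 0 :=
    Polynomial.eq_zero_of_natDegree_lt_card_of_eval_eq_zero pol hθ hroot (by simpa using hdeg)
  have hco : ∀ k : Fin n, k ≠ ⟨0, hn⟩ → c (some k) = 0 := by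
    intro k hk
    have hk0 : (k : ℕ) ≠ 0 := fun h => hk (Fin.ext h)
    have := congrArg (fun q => q.coeff (k : ℕ)) hzero
    simp only [pol, Polynomial.coeff_add, Polynomial.coeff_C, hk0, if_false,
      Polynomial.finsetSum_coeff, Polynomial.coeff_C_mul, Polynomial.coeff_X_pow,
      Polynomial.coeff_zero, zero_add] at this
    rw [Finset.sum_eq_single k] at this
    · simp only [if_true, mul_one] at this
      have h2 := hj (this.trans (map_zero j).symm)
      exact_mod_cast h2
    · intro b _ hb
      rw [if_neg (fun h => hb (Fin.ext h.symm)), mul_zero]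
    · simp
  have hrel : (c none : R) * F + c (some ⟨0, hn⟩) = 0 := by
    rw [← hc]
    congr 1
    rw [Finset.sum_eq_single (⟨0, hn⟩ : Fin n)]
    · simp
    · intro b _ hb
      rw [hco b hb]; simp
    · simp
  have hlam : c none ≠ 0 := by
    intro h0
    rw [h0] at hrel
    have h00 : c (some ⟨0, hn⟩) = 0 := by
      have : ((c (some ⟨0, hn⟩) : A) : R) = 0 := by simpa using hrel
      exact_mod_cast this
    apply hi0
    cases i0 with
    | none => exact h0
    | some k =>
      by_cases hk : k = ⟨0, hn⟩
      · rw [hk]; exact h00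
      · exact hco k hk
  -- integrally closed
  have hFint : IsIntegral A F := Algebra.IsIntegral.isIntegral F
  obtain ⟨P, hPm, hP⟩ := hFint
  let K := FractionRing A
  let L := FractionRing R
  have hinjAR : Function.Injective (algebraMap A R) := Subtype.coe_injective
  have hinj : Function.Injective (algebraMap A L) := by
    rw [IsScalarTower.algebraMap_eq A R L]
    exact (IsFractionRing.injective R L).comp hinjAR
  let ψ : K →+* L := IsFractionRing.lift (g := algebraMap A L) hinj
  let x : K := - algebraMap A K (c (some ⟨0, hn⟩)) / algebraMap A K (c none)
  have hψ : ∀ a : A, ψ (algebraMap A K a) = algebraMap R L (a : R) := by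
    intro a
    have := IsFractionRing.lift_algebraMap (K := K) hinj a
    rw [this, IsScalarTower.algebraMap_apply A R L]
    rfl
  have hlamL : algebraMap R L (c none : R) ≠ 0 := by
    intro h
    have := (IsFractionRing.injective R L) (h.trans (map_zero _).symm)
    exact hlam (by exact_mod_cast this)
  have hx : ψ x = algebraMap R L F := by
    simp only [x, map_div₀, hψ]
    rw [div_eq_iff hlamL, ← map_mul, ← map_neg]
    have : -((c (some ⟨0, hn⟩) : A) : R) = F * (c none : R) := by linear_combination - hrel
    rw [← this]; simp [hψ]
  have hxint : IsIntegral A x := by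
    refine ⟨P, hPm, ?_⟩
    apply ψ.injective
    rw [map_zero, Polynomial.hom_eval₂, hx]
    have hcomp : ψ.comp (algebraMap A K) = (algebraMap R L).comp (algebraMap A R) := by
      ext a; exact hψ a
    rw [hcomp, ← Polynomial.hom_eval₂, hP, map_zero]
  obtain ⟨y, hy⟩ := (IsIntegrallyClosed.isIntegral_iff (R := A) (K := K)).mp hxint
  have : (y : R) = F := by
    apply IsFractionRing.injective R L
    rw [← hψ, hy, hx]
  rw [← this]
  exact y.2

/-- The invariant of degree 12, in terms of the invariants of `H3`. -/
def bF {R : Type*} [CommRing R] (a v u t : R) : R :=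
    a^5*v - 8*a^4*v^2 + 29*a^3*v^3 + 33*a^3*u - 52*a^2*v^4 - 132*a^2*v*u
    + 45*a*v^5 + 154*a*v^2*u - 11*a*t - 15*v^6 - 54*v^3*u + 12*v*t
    - 3*u^2

/-- The invariant of degree 20. -/
def cF {R : Type*} [CommRing R] (a v u t : R) : R :=
    a^8*v^2 - 13*a^7*v^3 + 15*a^7*u + 74*a^6*v^4 - 174*a^6*v*u - 238*a^5*v^5
    + 1020*a^5*v^2*u + 90*a^5*t + 476*a^4*v^6 - 3448*a^4*v^3*u - 682*a^4*v*t + 294*a^4*u^2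
    - 610*a^3*v^7 + 6764*a^3*v^4*u + 1976*a^3*v^2*t - 1482*a^3*v*u^2 + 490*a^2*v^8 - 7562*a^2*v^5*u
    - 2774*a^2*v^3*t + 2964*a^2*v^2*u^2 + 114*a^2*u*t - 225*a*v^9 + 4465*a*v^6*u + 1900*a*v^4*t
    - 2679*a*v^3*u^2 - 228*a*v*u*t - 57*a*u^3 + 45*v^10 - 1080*v^7*u - 510*v^5*t
    + 904*v^4*u^2 + 116*v^2*u*t + 60*v*u^3 + t^2

set_option maxHeartbeats 2000000 in
/-- The invariant of degree 30. -/
def eF {R : Type*} [CommRing R] (a v u t : R) : R :=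
    10*a^12*v^3 - 195*a^11*v^4 + 225*a^11*v*u + 1737*a^10*v^5 - 3060*a^10*v^2*u + 675*a^10*t
    - 9260*a^9*v^6 + 15840*a^9*v^3*u - 12150*a^9*v*t + 4050*a^9*u^2 + 32655*a^8*v^7 - 25530*a^8*v^4*u
    + 97770*a^8*v^2*t - 57555*a^8*v*u^2 - 79635*a^7*v^8 - 104655*a^7*v^5*u - 457365*a^7*v^3*t + 412920*a^7*v^2*u^2
    + 28575*a^7*u*t + 136610*a^6*v^9 + 684510*a^6*v^6*u + 1369500*a^6*v^4*t - 1809990*a^6*v^3*u^2 - 288180*a^6*v*u*t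
    + 43470*a^6*u^3 - 164547*a^5*v^10 - 1824735*a^5*v^7*u - 2740080*a^5*v^5*t + 5083425*a^5*v^4*u^2 + 1248300*a^5*v^2*u*t
    - 315945*a^5*v*u^3 + 12150*a^5*t^2 + 136275*a^4*v^11 + 2883840*a^4*v^8*u + 3714945*a^4*v^6*t - 9279915*a^4*v^5*u^2
    - 2984070*a^4*v^3*u*t + 935550*a^4*v^2*u^3 - 72870*a^4*v*t^2 - 6795*a^4*u^2*t - 73900*a^3*v^12 - 2886960*a^3*v^9*u
    - 3377370*a^3*v^7*t + 10933410*a^3*v^6*u^2 + 4233660*a^3*v^4*u*t - 1468620*a^3*v^3*u^3 + 174360*a^3*v^2*t^2 + 12870*a^3*v*u^2*t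
    + 35910*a^3*u^4 + 23625*a^2*v^13 + 1805250*a^2*v^10*u + 1974900*a^2*v^8*t - 8011830*a^2*v^7*u^2 - 3558300*a^2*v^5*u*t
    + 1299780*a^2*v^4*u^3 - 207930*a^2*v^3*t^2 - 121365*a^2*v*u^4 - 2610*a^2*u*t^2 - 3375*a*v^14 - 645975*a*v^11*u
    - 672075*a*v^9*t + 3319485*a*v^8*u^2 + 1639515*a*v^6*u*t - 617265*a*v^5*u^3 + 123540*a*v^4*t^2 - 11745*a*v^3*u^2*t
    + 138330*a*v^2*u^4 + 5220*a*v*u*t^2 + 1305*a*u^3*t + 101250*v^12*u + 101250*v^10*t - 594000*v^9*u^2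
    - 319500*v^7*u*t + 123040*v^6*u^3 - 29250*v^5*t^2 + 5700*v^4*u^2*t - 52830*v^3*u^4 - 2580*v^2*u*t^2
    - 1260*v*u^3*t - 54*u^5 + 10*t^3

attribute [irreducible] bF cF eF

theorem scale_bF {R : Type*} [CommRing R] (T a v u t : R) :
    bF (T * a) (T * v) (T ^ 3 * u) (T ^ 5 * t) = T ^ 6 * bF a v u t := by
  simp only [bF]; ring

theorem scale_cF {R : Type*} [CommRing R] (T a v u t : R) :
    cF (T * a) (T * v) (T ^ 3 * u) (T ^ 5 * t) = T ^ 10 * cF a v u t := by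
  simp only [cF]; ring

set_option maxHeartbeats 2000000 in
theorem scale_eF {R : Type*} [CommRing R] (T a v u t : R) :
    eF (T * a) (T * v) (T ^ 3 * u) (T ^ 5 * t) = T ^ 15 * eF a v u t := by
  simp only [eF]; ring

theorem cancel_nat {Q : Type*} [CommRing Q] [Algebra ℝ Q] (n : ℕ) (hn : n ≠ 0) {x : Q}
    (h : (n : Q) * x = 0) : x = 0 := by
  have h1 : algebraMap ℝ Q ((n : ℝ)⁻¹) * ((n : Q) * x) = 0 := by rw [h, mul_zero]
  have h2 : algebraMap ℝ Q ((n : ℝ)⁻¹) * (n : Q) = 1 := by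
    rw [← map_natCast (algebraMap ℝ Q) n, ← map_mul, inv_mul_cancel₀ (by exact_mod_cast hn),
      map_one]
  rwa [← mul_assoc, h2, one_mul] at h1

theorem mem_of_nat_mul {Q : Type*} [CommRing Q] [Algebra ℝ Q] (N : Submodule ℝ Q) (n : ℕ)
    (hn : n ≠ 0) {x : Q} (h : (n : Q) * x ∈ N) : x ∈ N := by
  have h1 := N.smul_mem ((n : ℝ)⁻¹) h
  have : (n : ℝ)⁻¹ • ((n : Q) * x) = x := by
    rw [Algebra.smul_def, ← mul_assoc, ← map_natCast (algebraMap ℝ Q) n, ← map_mul,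
      inv_mul_cancel₀ (by exact_mod_cast hn), map_one, one_mul]
  rwa [this] at h1

theorem int_mul_mem {Q : Type*} [CommRing Q] [Algebra ℝ Q] (N : Submodule ℝ Q) (n : ℤ)
    {x : Q} (h : x ∈ N) : (n : Q) * x ∈ N := by
  have h1 := N.smul_mem (n : ℝ) h
  rwa [Algebra.smul_def, map_intCast] at h1

theorem span_of_quot {κ : Type*} [Fintype κ] (f : Fin 4 → P4) (B : κ → P4)
    (h : ∀ (Q : Type) [CommRing Q] [Algebra ℝ Q] (π : P4 →ₐ[ℝ] Q), (∀ i, π (f i) = 0) →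
      π 1 ∈ Submodule.span ℝ (Set.range fun j => π (B j)) ∧
      ∀ i j, π (X i * B j) ∈ Submodule.span ℝ (Set.range fun j => π (B j)))
    (p : P4) : ∃ (x : κ → ℝ) (y : Fin 4 → P4), p = ∑ i, x i • B i + ∑ i, y i * f i := by
  set I := Ideal.span (Set.range f)
  obtain ⟨h1, hX⟩ := h (P4 ⧸ I) (Ideal.Quotient.mkₐ ℝ I) (fun i => by
    rw [Ideal.Quotient.mkₐ_eq_mk]
    exact Ideal.Quotient.eq_zero_iff_mem.mpr (Ideal.subset_span ⟨i, rfl⟩))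
  set π := Ideal.Quotient.mkₐ ℝ I with hπ
  set N := Submodule.span ℝ (Set.range fun j => π (B j))
  have hmul : ∀ i, ∀ q ∈ N, π (X i) * q ∈ N := by
    intro i q hq
    induction hq using Submodule.span_induction with
    | mem x hx =>
      obtain ⟨j, rfl⟩ := hx
      have := hX i j
      rwa [map_mul] at this
    | zero => rw [mul_zero]; exact N.zero_mem
    | add x y _ _ hx hy => rw [mul_add]; exact N.add_mem hx hy
    | smul r x _ hx => rw [mul_smul_comm]; exact N.smul_mem r hx
  have hp : π p ∈ N := by
    induction p using MvPolynomial.induction_on with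
    | C r =>
      have := N.smul_mem r h1
      rwa [← map_smul, smul_eq_C_mul, mul_one] at this
    | add p q hp hq => rw [map_add]; exact N.add_mem hp hq
    | mul_X p i hp => rw [map_mul, mul_comm]; exact hmul i _ hp
  obtain ⟨x, hx⟩ := (Submodule.mem_span_range_iff_exists_fun ℝ).mp hp
  have h3 : p - ∑ i, x i • B i ∈ I := by
    rw [← Ideal.Quotient.eq_zero_iff_mem, ← Ideal.Quotient.mkₐ_eq_mk ℝ I, ← hπ, map_sub, ← hx,
      map_sum, sub_eq_zero]
    refine Finset.sum_congr rfl fun i _ => ?_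
    rw [map_smul]
  obtain ⟨y, hy⟩ := (Ideal.mem_span_range_iff_exists_fun).mp h3
  exact ⟨x, y, by rw [hy]; ring⟩

set_option maxHeartbeats 2000000 in
theorem rels2 {Q : Type*} [CommRing Q] [Algebra ℝ Q] (v u t : Q) (hb : bF 0 v u t = 0)
    (hc : cF 0 v u t = 0) (he : eF 0 v u t = 0) :
    u^2 = 4*v*t - 18*v^3*u - 5*v^6 ∧
    t^2 = -356*v^2*u*t + 1214*v^5*t - 1788*v^7*u - 925*v^10 ∧
    24149*(v^7*u*t) = -61895*v^15 - 119691*v^12*u + 81127*v^10*t ∧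
    69967*(v^13*t) = 93045*v^18 + 344174*v^15*u ∧
    1763*(v^17*u) = -295*v^20 ∧ v^23 = 0 := by
  simp only [bF, cF, eF] at hb hc he
  have hu : u^2 - (4*v*t - 18*v^3*u - 5*v^6) = 0 := by
    apply cancel_nat 3 (by norm_num)
    push_cast
    linear_combination -hb
  have ht : t^2 - (-356*v^2*u*t + 1214*v^5*t - 1788*v^7*u - 925*v^10) = 0 := by
    linear_combination hc - (60*v*u - 176*v^4) * hu
  have h0 : -61895*v^15 - 119691*v^12*u + 81127*v^10*t - 24149*v^7*u*t = 0 := by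
    apply cancel_nat 245760 (by norm_num)
    push_cast
    linear_combination he - (2178390*v^9 + 1056754*v^6*u + 4112500*v^4*t - 51858*v^3*u^2
      - 1476*v*u*t - 54*u^3) * hu - (16432890*v^5 - 12044*v^2*u + 10*t) * ht
  have h1 : 89949755*v^18 + 174806191*v^15*u - 117625563*v^13*t + 34903985*v^10*u*t = 0 := by
    linear_combination u * h0 - (-119691*v^12 - 24149*v^7*t) * hu - (-96596*v^8) * ht
  have h2 : -32099997335*v^20 - 62385987355*v^17*u + 41975400375*v^15*t
      - 12455255237*v^12*u*t = 0 := by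
    linear_combination t * h0 - (43178412*v^14 + 8597044*v^9*t) * hu
      - (34469303*v^10 - 24149*v^7*u) * ht
  have h3 : 46396374313675*v^23 + 90170833230079*v^20*u - 60669987104107*v^18*t
      + 18002453452129*v^15*u*t = 0 := by
    linear_combination u * t * h0 - (-62385987355*v^17 + 43178412*v^14*u - 12455255237*v^12*t
      + 8597044*v^9*u*t) * hu - (-49821020948*v^13 + 34469303*v^10*u - 24149*v^7*u^2) * ht
  have p1 : -93045*v^18 - 344174*v^15*u + 69967*v^13*t = 0 := by
    apply cancel_nat 4096 (by norm_num)
    push_cast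
    linear_combination -779 * h1 - 1125935 * v^3 * h0
  have p2 : 295*v^20 + 1763*v^17*u = 0 := by
    apply cancel_nat 153157632 (by norm_num)
    push_cast
    linear_combination 1891 * (-779 * h2 + 401782427 * v^5 * h0) + 2795511808 * v^2 * p1
  have p3 : v^23 = 0 := by
    apply cancel_nat 4666750402560 (by norm_num)
    push_cast
    linear_combination 43 * (2257 * (-24149 * h3 - 18002453452129 * v^8 * h0)
      - 149499269877760 * v^5 * p1) + 351336835252224 * v^3 * p2
  refine ⟨by linear_combination hu, by linear_combination ht, by linear_combination -h0,
    by linear_combination p1, by linear_combination p2, p3⟩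

/-- Index type of the module basis of `ℝ[a,v,u,t]` over the invariants of `H4`. -/
abbrev K60 := Fin 23 ⊕ Fin 17 ⊕ Fin 13 ⊕ Fin 7

theorem card_K60 : Fintype.card K60 = 60 := by simp

/-- The generating family of `ℝ[a,v,u,t]`. -/
noncomputable def B2 : K60 → P4
  | .inl i => X 1 ^ (i : ℕ)
  | .inr (.inl i) => X 1 ^ (i : ℕ) * X 2
  | .inr (.inr (.inl i)) => X 1 ^ (i : ℕ) * X 3
  | .inr (.inr (.inr i)) => X 1 ^ (i : ℕ) * (X 2 * X 3)

/-- The basic invariants in terms of `a,v,u,t`. -/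
noncomputable def f2 : Fin 4 → P4 :=
  ![X 0, bF (X 0) (X 1) (X 2) (X 3), cF (X 0) (X 1) (X 2) (X 3), eF (X 0) (X 1) (X 2) (X 3)]

theorem map_bF {R S F : Type*} [CommRing R] [CommRing S] [FunLike F R S]
    [RingHomClass F R S] (g : F) (a v u t : R) :
    g (bF a v u t) = bF (g a) (g v) (g u) (g t) := by
  simp only [bF, map_add, map_sub, map_mul, map_pow, map_neg, map_ofNat]

theorem map_cF {R S F : Type*} [CommRing R] [CommRing S] [FunLike F R S]
    [RingHomClass F R S] (g : F) (a v u t : R) :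
    g (cF a v u t) = cF (g a) (g v) (g u) (g t) := by
  simp only [cF, map_add, map_sub, map_mul, map_pow, map_neg, map_ofNat]

set_option maxHeartbeats 2000000 in
set_option maxRecDepth 10000 in
theorem map_eF {R S F : Type*} [CommRing R] [CommRing S] [FunLike F R S]
    [RingHomClass F R S] (g : F) (a v u t : R) :
    g (eF a v u t) = eF (g a) (g v) (g u) (g t) := by
  simp only [eF, map_add, map_sub, map_mul, map_pow, map_neg, map_ofNat]

theorem mem_of_pow {Q : Type*} [CommRing Q] [Algebra ℝ Q] (N : Submodule ℝ Q) (v x : Q) (n : ℕ)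
    (h1 : ∀ i < n, v ^ i * x ∈ N) (h2 : ∀ i, v ^ (i + n) * x ∈ N) (i : ℕ) : v ^ i * x ∈ N := by
  by_cases h : i < n
  · exact h1 i h
  · have := h2 (i - n)
    rwa [Nat.sub_add_cancel (by omega)] at this

theorem span2 (p : P4) :
    ∃ (x : K60 → ℝ) (y : Fin 4 → P4), p = ∑ i, x i • B2 i + ∑ i, y i * f2 i := by
  apply span_of_quot
  intro Q _ _ π hf
  set N := Submodule.span ℝ (Set.range fun j => π (B2 j)) with hN
  have ha : π (X 0) = 0 := hf 0
  have hb : bF (π (X 0)) (π (X 1)) (π (X 2)) (π (X 3)) = 0 :=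
    (map_bF π _ _ _ _).symm.trans (hf 1)
  have hc : cF (π (X 0)) (π (X 1)) (π (X 2)) (π (X 3)) = 0 :=
    (map_cF π _ _ _ _).symm.trans (hf 2)
  have he : eF (π (X 0)) (π (X 1)) (π (X 2)) (π (X 3)) = 0 :=
    (map_eF π _ _ _ _).symm.trans (hf 3)
  rw [ha] at hb hc he
  obtain ⟨hu, ht, h0, h1, h2, h3⟩ := rels2 _ _ _ hb hc he
  have k1 : ∀ i < 23, π (X 1) ^ (i : ℕ) * 1 ∈ N := fun i hi =>
    Submodule.subset_span ⟨.inl ⟨i, hi⟩, by simp [B2]⟩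
  have k2 : ∀ i < 17, π (X 1) ^ (i : ℕ) * π (X 2) ∈ N :=
    fun i hi => Submodule.subset_span ⟨.inr (.inl ⟨i, hi⟩), by simp [B2]⟩
  have k3 : ∀ i < 13, π (X 1) ^ (i : ℕ) * π (X 3) ∈ N :=
    fun i hi => Submodule.subset_span ⟨.inr (.inr (.inl ⟨i, hi⟩)), by simp [B2]⟩
  have k4 : ∀ i < 7, π (X 1) ^ (i : ℕ) * (π (X 2) * π (X 3)) ∈ N :=
    fun i hi => Submodule.subset_span ⟨.inr (.inr (.inr ⟨i, hi⟩)), by simp [B2]⟩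
  have hB : ∀ (g : Q) (_ : ∀ i, g * (π (X 1) ^ (i : ℕ) * 1) ∈ N)
      (_ : ∀ i, g * (π (X 1) ^ (i : ℕ) * π (X 2)) ∈ N)
      (_ : ∀ i, g * (π (X 1) ^ (i : ℕ) * π (X 3)) ∈ N)
      (_ : ∀ i, g * (π (X 1) ^ (i : ℕ) * (π (X 2) * π (X 3))) ∈ N), ∀ j, g * π (B2 j) ∈ N := by
    intro g g1 g2 g3 g4 j
    rcases j with j | j | j | j
    · have := g1 j; simpa [B2] using this
    · have := g2 j; simpa [B2] using this
    · have := g3 j; simpa [B2] using this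
    · have := g4 j; simpa [B2] using this
  refine ⟨by have := k1 0 (by norm_num); simpa using this, ?_⟩
  suffices hs : ∀ i j, π (X i) * π (B2 j) ∈ N by
    intro i j; rw [map_mul]; exact hs i j
  generalize hvx : π (X 1) = v at *
  generalize hux : π (X 2) = u at *
  generalize htx : π (X 3) = t at *
  have l1 := mem_of_pow N v 1 23 k1 (fun i => by rw [pow_add, h3]; simp)
  have l2 := mem_of_pow N v u 17 k2 (fun i => by
    apply mem_of_nat_mul N 1763 (by norm_num)
    have : ((1763 : ℕ) : Q) * (v ^ (i + 17) * u) = ((-295 : ℤ) : Q) * (v ^ (i + 20) * 1) := by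
      push_cast; linear_combination v ^ i * h2
    rw [this]; exact int_mul_mem N _ (l1 _))
  have l3 := mem_of_pow N v t 13 k3 (fun i => by
    apply mem_of_nat_mul N 69967 (by norm_num)
    have : ((69967 : ℕ) : Q) * (v ^ (i + 13) * t) = ((93045 : ℤ) : Q) * (v ^ (i + 18) * 1) +
        ((344174 : ℤ) : Q) * (v ^ (i + 15) * u) := by
      push_cast; linear_combination v ^ i * h1
    rw [this]; exact N.add_mem (int_mul_mem N _ (l1 _)) (int_mul_mem N _ (l2 _)))
  have l4 := mem_of_pow N v (u * t) 7 k4 (fun i => by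
    apply mem_of_nat_mul N 24149 (by norm_num)
    have : ((24149 : ℕ) : Q) * (v ^ (i + 7) * (u * t)) = ((-61895 : ℤ) : Q) * (v ^ (i + 15) * 1) +
        ((-119691 : ℤ) : Q) * (v ^ (i + 12) * u) + ((81127 : ℤ) : Q) * (v ^ (i + 10) * t) := by
      push_cast; linear_combination v ^ i * h0
    rw [this]
    exact N.add_mem (N.add_mem (int_mul_mem N _ (l1 _)) (int_mul_mem N _ (l2 _)))
      (int_mul_mem N _ (l3 _)))
  have n1 : ∀ (c : ℤ) i, (c : Q) * (v ^ i * 1) ∈ N := fun c i => int_mul_mem N c (l1 i)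
  have n2 : ∀ (c : ℤ) i, (c : Q) * (v ^ i * u) ∈ N := fun c i => int_mul_mem N c (l2 i)
  have n3 : ∀ (c : ℤ) i, (c : Q) * (v ^ i * t) ∈ N := fun c i => int_mul_mem N c (l3 i)
  have n4 : ∀ (c : ℤ) i, (c : Q) * (v ^ i * (u * t)) ∈ N := fun c i => int_mul_mem N c (l4 i)
  -- a general combination lies in `N`
  have comb : ∀ (x : Q) (c1 c2 c3 c4 : ℤ) (e1 e2 e3 e4 : ℕ),
      x = (c1 : Q) * (v ^ e1 * 1) + (c2 : Q) * (v ^ e2 * u) + (c3 : Q) * (v ^ e3 * t) +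
        (c4 : Q) * (v ^ e4 * (u * t)) → x ∈ N := by
    intro x c1 c2 c3 c4 e1 e2 e3 e4 hx
    rw [hx]
    exact N.add_mem (N.add_mem (N.add_mem (n1 _ _) (n2 _ _)) (n3 _ _)) (n4 _ _)
  have uu : ∀ i, v ^ i * u ^ 2 ∈ N := fun i =>
    comb _ (-5) (-18) 4 0 (i + 6) (i + 3) (i + 1) 0 (by
      push_cast; linear_combination v ^ i * hu)
  have tt : ∀ i, v ^ i * t ^ 2 ∈ N := fun i =>
    comb _ (-925) (-1788) 1214 (-356) (i + 10) (i + 7) (i + 5) (i + 2) (by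
      push_cast; linear_combination v ^ i * ht)
  have uut : ∀ i, v ^ i * (u ^ 2 * t) ∈ N := fun i => by
    have : v ^ i * (u ^ 2 * t) = ((4 : ℤ) : Q) * (v ^ (i + 1) * t ^ 2) +
      ((-18 : ℤ) : Q) * (v ^ (i + 3) * (u * t)) + ((-5 : ℤ) : Q) * (v ^ (i + 6) * t) := by
      push_cast; linear_combination v ^ i * t * hu
    rw [this]
    exact N.add_mem (N.add_mem (int_mul_mem N _ (tt _)) (n4 _ _)) (n3 _ _)
  have utt : ∀ i, v ^ i * (u * t ^ 2) ∈ N := fun i => by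
    have : v ^ i * (u * t ^ 2) = ((-356 : ℤ) : Q) * (v ^ (i + 2) * (u ^ 2 * t)) +
      ((1214 : ℤ) : Q) * (v ^ (i + 5) * (u * t)) + ((-1788 : ℤ) : Q) * (v ^ (i + 7) * u ^ 2) +
      ((-925 : ℤ) : Q) * (v ^ (i + 10) * u) := by
      push_cast; linear_combination v ^ i * u * ht
    rw [this]
    exact N.add_mem (N.add_mem (N.add_mem (int_mul_mem N _ (uut _)) (n4 _ _))
      (int_mul_mem N _ (uu _))) (n2 _ _)
  intro i j
  fin_cases i
  · simp [ha]
  · change π (X 1) * _ ∈ N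
    rw [hvx]
    refine hB _ ?_ ?_ ?_ ?_ j
    · intro i; have := l1 (i + 1); rwa [pow_succ', mul_assoc] at this
    · intro i; have := l2 (i + 1); rwa [pow_succ', mul_assoc] at this
    · intro i; have := l3 (i + 1); rwa [pow_succ', mul_assoc] at this
    · intro i; have := l4 (i + 1); rwa [pow_succ', mul_assoc] at this
  · change π (X 2) * _ ∈ N
    rw [hux]
    refine hB _ ?_ ?_ ?_ ?_ j
    · intro i; have := l2 i; rwa [show u * (v ^ i * 1) = v ^ i * u by ring]
    · intro i; have := uu i; rwa [show u * (v ^ i * u) = v ^ i * u ^ 2 by ring]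
    · intro i; have := l4 i; rwa [show u * (v ^ i * t) = v ^ i * (u * t) by ring]
    · intro i; have := uut i; rwa [show u * (v ^ i * (u * t)) = v ^ i * (u ^ 2 * t) by ring]
  · change π (X 3) * _ ∈ N
    rw [htx]
    refine hB _ ?_ ?_ ?_ ?_ j
    · intro i; have := l3 i; rwa [show t * (v ^ i * 1) = v ^ i * t by ring]
    · intro i; have := l4 i; rwa [show t * (v ^ i * u) = v ^ i * (u * t) by ring]
    · intro i; have := tt i; rwa [show t * (v ^ i * t) = v ^ i * t ^ 2 by ring]
    · intro i; have := utt i; rwa [show t * (v ^ i * (u * t)) = v ^ i * (u * t ^ 2) by ring]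

/-- The scaling substitution `X i ↦ T ^ (w i) * X i`. -/
noncomputable def scale (w : Fin 4 → ℕ) : P4 →ₐ[ℝ] Polynomial P4 :=
  aeval fun i => Polynomial.X ^ w i * Polynomial.C (X i)

theorem scale_monomial (w : Fin 4 → ℕ) (μ : Fin 4 →₀ ℕ) (r : ℝ) :
    scale w (monomial μ r) = Polynomial.monomial (Finsupp.weight w μ) (monomial μ r) := by
  rw [scale, aeval_monomial, Finsupp.prod_fintype _ _ (by simp), monomial_eq,
    Finsupp.prod_fintype _ _ (by simp), ← Polynomial.C_mul_X_pow_eq_monomial,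
    Finsupp.weight_apply, Finsupp.sum_fintype _ _ (by simp)]
  simp only [Fin.prod_univ_four, Fin.sum_univ_four, mul_pow, map_mul, map_pow, smul_eq_mul,
    pow_add]
  rw [show algebraMap ℝ (Polynomial P4) r = Polynomial.C (C r) from rfl]
  ring

theorem coeff_scale (w : Fin 4 → ℕ) (p : P4) (n : ℕ) :
    (scale w p).coeff n = weightedHomogeneousComponent w n p := by
  induction p using MvPolynomial.induction_on' with
  | monomial μ r =>
    rw [scale_monomial, Polynomial.coeff_monomial,
      weightedHomogeneousComponent_of_mem (m := n) (isWeightedHomogeneous_monomial w μ r rfl)]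
    simp only [eq_comm]
  | add p q hp hq => rw [map_add, Polynomial.coeff_add, hp, hq, map_add]

theorem wh_of_scale {w : Fin 4 → ℕ} {p : P4} {d : ℕ}
    (h : scale w p = Polynomial.X ^ d * Polynomial.C p) : IsWeightedHomogeneous w p d := by
  have h1 := coeff_scale w p d
  rw [h, Polynomial.coeff_X_pow_mul', if_pos le_rfl, Nat.sub_self, Polynomial.coeff_C_zero] at h1
  rw [h1]
  exact weightedHomogeneousComponent_isWeightedHomogeneous d p

/-- Weights on `a,v,u,t`. -/
def w2 : Fin 4 → ℕ := ![1, 1, 3, 5]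

/-- Degrees of the basic invariants. -/
def d2 : Fin 4 → ℕ := ![1, 6, 10, 15]

theorem f2_hom (i : Fin 4) : IsWeightedHomogeneous w2 (f2 i) (d2 i) := by
  apply wh_of_scale
  have h0 : scale w2 (X 0) = Polynomial.X * Polynomial.C (X 0) := by simp [scale, w2]
  have h1 : scale w2 (X 1) = Polynomial.X * Polynomial.C (X 1) := by simp [scale, w2]
  have h2 : scale w2 (X 2) = Polynomial.X ^ 3 * Polynomial.C (X 2) := by simp [scale, w2]
  have h3 : scale w2 (X 3) = Polynomial.X ^ 5 * Polynomial.C (X 3) := by simp [scale, w2]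
  fin_cases i
  · change scale w2 (X 0) = Polynomial.X ^ 1 * Polynomial.C (X 0)
    rw [h0, pow_one]
  · change scale w2 (bF _ _ _ _) = Polynomial.X ^ 6 * Polynomial.C (bF _ _ _ _)
    rw [map_bF, map_bF, h0, h1, h2, h3, scale_bF]
  · change scale w2 (cF _ _ _ _) = Polynomial.X ^ 10 * Polynomial.C (cF _ _ _ _)
    rw [map_cF, map_cF, h0, h1, h2, h3, scale_cF]
  · change scale w2 (eF _ _ _ _) = Polynomial.X ^ 15 * Polynomial.C (eF _ _ _ _)
    rw [map_eF, map_eF, h0, h1, h2, h3, scale_eF]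

theorem B2_hom (j : K60) : ∃ d, IsWeightedHomogeneous w2 (B2 j) d := by
  have hX := fun i => isWeightedHomogeneous_X ℝ w2 i
  rcases j with j | j | j | j
  · exact ⟨_, (hX 1).pow _⟩
  · exact ⟨_, ((hX 1).pow _).mul (hX 2)⟩
  · exact ⟨_, ((hX 1).pow _).mul (hX 3)⟩
  · exact ⟨_, ((hX 1).pow _).mul ((hX 2).mul (hX 3))⟩

/-- The algebra generated by the basic invariants. -/
noncomputable abbrev A2 : Subalgebra ℝ P4 := Algebra.adjoin ℝ (Set.range f2)

theorem span2' (p : P4) : p ∈ Submodule.span A2 (Set.range B2) := by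
  choose dB hB using B2_hom
  exact graded_nakayama f2 d2 (by decide) f2_hom B2 dB hB span2 p

theorem integral_of_span {κ : Type*} [Fintype κ] (A : Subalgebra ℝ P4) (B : κ → P4)
    (h : ∀ p, p ∈ Submodule.span A (Set.range B)) : Algebra.IsIntegral A P4 := by
  have : Module.Finite A P4 := ⟨by
    rw [Submodule.fg_def]
    exact ⟨Set.range B, Set.finite_range B, by rw [eq_top_iff]; intro p _; exact h p⟩⟩
  infer_instance

theorem algInd2 : AlgebraicIndependent ℝ f2 :=
  algInd_of_integral f2 (integral_of_span A2 B2 span2')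

/-- The invariant of `H3` of degree 6, in terms of the squares of the coordinates. -/
def uF {R : Type*} [CommRing R] (g x y z : R) : R :=
  4*x*y*z - g*(x^2*y + y^2*z + z^2*x) + (g-1)*(x^2*z + y^2*x + z^2*y)

/-- The invariant of `H3` of degree 10. -/
def tF {R : Type*} [CommRing R] (g x y z : R) : R :=
  x*(4*y*z - g*(2*x*y+z^2) + (g-1)*(2*x*z+y^2))^2
  + y*(4*x*z - g*(x^2+2*y*z) + (g-1)*(2*y*x+z^2))^2
  + z*(4*x*y - g*(y^2+2*z*x) + (g-1)*(x^2+2*z*y))^2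

attribute [irreducible] uF tF

theorem map_uF {R S F : Type*} [CommRing R] [CommRing S] [FunLike F R S]
    [RingHomClass F R S] (f : F) (g x y z : R) :
    f (uF g x y z) = uF (f g) (f x) (f y) (f z) := by
  simp only [uF, map_add, map_sub, map_mul, map_pow, map_ofNat, map_one]

theorem map_tF {R S F : Type*} [CommRing R] [CommRing S] [FunLike F R S]
    [RingHomClass F R S] (f : F) (g x y z : R) :
    f (tF g x y z) = tF (f g) (f x) (f y) (f z) := by
  simp only [tF, map_add, map_sub, map_mul, map_pow, map_ofNat, map_one]

theorem scale_uF {R : Type*} [CommRing R] (T g x y z : R) :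
    uF g (T * x) (T * y) (T * z) = T ^ 3 * uF g x y z := by
  simp only [uF]; ring

theorem scale_tF {R : Type*} [CommRing R] (T g x y z : R) :
    tF g (T * x) (T * y) (T * z) = T ^ 5 * tF g x y z := by
  simp only [tF]; ring

theorem rels1 {Q : Type*} [CommRing Q] [Algebra ℝ Q] (g x y : Q) (hg : g^2 = g + 1)
    (hu : uF g x y (-x-y) = 0) (ht : tF g x y (-x-y) = 0) :
    5*y^3 = (11*g-13)*x*y^2 + (11*g+2)*x^2*y + 5*x^3 ∧
    44*(x^3*y^2) = -(33+22*g)*x^4*y - (11*g-3)*x^5 ∧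
    13*(x^5*y) = -(7-g)*x^6 ∧ x^7 = 0 := by
  simp only [uF, tF] at hu ht
  have hy : 5*y^3 - ((11*g-13)*x*y^2 + (11*g+2)*x^2*y + 5*x^3) = 0 := by
    linear_combination (2*g-1)*hu + (4*x^3 + 6*x^2*y - 6*x*y^2 - 4*y^3)*hg
  have p1 : 44*(x^3*y^2) + (33+22*g)*x^4*y + (11*g-3)*x^5 = 0 := by
    apply cancel_nat 320 (by norm_num)
    push_cast
    linear_combination 25*ht - (734*x^2*g - 207*x^2 + 30*x*y*g + 305*x*y + 30*y^2*g - 15*y^2)*hy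
      + (-8749*x^4*y - 9754*x^3*y^2 - 2010*x^2*y^3 - 1005*x*y^4)*hg
  have p2 : 13*(x^5*y) + (7-g)*x^6 = 0 := by
    apply cancel_nat 275 (by norm_num)
    push_cast
    linear_combination 44*(5*y*p1-44*x^3*hy) - (594*x*g - 407*x)*p1
      + (6534*x^6 + 13068*x^5*y)*hg
  have p3 : x^7 = 0 := by
    apply cancel_nat 32000 (by norm_num)
    push_cast
    linear_combination 13*(44*(25*y^2*p1-(594*x^4*g - 407*x^4 + 220*x^3*y)*hy)
      -(-2970*x^2*g + 12190*x^2)*p1)-25*(-1474+1518*g)*x*p2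
      + (-462660*x^7 - 4586868*x^6*y - 3737448*x^5*y^2)*hg
  refine ⟨by linear_combination hy, by linear_combination p1, by linear_combination p2, p3⟩

theorem gr_sq : gr ^ 2 = gr + 1 := by
  have h : Real.sqrt 5 ^ 2 = 5 := Real.sq_sqrt (by norm_num)
  unfold gr
  linear_combination h / 4

/-- Index type. -/
abbrev K15 := Fin 7 ⊕ Fin 5 ⊕ Fin 3

/-- The generating family of the ring of polynomials in the squares. -/
noncomputable def B1 : K15 → P4
  | .inl i => X 0 ^ (i : ℕ)
  | .inr (.inl i) => X 0 ^ (i : ℕ) * X 1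
  | .inr (.inr i) => X 0 ^ (i : ℕ) * X 1 ^ 2

/-- The basic invariants of `H3` (plus a free variable), in terms of squares. -/
noncomputable def f1 : Fin 4 → P4 :=
  ![X 3, X 0 + X 1 + X 2, uF (C gr) (X 0) (X 1) (X 2), tF (C gr) (X 0) (X 1) (X 2)]

theorem span1 (p : P4) :
    ∃ (x : K15 → ℝ) (y : Fin 4 → P4), p = ∑ i, x i • B1 i + ∑ i, y i * f1 i := by
  apply span_of_quot
  intro Q _ _ π hf
  set N := Submodule.span ℝ (Set.range fun j => π (B1 j)) with hN
  have hs : π (X 3) = 0 := hf 0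
  have hv : π (X 2) = - π (X 0) - π (X 1) := by
    have : π (X 0 + X 1 + X 2) = 0 := hf 1
    rw [map_add, map_add] at this
    linear_combination this
  have hu : uF (π (C gr)) (π (X 0)) (π (X 1)) (π (X 2)) = 0 :=
    (map_uF π _ _ _ _).symm.trans (hf 2)
  have ht : tF (π (C gr)) (π (X 0)) (π (X 1)) (π (X 2)) = 0 :=
    (map_tF π _ _ _ _).symm.trans (hf 3)
  rw [hv] at hu ht
  have hg : π (C gr) ^ 2 = π (C gr) + 1 := by
    rw [← map_pow, ← map_one π, ← map_add, ← C_pow, gr_sq, C_add, C_1]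
  obtain ⟨h0, h1, h2, h3⟩ := rels1 _ _ _ hg hu ht
  have hsm : ∀ (r s : ℤ) (q : Q), q ∈ N → ((r : Q) + (s : Q) * π (C gr)) * q ∈ N := by
    intro r s q hq
    have h1 := N.smul_mem ((r : ℝ) + s * gr) hq
    rw [Algebra.smul_def, map_add, map_mul, map_intCast, map_intCast] at h1
    have : π (C gr) = algebraMap ℝ Q gr := by
      rw [← algebraMap_eq, AlgHom.commutes]
    rwa [this]
  have k1 : ∀ i < 7, π (X 0) ^ (i : ℕ) * 1 ∈ N := fun i hi =>
    Submodule.subset_span ⟨.inl ⟨i, hi⟩, by simp [B1]⟩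
  have k2 : ∀ i < 5, π (X 0) ^ (i : ℕ) * π (X 1) ∈ N :=
    fun i hi => Submodule.subset_span ⟨.inr (.inl ⟨i, hi⟩), by simp [B1]⟩
  have k3 : ∀ i < 3, π (X 0) ^ (i : ℕ) * π (X 1) ^ 2 ∈ N :=
    fun i hi => Submodule.subset_span ⟨.inr (.inr ⟨i, hi⟩), by simp [B1]⟩
  have hB : ∀ (g : Q) (_ : ∀ i, g * (π (X 0) ^ (i : ℕ) * 1) ∈ N)
      (_ : ∀ i, g * (π (X 0) ^ (i : ℕ) * π (X 1)) ∈ N)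
      (_ : ∀ i, g * (π (X 0) ^ (i : ℕ) * π (X 1) ^ 2) ∈ N), ∀ j, g * π (B1 j) ∈ N := by
    intro g g1 g2 g3 j
    rcases j with j | j | j
    · have := g1 j; simpa [B1] using this
    · have := g2 j; simpa [B1] using this
    · have := g3 j; simpa [B1] using this
  refine ⟨by have := k1 0 (by norm_num); simpa using this, ?_⟩
  suffices hs : ∀ i j, π (X i) * π (B1 j) ∈ N by
    intro i j; rw [map_mul]; exact hs i j
  generalize hxx : π (X 0) = x at *
  generalize hyx : π (X 1) = y at *
  generalize π (C gr) = g at *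
  have l1 := mem_of_pow N x 1 7 k1 (fun i => by rw [pow_add, h3]; simp)
  have l2 := mem_of_pow N x y 5 k2 (fun i => by
    apply mem_of_nat_mul N 13 (by norm_num)
    have : ((13 : ℕ) : Q) * (x ^ (i + 5) * y) = ((-7 : ℤ) + ((1 : ℤ) : Q) * g) * (x ^ (i + 6) * 1) := by
      push_cast; linear_combination x ^ i * h2
    rw [this]; exact hsm _ _ _ (l1 _))
  have l3 := mem_of_pow N x (y ^ 2) 3 k3 (fun i => by
    apply mem_of_nat_mul N 44 (by norm_num)
    have : ((44 : ℕ) : Q) * (x ^ (i + 3) * y ^ 2) =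
        ((-33 : ℤ) + ((-22 : ℤ) : Q) * g) * (x ^ (i + 4) * y) +
        ((3 : ℤ) + ((-11 : ℤ) : Q) * g) * (x ^ (i + 5) * 1) := by
      push_cast; linear_combination x ^ i * h1
    rw [this]; exact N.add_mem (hsm _ _ _ (l2 _)) (hsm _ _ _ (l1 _)))
  have l4 : ∀ i, x ^ i * y ^ 3 ∈ N := fun i => by
    apply mem_of_nat_mul N 5 (by norm_num)
    have : ((5 : ℕ) : Q) * (x ^ i * y ^ 3) =
        ((-13 : ℤ) + ((11 : ℤ) : Q) * g) * (x ^ (i + 1) * y ^ 2) +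
        ((2 : ℤ) + ((11 : ℤ) : Q) * g) * (x ^ (i + 2) * y) +
        ((5 : ℤ) + ((0 : ℤ) : Q) * g) * (x ^ (i + 3) * 1) := by
      push_cast; linear_combination x ^ i * h0
    rw [this]
    exact N.add_mem (N.add_mem (hsm _ _ _ (l3 _)) (hsm _ _ _ (l2 _))) (hsm _ _ _ (l1 _))
  have rx : ∀ j, x * π (B1 j) ∈ N := by
    refine hB _ ?_ ?_ ?_
    · intro i; have := l1 (i + 1); rwa [pow_succ', mul_assoc] at this
    · intro i; have := l2 (i + 1); rwa [pow_succ', mul_assoc] at this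
    · intro i; have := l3 (i + 1); rwa [pow_succ', mul_assoc] at this
  have ry : ∀ j, y * π (B1 j) ∈ N := by
    refine hB _ ?_ ?_ ?_
    · intro i; have := l2 i; rwa [show y * (x ^ i * 1) = x ^ i * y by ring]
    · intro i; have := l3 i; rwa [show y * (x ^ i * y) = x ^ i * y ^ 2 by ring]
    · intro i; have := l4 i; rwa [show y * (x ^ i * y ^ 2) = x ^ i * y ^ 3 by ring]
  intro i j
  fin_cases i
  · change π (X 0) * _ ∈ N
    rw [hxx]; exact rx j
  · change π (X 1) * _ ∈ N
    rw [hyx]; exact ry j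
  · change π (X 2) * _ ∈ N
    rw [hv, sub_mul, neg_mul]
    exact N.sub_mem (N.neg_mem (rx j)) (ry j)
  · simp [hs]

/-- Weights. -/
def w1 : Fin 4 → ℕ := ![1, 1, 1, 1]

/-- Degrees. -/
def d1 : Fin 4 → ℕ := ![1, 1, 3, 5]

theorem f1_hom (i : Fin 4) : IsWeightedHomogeneous w1 (f1 i) (d1 i) := by
  apply wh_of_scale
  have h0 : scale w1 (X 0) = Polynomial.X * Polynomial.C (X 0) := by simp [scale, w1]
  have h1 : scale w1 (X 1) = Polynomial.X * Polynomial.C (X 1) := by simp [scale, w1]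
  have h2 : scale w1 (X 2) = Polynomial.X * Polynomial.C (X 2) := by simp [scale, w1]
  have h3 : scale w1 (X 3) = Polynomial.X * Polynomial.C (X 3) := by simp [scale, w1]
  have h4 : scale w1 (C gr) = Polynomial.C (C gr) := by
    rw [scale, aeval_C]; rfl
  fin_cases i
  · change scale w1 (X 3) = Polynomial.X ^ 1 * Polynomial.C (X 3)
    rw [h3, pow_one]
  · change scale w1 (X 0 + X 1 + X 2) = Polynomial.X ^ 1 * Polynomial.C (X 0 + X 1 + X 2)
    rw [map_add, map_add, h0, h1, h2, map_add, map_add]; ring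
  · change scale w1 (uF _ _ _ _) = Polynomial.X ^ 3 * Polynomial.C (uF _ _ _ _)
    rw [map_uF, map_uF, h0, h1, h2, h4, scale_uF]
  · change scale w1 (tF _ _ _ _) = Polynomial.X ^ 5 * Polynomial.C (tF _ _ _ _)
    rw [map_tF, map_tF, h0, h1, h2, h4, scale_tF]

theorem B1_hom (j : K15) : ∃ d, IsWeightedHomogeneous w1 (B1 j) d := by
  have hX := fun i => isWeightedHomogeneous_X ℝ w1 i
  rcases j with j | j | j
  · exact ⟨_, (hX 0).pow _⟩
  · exact ⟨_, ((hX 0).pow _).mul (hX 1)⟩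
  · exact ⟨_, ((hX 0).pow _).mul ((hX 1).pow 2)⟩

/-- The algebra generated by the basic invariants of `H3`. -/
noncomputable abbrev A1 : Subalgebra ℝ P4 := Algebra.adjoin ℝ (Set.range f1)

theorem span1' (p : P4) : p ∈ Submodule.span A1 (Set.range B1) := by
  choose dB hB using B1_hom
  exact graded_nakayama f1 d1 (by decide) f1_hom B1 dB hB span1 p

theorem algInd1 : AlgebraicIndependent ℝ f1 :=
  algInd_of_integral f1 (integral_of_span A1 B1 span1')

/-- Partial derivatives of `uF`. -/
def uX {R : Type*} [CommRing R] (g x y z : R) : R := 4*y*z - g*(2*x*y+z^2) + (g-1)*(2*x*z+y^2)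
/-- Partial derivatives of `uF`. -/
def uY {R : Type*} [CommRing R] (g x y z : R) : R := 4*x*z - g*(x^2+2*y*z) + (g-1)*(2*y*x+z^2)
/-- Partial derivatives of `uF`. -/
def uZ {R : Type*} [CommRing R] (g x y z : R) : R := 4*x*y - g*(y^2+2*z*x) + (g-1)*(x^2+2*z*y)
/-- Partial derivatives of `tF`. -/
def tX {R : Type*} [CommRing R] (g x y z : R) : R :=
  uX g x y z ^ 2 + 2*(x * uX g x y z * (-2*g*y+2*(g-1)*z) + y * uY g x y z * (4*z-2*g*x+2*(g-1)*y)
    + z * uZ g x y z * (4*y-2*g*z+2*(g-1)*x))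
/-- Partial derivatives of `tF`. -/
def tY {R : Type*} [CommRing R] (g x y z : R) : R :=
  uY g x y z ^ 2 + 2*(x * uX g x y z * (4*z-2*g*x+2*(g-1)*y) + y * uY g x y z * (-2*g*z+2*(g-1)*x)
    + z * uZ g x y z * (4*x-2*g*y+2*(g-1)*z))
/-- Partial derivatives of `tF`. -/
def tZ {R : Type*} [CommRing R] (g x y z : R) : R :=
  uZ g x y z ^ 2 + 2*(x * uX g x y z * (4*y-2*g*z+2*(g-1)*x) + y * uY g x y z * (4*x-2*g*y+2*(g-1)*z)
    + z * uZ g x y z * (-2*g*x+2*(g-1)*y))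

theorem uF_m3 {R : Type*} [CommRing R] (g x y z : R) (hg : g^2 = g + 1) :
    uF g ((g*x+(g-1)*y-z)^2) (((g-1)*x+y+g*z)^2) ((-x+g*y+(1-g)*z)^2)
      = 64 * uF g (x^2) (y^2) (z^2) := by
  simp only [uF]
  linear_combination (-3*x^6*g^4 + 6*x^6*g^3 - 3*x^6*g + x^6 - 2*x^5*y*g^5 - 8*x^5*y*g^3
    + 4*x^5*y*g^2 + 4*x^5*y*g - 2*x^5*y + 2*x^5*z*g^5 - 10*x^5*z*g^4 + 28*x^5*z*g^3
    - 40*x^5*z*g^2 + 22*x^5*z*g - 4*x^5*z - 5*x^4*y^2*g^5 + 11*x^4*y^2*g^4 - 28*x^4*y^2*g^3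
    + 10*x^4*y^2*g^2 - 47*x^4*y^2*g - 2*x^4*y^2 - 2*x^4*y*z*g^4 + 4*x^4*y*z*g^3 + 12*x^4*y*z*g^2
    - 14*x^4*y*z*g + 2*x^4*y*z + 5*x^4*z^2*g^5 - 14*x^4*z^2*g^4 + 34*x^4*z^2*g^3 - 58*x^4*z^2*g^2
    + 92*x^4*z^2*g - 61*x^4*z^2 - 4*x^3*y^3*g^4 + 8*x^3*y^3*g^3 + 8*x^3*y^3*g^2 - 12*x^3*y^3*g
    + 4*x^3*y^3 - 20*x^3*y^2*z*g^5 + 64*x^3*y^2*z*g^4 - 96*x^3*y^2*z*g^3 + 88*x^3*y^2*z*g^2 - 40*x^3*y^2*z*g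
    + 12*x^3*y^2*z + 20*x^3*y*z^2*g^5 - 36*x^3*y*z^2*g^4 + 40*x^3*y*z^2*g^3 - 16*x^3*y*z^2*g^2 - 4*x^3*y*z^2*g
    + 8*x^3*y*z^2 - 4*x^3*z^3*g^4 + 8*x^3*z^3*g^3 + 8*x^3*z^3*g^2 - 12*x^3*z^3*g + 4*x^3*z^3
    + 5*x^2*y^4*g^5 - 14*x^2*y^4*g^4 + 34*x^2*y^4*g^3 - 58*x^2*y^4*g^2 + 92*x^2*y^4*g - 61*x^2*y^4
    - 20*x^2*y^3*z*g^5 + 36*x^2*y^3*z*g^4 - 40*x^2*y^3*z*g^3 + 16*x^2*y^3*z*g^2 + 4*x^2*y^3*z*g - 8*x^2*y^3*z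
    + 66*x^2*y^2*z^2*g^4 - 132*x^2*y^2*z^2*g^3 + 240*x^2*y^2*z^2*g^2 - 174*x^2*y^2*z^2*g + 234*x^2*y^2*z^2 + 20*x^2*y*z^3*g^5
    - 64*x^2*y*z^3*g^4 + 96*x^2*y*z^3*g^3 - 88*x^2*y*z^3*g^2 + 40*x^2*y*z^3*g - 12*x^2*y*z^3 - 5*x^2*z^4*g^5
    + 11*x^2*z^4*g^4 - 28*x^2*z^4*g^3 + 10*x^2*z^4*g^2 - 47*x^2*z^4*g - 2*x^2*z^4 + 2*x*y^5*g^5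
    - 10*x*y^5*g^4 + 28*x*y^5*g^3 - 40*x*y^5*g^2 + 22*x*y^5*g - 4*x*y^5 + 2*x*y^4*z*g^4
    - 4*x*y^4*z*g^3 - 12*x*y^4*z*g^2 + 14*x*y^4*z*g - 2*x*y^4*z - 20*x*y^3*z^2*g^5 + 64*x*y^3*z^2*g^4
    - 96*x*y^3*z^2*g^3 + 88*x*y^3*z^2*g^2 - 40*x*y^3*z^2*g + 12*x*y^3*z^2 + 20*x*y^2*z^3*g^5 - 36*x*y^2*z^3*g^4
    + 40*x*y^2*z^3*g^3 - 16*x*y^2*z^3*g^2 - 4*x*y^2*z^3*g + 8*x*y^2*z^3 + 2*x*y*z^4*g^4 - 4*x*y*z^4*g^3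
    - 12*x*y*z^4*g^2 + 14*x*y*z^4*g - 2*x*y*z^4 - 2*x*z^5*g^5 - 8*x*z^5*g^3 + 4*x*z^5*g^2
    + 4*x*z^5*g - 2*x*z^5 - 3*y^6*g^4 + 6*y^6*g^3 - 3*y^6*g + y^6
    + 2*y^5*z*g^5 + 8*y^5*z*g^3 - 4*y^5*z*g^2 - 4*y^5*z*g + 2*y^5*z - 5*y^4*z^2*g^5
    + 11*y^4*z^2*g^4 - 28*y^4*z^2*g^3 + 10*y^4*z^2*g^2 - 47*y^4*z^2*g - 2*y^4*z^2 + 4*y^3*z^3*g^4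
    - 8*y^3*z^3*g^3 - 8*y^3*z^3*g^2 + 12*y^3*z^3*g - 4*y^3*z^3 + 5*y^2*z^4*g^5 - 14*y^2*z^4*g^4
    + 34*y^2*z^4*g^3 - 58*y^2*z^4*g^2 + 92*y^2*z^4*g - 61*y^2*z^4 - 2*y*z^5*g^5 + 10*y*z^5*g^4
    - 28*y*z^5*g^3 + 40*y*z^5*g^2 - 22*y*z^5*g + 4*y*z^5 - 3*z^6*g^4 + 6*z^6*g^3
    - 3*z^6*g + z^6) * hg

theorem bF_m4 {R : Type*} [CommRing R] (g x y z w : R) (hg : g^2 = g + 1) :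
    bF (x+y+z+w) (z+w+x) (uF g z w x) (tF g z w x)
      = bF (x+y+z+w) (x+y+z) (uF g x y z) (tF g x y z) := by
  simp only [bF, uF, tF]
  linear_combination (-x^5*y + x^5*w + 2*x^4*y^2 - 11*x^4*y*z + 11*x^4*z*w - 2*x^4*w^2
    - 6*x^3*y^3 + 8*x^3*y^2*z + 8*x^3*y*z^2 - 8*x^3*z^2*w - 8*x^3*z*w^2 + 6*x^3*w^3
    + 2*x^2*y^4 + 8*x^2*y^3*z - 36*x^2*y^2*z^2 + 66*x^2*y^2*z*w + 8*x^2*y*z^3 - 66*x^2*y*z*w^2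
    - 8*x^2*z^3*w + 36*x^2*z^2*w^2 - 8*x^2*z*w^3 - 2*x^2*w^4 - x*y^5 + 11*x*y^4*w
    + 8*x*y^3*z^2 - 88*x*y^3*z*w + 8*x*y^2*z^3 + 66*x*y^2*z^2*w - 11*x*y*z^4 - 66*x*y*z^2*w^2
    + 88*x*y*z*w^3 - 11*x*y*w^4 + 11*x*z^4*w - 8*x*z^3*w^2 - 8*x*z^2*w^3 + x*w^5
    - y^5*z + 2*y^4*z^2 + 11*y^4*z*w - 6*y^3*z^3 + 2*y^2*z^4 - y*z^5
    - 11*y*z*w^4 + z^5*w - 2*z^4*w^2 + 6*z^3*w^3 - 2*z^2*w^4 + z*w^5) * hg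

theorem gam_ut {R : Type*} [CommRing R] (g x y z : R) (hg : g^2 = g + 1) :
    x * uX g x y z * tX g x y z + y * uY g x y z * tY g x y z + z * uZ g x y z * tZ g x y z
      = - tF g x y z * (x+y+z)^2 - 13 * uF g x y z ^2 * (x+y+z) + uF g x y z * (x+y+z)^4 := by
  simp only [uF, tF, uX, uY, uZ, tX, tY, tZ]
  linear_combination (-x^6*y*g + x^6*z*g - x^6*z - 6*x^5*y^2*g - x^5*y^2 - 6*x^5*y*z
    + 6*x^5*z^2*g - 7*x^5*z^2 + 4*x^4*y^3*g - 8*x^4*y^3 + 27*x^4*y^2*z*g + 15*x^4*y^2*z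
    - 27*x^4*y*z^2*g + 42*x^4*y*z^2 - 4*x^4*z^3*g - 4*x^4*z^3 - 4*x^3*y^4*g - 4*x^3*y^4
    + 22*x^3*y^3*z - 52*x^3*y^2*z^2 + 22*x^3*y*z^3 + 4*x^3*z^4*g - 8*x^3*z^4 + 6*x^2*y^5*g
    - 7*x^2*y^5 - 27*x^2*y^4*z*g + 42*x^2*y^4*z - 52*x^2*y^3*z^2 - 52*x^2*y^2*z^3 + 27*x^2*y*z^4*g
    + 15*x^2*y*z^4 - 6*x^2*z^5*g - x^2*z^5 + x*y^6*g - x*y^6 - 6*x*y^5*z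
    + 27*x*y^4*z^2*g + 15*x*y^4*z^2 + 22*x*y^3*z^3 - 27*x*y^2*z^4*g + 42*x*y^2*z^4 - 6*x*y*z^5
    - x*z^6*g - y^6*z*g - 6*y^5*z^2*g - y^5*z^2 + 4*y^4*z^3*g - 8*y^4*z^3
    - 4*y^3*z^4*g - 4*y^3*z^4 + 6*y^2*z^5*g - 7*y^2*z^5 + y*z^6*g - y*z^6) * hg

set_option maxHeartbeats 2000000 in
theorem gam_tt {R : Type*} [CommRing R] (g x y z : R) (hg : g^2 = g + 1) :
    x * tX g x y z ^ 2 + y * tY g x y z ^ 2 + z * tZ g x y z ^ 2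
      = - 15 * uF g x y z ^ 3 + 2 * tF g x y z * (x+y+z)^4 - 20 * tF g x y z * uF g x y z * (x+y+z)
        + 19 * uF g x y z ^ 2 * (x+y+z)^3 - uF g x y z * (x+y+z)^6 := by
  simp only [uF, tF, uX, uY, uZ, tX, tY, tZ]
  linear_combination (x^8*y*g^2 + x^8*y*g + x^8*z*g^2 - 3*x^8*z*g + 2*x^8*z + 16*x^7*y^2*g^2
    + 12*x^7*y^2*g + x^7*y^2 + 10*x^7*y*z + 16*x^7*z^2*g^2 - 44*x^7*z^2*g + 29*x^7*z^2
    + 57*x^6*y^3*g + 14*x^6*y^3 - 92*x^6*y^2*z*g^2 + 85*x^6*y^2*z*g - 61*x^6*y^2*z - 92*x^6*y*z^2*g^2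
    + 99*x^6*y*z^2*g - 68*x^6*y*z^2 - 57*x^6*z^3*g + 71*x^6*z^3 + 8*x^5*y^4*g^2 - 7*x^5*y^4*g
    + 68*x^5*y^4 - 64*x^5*y^3*z*g^2 - 318*x^5*y^3*z*g + 60*x^5*y^3*z + 432*x^5*y^2*z^2*g^2 - 432*x^5*y^2*z^2*g
    + 93*x^5*y^2*z^2 - 64*x^5*y*z^3*g^2 + 446*x^5*y*z^3*g - 322*x^5*y*z^3 + 8*x^5*z^4*g^2 - 9*x^5*z^4*g
    + 69*x^5*z^4 + 8*x^4*y^5*g^2 - 9*x^4*y^5*g + 69*x^4*y^5 + 54*x^4*y^4*z*g^2 - 54*x^4*y^4*z*g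
    - 415*x^4*y^4*z - 112*x^4*y^3*z^2*g^2 + 653*x^4*y^3*z^2*g + 52*x^4*y^3*z^2 - 112*x^4*y^2*z^3*g^2 - 429*x^4*y^2*z^3*g
    + 593*x^4*y^2*z^3 + 54*x^4*y*z^4*g^2 - 54*x^4*y*z^4*g - 415*x^4*y*z^4 + 8*x^4*z^5*g^2 - 7*x^4*z^5*g
    + 68*x^4*z^5 - 57*x^3*y^6*g + 71*x^3*y^6 - 64*x^3*y^5*z*g^2 + 446*x^3*y^5*z*g - 322*x^3*y^5*z
    - 112*x^3*y^4*z^2*g^2 - 429*x^3*y^4*z^2*g + 593*x^3*y^4*z^2 - 588*x^3*y^3*z^3 - 112*x^3*y^2*z^4*g^2 + 653*x^3*y^2*z^4*g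
    + 52*x^3*y^2*z^4 - 64*x^3*y*z^5*g^2 - 318*x^3*y*z^5*g + 60*x^3*y*z^5 + 57*x^3*z^6*g + 14*x^3*z^6
    + 16*x^2*y^7*g^2 - 44*x^2*y^7*g + 29*x^2*y^7 - 92*x^2*y^6*z*g^2 + 99*x^2*y^6*z*g - 68*x^2*y^6*z
    + 432*x^2*y^5*z^2*g^2 - 432*x^2*y^5*z^2*g + 93*x^2*y^5*z^2 - 112*x^2*y^4*z^3*g^2 + 653*x^2*y^4*z^3*g + 52*x^2*y^4*z^3
    - 112*x^2*y^3*z^4*g^2 - 429*x^2*y^3*z^4*g + 593*x^2*y^3*z^4 + 432*x^2*y^2*z^5*g^2 - 432*x^2*y^2*z^5*g + 93*x^2*y^2*z^5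
    - 92*x^2*y*z^6*g^2 + 85*x^2*y*z^6*g - 61*x^2*y*z^6 + 16*x^2*z^7*g^2 + 12*x^2*z^7*g + x^2*z^7
    + x*y^8*g^2 - 3*x*y^8*g + 2*x*y^8 + 10*x*y^7*z - 92*x*y^6*z^2*g^2 + 85*x*y^6*z^2*g
    - 61*x*y^6*z^2 - 64*x*y^5*z^3*g^2 - 318*x*y^5*z^3*g + 60*x*y^5*z^3 + 54*x*y^4*z^4*g^2 - 54*x*y^4*z^4*g
    - 415*x*y^4*z^4 - 64*x*y^3*z^5*g^2 + 446*x*y^3*z^5*g - 322*x*y^3*z^5 - 92*x*y^2*z^6*g^2 + 99*x*y^2*z^6*g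
    - 68*x*y^2*z^6 + 10*x*y*z^7 + x*z^8*g^2 + x*z^8*g + y^8*z*g^2 + y^8*z*g
    + 16*y^7*z^2*g^2 + 12*y^7*z^2*g + y^7*z^2 + 57*y^6*z^3*g + 14*y^6*z^3 + 8*y^5*z^4*g^2
    - 7*y^5*z^4*g + 68*y^5*z^4 + 8*y^4*z^5*g^2 - 9*y^4*z^5*g + 69*y^4*z^5 - 57*y^3*z^6*g
    + 71*y^3*z^6 + 16*y^2*z^7*g^2 - 44*y^2*z^7*g + 29*y^2*z^7 + y*z^8*g^2 - 3*y*z^8*g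
    + 2*y*z^8) * hg

theorem gam_uu {R : Type*} [CommRing R] (g x y z : R) :
    x * uX g x y z ^ 2 + y * uY g x y z ^ 2 + z * uZ g x y z ^ 2 = tF g x y z := by
  simp only [tF, uX, uY, uZ]

theorem euler_u {R : Type*} [CommRing R] (g x y z : R) :
    x * uX g x y z + y * uY g x y z + z * uZ g x y z = 3 * uF g x y z := by
  simp only [uF, uX, uY, uZ]; ring

theorem euler_t {R : Type*} [CommRing R] (g x y z : R) :
    x * tX g x y z + y * tY g x y z + z * tZ g x y z = 5 * tF g x y z := by
  simp only [tF, uX, uY, uZ, tX, tY, tZ]; ring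

/-- Partial derivative of `bF`. -/
def ba {R : Type*} [CommRing R] (a v u t : R) : R :=
    5*a^4*v - 32*a^3*v^2 + 87*a^2*v^3 + 99*a^2*u - 104*a*v^4 - 264*a*v*u
    + 45*v^5 + 154*v^2*u - 11*t

/-- Partial derivative of `bF`. -/
def bv {R : Type*} [CommRing R] (a v u t : R) : R :=
    a^5 - 16*a^4*v + 87*a^3*v^2 - 208*a^2*v^3 - 132*a^2*u + 225*a*v^4
    + 308*a*v*u - 90*v^5 - 162*v^2*u + 12*t

/-- Partial derivative of `bF`. -/
def bu {R : Type*} [CommRing R] (a v u t : R) : R :=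
    33*a^3 - 132*a^2*v + 154*a*v^2 - 54*v^3 - 6*u

/-- Partial derivative of `bF`. -/
def bt {R : Type*} [CommRing R] (a v u t : R) : R :=
    -11*a + 12*v

/-- Partial derivative of `cF`. -/
def ca {R : Type*} [CommRing R] (a v u t : R) : R :=
    8*a^7*v^2 - 91*a^6*v^3 + 105*a^6*u + 444*a^5*v^4 - 1044*a^5*v*u - 1190*a^4*v^5
    + 5100*a^4*v^2*u + 450*a^4*t + 1904*a^3*v^6 - 13792*a^3*v^3*u - 2728*a^3*v*t + 1176*a^3*u^2
    - 1830*a^2*v^7 + 20292*a^2*v^4*u + 5928*a^2*v^2*t - 4446*a^2*v*u^2 + 980*a*v^8 - 15124*a*v^5*u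
    - 5548*a*v^3*t + 5928*a*v^2*u^2 + 228*a*u*t - 225*v^9 + 4465*v^6*u + 1900*v^4*t
    - 2679*v^3*u^2 - 228*v*u*t - 57*u^3

/-- Partial derivative of `cF`. -/
def cv {R : Type*} [CommRing R] (a v u t : R) : R :=
    2*a^8*v - 39*a^7*v^2 + 296*a^6*v^3 - 174*a^6*u - 1190*a^5*v^4 + 2040*a^5*v*u
    + 2856*a^4*v^5 - 10344*a^4*v^2*u - 682*a^4*t - 4270*a^3*v^6 + 27056*a^3*v^3*u + 3952*a^3*v*t
    - 1482*a^3*u^2 + 3920*a^2*v^7 - 37810*a^2*v^4*u - 8322*a^2*v^2*t + 5928*a^2*v*u^2 - 2025*a*v^8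
    + 26790*a*v^5*u + 7600*a*v^3*t - 8037*a*v^2*u^2 - 228*a*u*t + 450*v^9 - 7560*v^6*u
    - 2550*v^4*t + 3616*v^3*u^2 + 232*v*u*t + 60*u^3

/-- Partial derivative of `cF`. -/
def cu {R : Type*} [CommRing R] (a v u t : R) : R :=
    15*a^7 - 174*a^6*v + 1020*a^5*v^2 - 3448*a^4*v^3 + 588*a^4*u + 6764*a^3*v^4
    - 2964*a^3*v*u - 7562*a^2*v^5 + 5928*a^2*v^2*u + 114*a^2*t + 4465*a*v^6 - 5358*a*v^3*u
    - 228*a*v*t - 171*a*u^2 - 1080*v^7 + 1808*v^4*u + 116*v^2*t + 180*v*u^2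

/-- Partial derivative of `cF`. -/
def ct {R : Type*} [CommRing R] (a v u t : R) : R :=
    90*a^5 - 682*a^4*v + 1976*a^3*v^2 - 2774*a^2*v^3 + 114*a^2*u + 1900*a*v^4
    - 228*a*v*u - 510*v^5 + 116*v^2*u + 2*t

theorem der_uF (D : Derivation ℝ P4 P4) (r : ℝ) (x y z : P4) :
    D (uF (C r) x y z) = uX (C r) x y z * D x + uY (C r) x y z * D y + uZ (C r) x y z * D z := by
  have h : D (C r) = 0 := by rw [← algebraMap_eq, D.map_algebraMap]
  have h1 : D 1 = 0 := D.map_one_eq_zero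
  have hn : ∀ n : ℕ, [n.AtLeastTwo] → D (ofNat(n)) = 0 := fun n _ => D.map_natCast n
  simp only [uF, uX, uY, uZ, map_add, map_sub, D.leibniz, D.leibniz_pow, smul_eq_mul, h, h1, hn,
    nsmul_eq_mul]
  push_cast
  ring

theorem der_tF (D : Derivation ℝ P4 P4) (r : ℝ) (x y z : P4) :
    D (tF (C r) x y z) = tX (C r) x y z * D x + tY (C r) x y z * D y + tZ (C r) x y z * D z := by
  have h : D (C r) = 0 := by rw [← algebraMap_eq, D.map_algebraMap]
  have h1 : D 1 = 0 := D.map_one_eq_zero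
  have hn : ∀ n : ℕ, [n.AtLeastTwo] → D (ofNat(n)) = 0 := fun n _ => D.map_natCast n
  simp only [tF, tX, tY, tZ, uX, uY, uZ, map_add, map_sub, D.leibniz, D.leibniz_pow, smul_eq_mul,
    h, h1, hn, nsmul_eq_mul]
  push_cast
  ring

theorem der_bF (D : Derivation ℝ P4 P4) (a v u t : P4) :
    D (bF a v u t) = ba a v u t * D a + bv a v u t * D v + bu a v u t * D u + bt a v u t * D t := by
  have hn : ∀ n : ℕ, [n.AtLeastTwo] → D (ofNat(n)) = 0 := fun n _ => D.map_natCast n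
  simp only [bF, ba, bv, bu, bt, map_add, map_sub, D.leibniz, D.leibniz_pow, smul_eq_mul, hn,
    nsmul_eq_mul]
  push_cast
  ring

set_option maxHeartbeats 1000000 in
theorem der_cF (D : Derivation ℝ P4 P4) (a v u t : P4) :
    D (cF a v u t) = ca a v u t * D a + cv a v u t * D v + cu a v u t * D u + ct a v u t * D t := by
  have hn : ∀ n : ℕ, [n.AtLeastTwo] → D (ofNat(n)) = 0 := fun n _ => D.map_natCast n
  simp only [cF, ca, cv, cu, ct, map_add, map_sub, D.leibniz, D.leibniz_pow, smul_eq_mul, hn,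
    nsmul_eq_mul]
  push_cast
  ring

set_option maxHeartbeats 1000000 in
theorem gam_bb_id {R : Type*} [CommRing R] (a v u t : R) :
    4*a*((ba a v u t)*(ba a v u t)) + 4*v*((ba a v u t)*(bv a v u t)+(bv a v u t)*(ba a v u t)) + 12*u*((ba a v u t)*(bu a v u t)+(bu a v u t)*(ba a v u t))
      + 20*t*((ba a v u t)*(bt a v u t)+(bt a v u t)*(ba a v u t)) + 4*v*((bv a v u t)*(bv a v u t)) + 12*u*((bv a v u t)*(bu a v u t)+(bu a v u t)*(bv a v u t))
      + 20*t*((bv a v u t)*(bt a v u t)+(bt a v u t)*(bv a v u t)) + 4*t*((bu a v u t)*(bu a v u t))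
      + 4*(-t*v^2-13*u^2*v+u*v^4)*((bu a v u t)*(bt a v u t)+(bt a v u t)*(bu a v u t))
      + 4*(-15*u^3+2*t*v^4-20*t*u*v+19*u^2*v^3-u*v^6)*((bt a v u t)*(bt a v u t))
      = 44*a*cF a v u t + 4*a^5*bF a v u t := by
  simp only [bF, cF, ba, bv, bu, bt]; ring

set_option maxHeartbeats 4000000 in
theorem gam_bc_id {R : Type*} [CommRing R] (a v u t : R) :
    4*a*((ba a v u t)*(ca a v u t)) + 4*v*((ba a v u t)*(cv a v u t)+(bv a v u t)*(ca a v u t)) + 12*u*((ba a v u t)*(cu a v u t)+(bu a v u t)*(ca a v u t))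
      + 20*t*((ba a v u t)*(ct a v u t)+(bt a v u t)*(ca a v u t)) + 4*v*((bv a v u t)*(cv a v u t)) + 12*u*((bv a v u t)*(cu a v u t)+(bu a v u t)*(cv a v u t))
      + 20*t*((bv a v u t)*(ct a v u t)+(bt a v u t)*(cv a v u t)) + 4*t*((bu a v u t)*(cu a v u t))
      + 4*(-t*v^2-13*u^2*v+u*v^4)*((bu a v u t)*(ct a v u t)+(bt a v u t)*(cu a v u t))
      + 4*(-15*u^3+2*t*v^4-20*t*u*v+19*u^2*v^3-u*v^6)*((bt a v u t)*(ct a v u t))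
      = 4*eF a v u t + 8*a^5*cF a v u t + 4*a^3*(a^2*cF a v u t - bF a v u t^2) := by
  simp only [bF, cF, eF, ba, bv, bu, bt, ca, cv, cu, ct]; ring

/-- Linear substitution by a matrix. -/
noncomputable def act (M : Matrix (Fin 4) (Fin 4) ℝ) : P4 →ₐ[ℝ] P4 :=
  aeval fun i => ∑ j, M i j • (X j : P4)

/-- The linear form with coefficient vector `r`. -/
noncomputable def lin (r : Fin 4 → ℝ) : P4 := ∑ j, r j • (X j : P4)

theorem act_X (M : Matrix (Fin 4) (Fin 4) ℝ) (i : Fin 4) : act M (X i) = lin (M i) := by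
  rw [act, aeval_X, lin]

theorem act_lin (M : Matrix (Fin 4) (Fin 4) ℝ) (r : Fin 4 → ℝ) : act M (lin r) = lin (r ᵥ* M) := by
  simp only [lin, map_sum, map_smul, act_X, vecMul, dotProduct, Finset.smul_sum, Finset.sum_smul,
    smul_smul]
  rw [Finset.sum_comm]

theorem act_mul (M N : Matrix (Fin 4) (Fin 4) ℝ) (F : P4) : act N (act M F) = act (M * N) F := by
  have : (act N).comp (act M) = act (M * N) := by
    apply MvPolynomial.algHom_ext
    intro i
    rw [AlgHom.comp_apply, act_X, act_X, act_lin]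
    rfl
  rw [← this]; rfl

theorem act_one (F : P4) : act 1 F = F := by
  have : act 1 = AlgHom.id ℝ P4 := by
    apply MvPolynomial.algHom_ext
    intro i
    rw [act_X, AlgHom.id_apply, lin]
    simp [Matrix.one_apply, ite_smul]
  rw [this]; rfl

theorem polyActR_eq (g : GL (Fin 4) ℝ) (F : P4) :
    polyActR g F = act ((g⁻¹ : GL (Fin 4) ℝ) : Matrix (Fin 4) (Fin 4) ℝ) F := rfl

/-- `F` is fixed by all four generators. -/
def FixG (F : P4) : Prop := act m1 F = F ∧ act m2 F = F ∧ act m3 F = F ∧ act m4 F = F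

/-- The polynomials fixed by a given substitution. -/
noncomputable def fixedBy (M : Matrix (Fin 4) (Fin 4) ℝ) : Subalgebra ℝ P4 :=
  AlgHom.equalizer (act M) (AlgHom.id ℝ P4)

theorem mem_fixedBy (M : Matrix (Fin 4) (Fin 4) ℝ) (F : P4) : F ∈ fixedBy M ↔ act M F = F :=
  Iff.rfl

theorem polyActR_of_inv {F : P4} (h : FixG F) (g : GL (Fin 4) ℝ) (hg : g ∈ WH4) :
    polyActR g F = F := by
  have key : ∀ g ∈ WH4, act (g : Matrix (Fin 4) (Fin 4) ℝ) F = F := by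
    intro g hg
    induction hg using Subgroup.closure_induction with
    | mem x hx =>
      rcases hx with hx | hx | hx | hx <;> rw [hx]
      exacts [h.1, h.2.1, h.2.2.1, h.2.2.2]
    | one => rw [Units.val_one, act_one]
    | mul x y _ _ hx hy => rw [Units.val_mul, ← act_mul, hx, hy]
    | inv x _ hx =>
      conv_lhs => rw [← hx]
      rw [act_mul, ← Units.val_mul, mul_inv_cancel, Units.val_one, act_one]
  rw [polyActR_eq]
  exact key _ (WH4.inv_mem hg)

theorem m1_sq : m1 * m1 = 1 := by
  ext i j; rw [Matrix.mul_apply, Fin.sum_univ_four]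
  fin_cases i <;> fin_cases j <;> simp [m1]

theorem m2_sq : m2 * m2 = 1 := by
  ext i j; rw [Matrix.mul_apply, Fin.sum_univ_four]
  fin_cases i <;> fin_cases j <;> simp [m2]

theorem m3_sq : m3 * m3 = 1 := by
  have h := gr_sq
  ext i j; rw [Matrix.mul_apply, Fin.sum_univ_four]
  fin_cases i <;> fin_cases j <;> simp [m3] <;>
    linarith

theorem m4_orth : m4 * m4ᵀ = 1 := by
  ext i j; rw [Matrix.mul_apply, Fin.sum_univ_four]
  simp only [Matrix.transpose_apply]
  fin_cases i <;> fin_cases j <;> simp [m4]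

theorem m3_symm : m3ᵀ = m3 := by
  ext i j; rw [Matrix.transpose_apply]
  fin_cases i <;> fin_cases j <;> simp [m3]

theorem inv_of_polyActR {F : P4} (h : ∀ g ∈ WH4, polyActR g F = F) : FixG F := by
  have key : ∀ M N : Matrix (Fin 4) (Fin 4) ℝ, M * N = 1 → (M = m1 ∨ M = m2 ∨ M = m3 ∨ M = m4) →
      act M F = F := by
    intro M N h1 hM
    have h2 : N * M = 1 := mul_eq_one_comm.mp h1
    let g : GL (Fin 4) ℝ := ⟨M, N, h1, h2⟩
    have hg : g ∈ WH4 := Subgroup.subset_closure hM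
    have := h g⁻¹ (WH4.inv_mem hg)
    rw [polyActR_eq, inv_inv] at this
    exact this
  exact ⟨key _ _ m1_sq (by simp), key _ _ m2_sq (by simp), key _ _ m3_sq (by simp),
    key _ _ m4_orth (by simp)⟩

/-- The carré du champ of the Laplacian. -/
noncomputable def Gam (f h : P4) : P4 := ∑ i, pderiv i f * pderiv i h

theorem pderiv_act (M : Matrix (Fin 4) (Fin 4) ℝ) (j : Fin 4) (f : P4) :
    pderiv j (act M f) = ∑ i, M i j • act M (pderiv i f) := by
  induction f using MvPolynomial.induction_on with
  | C r => simp
  | add p q hp hq => simp only [map_add, hp, hq, smul_add, Finset.sum_add_distrib]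
  | mul_X p k hp =>
    rw [map_mul, Derivation.leibniz, hp]
    simp only [Derivation.leibniz, map_add, smul_eq_mul, map_mul, smul_add,
      Finset.sum_add_distrib]
    congr 1
    · have h1 : pderiv j (act M (X k)) = C (M k j) := by
        rw [act_X, lin]
        simp [pderiv_X, Pi.single_apply, smul_eq_C_mul]
      rw [h1]
      simp [pderiv_X, Pi.single_apply, smul_eq_C_mul, apply_ite (act M)]
      ring
    · rw [Finset.mul_sum]
      refine Finset.sum_congr rfl fun i _ => ?_
      rw [mul_smul_comm]

theorem Gam_act (M : Matrix (Fin 4) (Fin 4) ℝ) (hM : M * Mᵀ = 1) (f h : P4) :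
    Gam (act M f) (act M h) = act M (Gam f h) := by
  simp only [Gam, pderiv_act, map_sum, map_mul]
  have : ∀ i k, ∑ j, M i j * M k j = if i = k then 1 else 0 := by
    intro i k
    have := congrFun (congrFun hM i) k
    rwa [Matrix.mul_apply, Matrix.one_apply] at this
  simp only [Finset.sum_mul_sum, smul_mul_smul_comm]
  rw [Finset.sum_comm]
  refine Finset.sum_congr rfl fun i _ => ?_
  rw [Finset.sum_comm]
  simp only [← Finset.sum_smul, this]
  simp

/-- Invariants as polynomials in the coordinates. -/
noncomputable def vS : P4 := X 0 ^ 2 + X 1 ^ 2 + X 2 ^ 2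
/-- Invariants as polynomials in the coordinates. -/
noncomputable def aS : P4 := X 0 ^ 2 + X 1 ^ 2 + X 2 ^ 2 + X 3 ^ 2
/-- Invariants as polynomials in the coordinates. -/
noncomputable def uS : P4 := uF (C gr) (X 0 ^ 2) (X 1 ^ 2) (X 2 ^ 2)
/-- Invariants as polynomials in the coordinates. -/
noncomputable def tS : P4 := tF (C gr) (X 0 ^ 2) (X 1 ^ 2) (X 2 ^ 2)
/-- Invariants as polynomials in the coordinates. -/
noncomputable def bS : P4 := bF aS vS uS tS
/-- Invariants as polynomials in the coordinates. -/
noncomputable def cS : P4 := cF aS vS uS tS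
/-- Invariants as polynomials in the coordinates. -/
noncomputable def eS : P4 := eF aS vS uS tS

theorem Cgr_sq : (C gr : P4) ^ 2 = C gr + 1 := by
  rw [← C_pow, gr_sq, C_add, C_1]

theorem act_C (M : Matrix (Fin 4) (Fin 4) ℝ) (r : ℝ) : act M (C r) = C r := by
  rw [← algebraMap_eq, AlgHom.commutes]

theorem act1 : act m1 (X 0) = - X 0 ∧ act m1 (X 1) = X 1 ∧ act m1 (X 2) = X 2 ∧
    act m1 (X 3) = X 3 := by
  refine ⟨?_, ?_, ?_, ?_⟩ <;> rw [act_X, lin, Fin.sum_univ_four] <;> simp [m1]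

theorem act2 : act m2 (X 0) = X 0 ∧ act m2 (X 1) = - X 1 ∧ act m2 (X 2) = X 2 ∧
    act m2 (X 3) = X 3 := by
  refine ⟨?_, ?_, ?_, ?_⟩ <;> rw [act_X, lin, Fin.sum_univ_four] <;> simp [m2]

theorem act4 : act m4 (X 0) = - X 2 ∧ act m4 (X 1) = X 3 ∧ act m4 (X 2) = X 0 ∧
    act m4 (X 3) = - X 1 := by
  refine ⟨?_, ?_, ?_, ?_⟩ <;> rw [act_X, lin, Fin.sum_univ_four] <;> simp [m4]

theorem act3 : act m3 (X 0) = C (1/2) * (C gr * X 0 + (C gr - 1) * X 1 - X 2) ∧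
    act m3 (X 1) = C (1/2) * ((C gr - 1) * X 0 + X 1 + C gr * X 2) ∧
    act m3 (X 2) = C (1/2) * (- X 0 + C gr * X 1 + (1 - C gr) * X 2) ∧
    act m3 (X 3) = X 3 := by
  have h2 : (C (2⁻¹ : ℝ) : P4) * 2 = 1 := by
    rw [show (2 : P4) = C 2 from (map_ofNat C 2).symm, ← C_mul]; norm_num
  refine ⟨?_, ?_, ?_, ?_⟩ <;> rw [act_X, lin, Fin.sum_univ_four] <;>
    simp [m3, smul_eq_C_mul] <;> ring

theorem fix_v1 : act m1 vS = vS := by simp [vS, act1]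
theorem fix_v2 : act m2 vS = vS := by simp [vS, act2]
theorem fix_a1 : act m1 aS = aS := by simp [aS, act1]
theorem fix_a2 : act m2 aS = aS := by simp [aS, act2]
theorem fix_u1 : act m1 uS = uS := by simp [uS, map_uF, act1, act_C]
theorem fix_u2 : act m2 uS = uS := by simp [uS, map_uF, act2, act_C]
theorem fix_t1 : act m1 tS = tS := by simp [tS, map_tF, act1, act_C]
theorem fix_t2 : act m2 tS = tS := by simp [tS, map_tF, act2, act_C]

theorem half_sq : (C (1/2 : ℝ) : P4) ^ 2 * 4 = 1 := by
  rw [show (4 : P4) = C 4 from (map_ofNat C 4).symm, ← C_pow, ← C_mul]; norm_num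

theorem fix_v3 : act m3 vS = vS := by
  simp only [vS, map_add, map_pow, act3]
  have h := Cgr_sq
  have h2 := half_sq
  generalize (C gr : P4) = g at *
  generalize (C (1/2) : P4) = k at *
  linear_combination k^2 * (2*X 0 ^ 2 + 2*X 1 ^ 2 + 2 * X 2 ^2 
    + 2 * X 0 * X 1 + 2 * X 0 * X 2 - 2 * X 1 * X 2) * h + (X 0 ^ 2 + X 1 ^ 2 + X 2 ^ 2) * h2

theorem fix_a3 : act m3 aS = aS := by
  have h : aS = vS + X 3 ^ 2 := rfl
  rw [h, map_add, fix_v3, map_pow, act3.2.2.2]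

theorem fix_u3 : act m3 uS = uS := by
  simp only [uS, map_uF, map_pow, act_C, act3, mul_pow]
  rw [scale_uF, uF_m3 _ _ _ _ Cgr_sq]
  have h2 := half_sq
  generalize (C (1/2) : P4) = k at *
  generalize uF (C gr : P4) _ _ _ = u
  linear_combination (16 * (k^2)^2 + 4 * k^2 + 1) * u * h2

theorem Gam_uu : Gam uS uS = 4 * tS := by
  simp only [Gam, Fin.sum_univ_four, uS, tS, der_uF, Derivation.leibniz_pow, pderiv_X]
  rw [← gam_uu]
  simp [Pi.single_apply]
  ring

theorem fix_t3 : act m3 tS = tS := by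
  have h : (4 : P4) * act m3 tS = 4 * tS := by
    rw [← Gam_uu, show (4 : P4) * act m3 tS = act m3 (4 * tS) by rw [map_mul, map_ofNat],
      ← Gam_uu, ← Gam_act m3 (by rw [m3_symm, m3_sq]), fix_u3]
  exact mul_left_cancel₀ (by norm_num) h


theorem Gam_list :
    Gam aS aS = 4 * aS ∧ Gam aS vS = 4 * vS ∧ Gam aS uS = 12 * uS ∧ Gam aS tS = 20 * tS ∧
    Gam vS vS = 4 * vS ∧ Gam vS uS = 12 * uS ∧ Gam vS tS = 20 * tS ∧
    Gam uS tS = 4 * (- tS * vS ^ 2 - 13 * uS ^ 2 * vS + uS * vS ^ 4) ∧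
    Gam tS tS = 4 * (-15*uS^3+2*tS*vS^4-20*tS*uS*vS+19*uS^2*vS^3-uS*vS^6) := by
  have e1 := euler_u (C gr) (X 0 ^ 2 : P4) (X 1 ^ 2) (X 2 ^ 2)
  have e2 := euler_t (C gr) (X 0 ^ 2 : P4) (X 1 ^ 2) (X 2 ^ 2)
  have e3 := gam_ut (C gr) (X 0 ^ 2 : P4) (X 1 ^ 2) (X 2 ^ 2) Cgr_sq
  have e4 := gam_tt (C gr) (X 0 ^ 2 : P4) (X 1 ^ 2) (X 2 ^ 2) Cgr_sq
  simp only [Gam, Fin.sum_univ_four, uS, tS, aS, vS, map_add, der_uF, der_tF,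
    Derivation.leibniz_pow, pderiv_X, nsmul_eq_mul, smul_eq_mul, Pi.single_apply, pow_one,
    Nat.add_one_sub_one, Nat.cast_ofNat, mul_zero, add_zero, zero_add, mul_one,
    Fin.reduceEq, if_true, if_false]
  refine ⟨?_, ?_, ?_, ?_, ?_, ?_, ?_, ?_, ?_⟩
  · ring
  · ring
  · linear_combination 4 * e1
  · linear_combination 4 * e2
  · ring
  · linear_combination 4 * e1
  · linear_combination 4 * e2
  · linear_combination 4 * e3
  · linear_combination 4 * e4

theorem Gam_symm (f h : P4) : Gam f h = Gam h f := by
  simp only [Gam, mul_comm]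

theorem Gam_expand {f h f1 f2 f3 f4 h1 h2 h3 h4 : P4}
    (hf : ∀ i, pderiv i f = f1 * pderiv i aS + f2 * pderiv i vS + f3 * pderiv i uS
      + f4 * pderiv i tS)
    (hh : ∀ i, pderiv i h = h1 * pderiv i aS + h2 * pderiv i vS + h3 * pderiv i uS
      + h4 * pderiv i tS) :
    Gam f h = 4*aS*(f1*h1) + 4*vS*(f1*h2+f2*h1) + 12*uS*(f1*h3+f3*h1)
      + 20*tS*(f1*h4+f4*h1) + 4*vS*(f2*h2) + 12*uS*(f2*h3+f3*h2)
      + 20*tS*(f2*h4+f4*h2) + 4*tS*(f3*h3)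
      + 4*(-tS*vS^2-13*uS^2*vS+uS*vS^4)*(f3*h4+f4*h3)
      + 4*(-15*uS^3+2*tS*vS^4-20*tS*uS*vS+19*uS^2*vS^3-uS*vS^6)*(f4*h4) := by
  obtain ⟨aa, av, au, at', vv, vu, vt, ut, tt⟩ := Gam_list
  have uu := Gam_uu
  rw [← ut, ← tt, ← uu]
  rw [show 4 * aS * (f1 * h1) = Gam aS aS * (f1 * h1) by rw [aa],
    show 4*vS*(f1*h2+f2*h1) = Gam aS vS * (f1*h2+f2*h1) by rw [av],
    show 12*uS*(f1*h3+f3*h1) = Gam aS uS * (f1*h3+f3*h1) by rw [au],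
    show 20*tS*(f1*h4+f4*h1) = Gam aS tS * (f1*h4+f4*h1) by rw [at'],
    show 4*vS*(f2*h2) = Gam vS vS * (f2 * h2) by rw [vv],
    show 12*uS*(f2*h3+f3*h2) = Gam vS uS * (f2*h3+f3*h2) by rw [vu],
    show 20*tS*(f2*h4+f4*h2) = Gam vS tS * (f2*h4+f4*h2) by rw [vt]]
  clear aa av au at' vv vu vt ut tt uu
  simp only [Gam, hf, hh, Fin.sum_univ_four]
  ring

theorem Gam_bb : Gam bS bS = 44 * aS * cS + 4 * aS ^ 5 * bS := by
  have hb : ∀ i, pderiv i bS = _ := fun i => der_bF (pderiv i) aS vS uS tS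
  rw [Gam_expand hb hb]
  exact gam_bb_id aS vS uS tS

theorem Gam_bc : Gam bS cS = 4 * eS + 8 * aS ^ 5 * cS + 4 * aS ^ 3 * (aS ^ 2 * cS - bS ^ 2) := by
  have hb : ∀ i, pderiv i bS = _ := fun i => der_bF (pderiv i) aS vS uS tS
  have hc : ∀ i, pderiv i cS = _ := fun i => der_cF (pderiv i) aS vS uS tS
  rw [Gam_expand hb hc]
  exact gam_bc_id aS vS uS tS

theorem fix_a4 : act m4 aS = aS := by
  simp only [aS, map_add, map_pow, act4]; ring

theorem fix_b4 : act m4 bS = bS := by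
  have h := bF_m4 (C gr) (X 0 ^ 2 : P4) (X 1 ^ 2) (X 2 ^ 2) (X 3 ^ 2) Cgr_sq
  have h1 : act m4 vS = X 2 ^ 2 + X 3 ^ 2 + X 0 ^ 2 := by
    simp only [vS, map_add, map_pow, act4]; ring
  have h2 : act m4 uS = uF (C gr) (X 2 ^ 2) (X 3 ^ 2) (X 0 ^ 2) := by
    simp only [uS, map_uF, act_C, map_pow, act4, neg_sq]
  have h3 : act m4 tS = tF (C gr) (X 2 ^ 2) (X 3 ^ 2) (X 0 ^ 2) := by
    simp only [tS, map_tF, act_C, map_pow, act4, neg_sq]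
  rw [bS, map_bF, h1, h2, h3, fix_a4]
  exact h

theorem aS_ne : aS ≠ 0 := by
  intro h
  have := congrArg (MvPolynomial.eval (fun _ => (1 : ℝ))) h
  simp [aS] at this
  norm_num at this

theorem fix_c4 : act m4 cS = cS := by
  have h : (44 * aS) * act m4 cS = (44 * aS) * cS := by
    have h1 := Gam_act m4 m4_orth bS bS
    rw [fix_b4, Gam_bb] at h1
    simp only [map_add, map_mul, map_pow, map_ofNat, fix_a4, fix_b4] at h1
    linear_combination -h1
  exact mul_left_cancel₀ (mul_ne_zero (by norm_num) aS_ne) h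

theorem fix_e4 : act m4 eS = eS := by
  have h : (4 : P4) * act m4 eS = 4 * eS := by
    have h1 := Gam_act m4 m4_orth bS cS
    rw [fix_b4, fix_c4, Gam_bc] at h1
    simp only [map_add, map_sub, map_mul, map_pow, map_ofNat, fix_a4, fix_b4, fix_c4] at h1
    linear_combination -h1
  exact mul_left_cancel₀ (by norm_num) h

theorem FixG_a : FixG aS := ⟨fix_a1, fix_a2, fix_a3, fix_a4⟩

theorem FixG_b : FixG bS := by
  refine ⟨?_, ?_, ?_, fix_b4⟩ <;> rw [bS, map_bF]
  · rw [fix_a1, fix_v1, fix_u1, fix_t1]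
  · rw [fix_a2, fix_v2, fix_u2, fix_t2]
  · rw [fix_a3, fix_v3, fix_u3, fix_t3]

theorem FixG_c : FixG cS := by
  refine ⟨?_, ?_, ?_, fix_c4⟩ <;> rw [cS, map_cF]
  · rw [fix_a1, fix_v1, fix_u1, fix_t1]
  · rw [fix_a2, fix_v2, fix_u2, fix_t2]
  · rw [fix_a3, fix_v3, fix_u3, fix_t3]

theorem FixG_e : FixG eS := by
  refine ⟨?_, ?_, ?_, fix_e4⟩ <;> rw [eS, map_eF]
  · rw [fix_a1, fix_v1, fix_u1, fix_t1]
  · rw [fix_a2, fix_v2, fix_u2, fix_t2]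
  · rw [fix_a3, fix_v3, fix_u3, fix_t3]

/-- Roots, doubled, with coordinates `α + β φ`. -/
def rtAL : List (List ℤ) := [
  [2, 0, 0, 0, 0, 0, 0, 0], [0, 1, -1, 1, -1, 0, 0, 0],
  [0, -1, -1, 1, -1, 0, 0, 0], [0, 1, 1, -1, -1, 0, 0, 0],
  [0, -1, 1, -1, -1, 0, 0, 0], [1, -1, -1, 0, 0, 1, 0, 0],
  [-1, 0, 0, -1, -1, 1, 0, 0], [-1, 1, -1, 0, 0, 1, 0, 0],
  [1, -1, 1, 0, 0, 1, 0, 0], [1, 0, 0, -1, -1, 1, 0, 0],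
  [-1, 0, 0, 1, -1, 1, 0, 0], [-1, 1, 1, 0, 0, 1, 0, 0],
  [1, 0, 0, 1, -1, 1, 0, 0], [0, 0, 0, 0, -2, 0, 0, 0],
  [0, 0, 2, 0, 0, 0, 0, 0]]

/-- Roots as functions. -/
def rtAR (i : Fin 15) (k : Fin 8) : ℤ := (rtAL.getD i []).getD k 0

/-- Predecessors in the orbit. -/
def rtAP (i : Fin 15) : Fin 15 := [
  0, 0, 1, 1, 2, 2, 4, 5, 5, 6, 6, 7, 9, 9, 11].getD i 0
/-- Generators used. -/
def rtAK (i : Fin 15) : Fin 4 := [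
  0, 2, 0, 1, 1, 2, 2, 0, 1, 0, 1, 1, 1, 2, 2].getD i 0

/-- Roots, doubled, with coordinates `α + β φ`. -/
def rtBL : List (List ℤ) := [
  [0, 0, 0, 0, 0, 0, 2, 0], [0, 0, -2, 0, 0, 0, 0, 0],
  [1, -1, -1, 0, 0, -1, 0, 0], [-1, 1, -1, 0, 0, -1, 0, 0],
  [1, -1, 1, 0, 0, -1, 0, 0], [0, -1, 0, 0, -1, 1, -1, 0],
  [-1, 1, 1, 0, 0, -1, 0, 0], [1, 0, 0, -1, 1, -1, 0, 0],
  [0, -1, 0, 0, 1, -1, -1, 0], [0, -1, 0, 0, -1, 1, 1, 0],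
  [0, 1, 0, 0, -1, 1, -1, 0], [0, 1, 1, -1, 1, 0, 0, 0],
  [-1, 0, 0, -1, 1, -1, 0, 0], [1, 0, 0, 1, 1, -1, 0, 0],
  [1, -1, 0, 0, -1, 0, 0, -1], [-1, 0, -1, 0, 1, 0, -1, 0],
  [1, 0, 1, 0, -1, 0, -1, 0], [0, -1, 1, -1, 1, 0, 0, 0],
  [0, 1, -1, 1, 1, 0, 0, 0], [1, 0, 0, 0, 0, -1, 1, -1],
  [-1, 0, 0, 1, 1, -1, 0, 0], [1, -1, 0, 0, 1, 0, 0, -1],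
  [1, -1, 0, 0, -1, 0, 0, 1], [-1, 1, 0, 0, -1, 0, 0, -1],
  [0, 0, -1, 0, -1, 1, 0, -1], [1, 0, -1, 0, 1, 0, -1, 0],
  [-1, 0, 1, 0, 1, 0, -1, 0], [1, 0, 1, 0, 1, 0, -1, 0],
  [-1, 0, 1, 0, -1, 0, -1, 0], [1, 0, -1, 0, -1, 0, -1, 0],
  [0, -1, -1, 1, 1, 0, 0, 0], [-2, 0, 0, 0, 0, 0, 0, 0],
  [1, 0, 0, 0, 0, 1, 1, -1], [1, 0, 0, 0, 0, -1, -1, 1],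
  [-1, 0, 0, 0, 0, -1, 1, -1], [0, 1, -1, 0, 0, 0, 1, -1],
  [0, 0, 0, 0, 2, 0, 0, 0], [-1, 0, -1, 1, 0, 0, 0, -1],
  [0, 0, -1, 0, -1, 1, 0, 1], [1, 0, 1, -1, 0, 0, 0, -1],
  [0, 0, 1, 0, -1, 1, 0, -1], [-1, 1, 0, 1, 0, 0, -1, 0],
  [0, 0, -1, 1, 0, -1, -1, 0], [1, 0, 1, 0, 1, 0, 1, 0],
  [0, 0, 1, -1, 0, 1, -1, 0], [0, 0, 0, 1, -1, 0, 1, -1],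
  [0, 1, -1, 0, 0, 0, -1, 1], [0, 0, 0, -1, 1, 0, 1, -1],
  [0, -1, -1, 0, 0, 0, 1, -1], [0, 1, 1, 0, 0, 0, 1, -1],
  [1, 0, -1, 1, 0, 0, 0, -1], [-1, 0, 1, -1, 0, 0, 0, -1],
  [0, 0, 0, 1, 1, 0, -1, 1], [0, 0, 1, 0, -1, 1, 0, 1],
  [-1, 1, 0, -1, 0, 0, -1, 0], [-1, 1, 0, 1, 0, 0, 1, 0],
  [1, -1, 0, 1, 0, 0, -1, 0], [0, 0, 1, -1, 0, -1, -1, 0],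
  [0, 0, -1, 1, 0, 1, -1, 0], [0, 0, 0, 1, 1, 0, 1, -1]]

/-- Roots as functions. -/
def rtBR (i : Fin 60) (k : Fin 8) : ℤ := (rtBL.getD i []).getD k 0

/-- Predecessors in the orbit. -/
def rtBP (i : Fin 60) : Fin 60 := [
  0, 0, 1, 2, 2, 2, 3, 3, 3, 4, 5, 6, 7, 7, 7, 8, 10, 11, 11, 11, 12, 12, 13, 14, 14, 15,
  15, 15, 16, 16, 17, 17, 17, 18, 19, 19, 20, 21, 22, 23, 24, 24, 25, 26, 28, 32, 33, 34,
  35, 35, 37, 37, 37, 38, 38, 40, 41, 42, 44, 47].getD i 0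
/-- Generators used. -/
def rtBK (i : Fin 60) : Fin 4 := [
  0, 3, 2, 0, 1, 3, 1, 2, 3, 3, 0, 2, 0, 1, 3, 2, 2, 0, 1, 3, 1, 3, 3, 0, 2, 0, 1, 3, 0,
  1, 1, 2, 3, 3, 0, 2, 2, 2, 2, 2, 1, 3, 2, 3, 2, 2, 2, 2, 0, 1, 0, 1, 3, 1, 3, 3, 0, 1,
  1, 1].getD i 0

/-- The real vector of a root. -/
noncomputable def rr (r : Fin 8 → ℤ) : Fin 4 → ℝ :=
  ![(r 0 + r 1 * gr) / 2, (r 2 + r 3 * gr) / 2, (r 4 + r 5 * gr) / 2, (r 6 + r 7 * gr) / 2]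

/-- Applying a generator to an integral root vector, as a decidable relation. -/
def stepOK (k : Fin 4) (p r : Fin 8 → ℤ) : Prop :=
  if k = 0 then
    r 0 = - p 0 ∧ r 1 = - p 1 ∧ r 2 = p 2 ∧ r 3 = p 3 ∧ r 4 = p 4 ∧ r 5 = p 5 ∧ r 6 = p 6 ∧ r 7 = p 7
  else if k = 1 then
    r 0 = p 0 ∧ r 1 = p 1 ∧ r 2 = - p 2 ∧ r 3 = - p 3 ∧ r 4 = p 4 ∧ r 5 = p 5 ∧ r 6 = p 6 ∧ r 7 = p 7
  else if k = 2 then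
    2 * r 0 = p 1 + p 3 - p 2 - p 4 ∧ 2 * r 1 = p 0 + p 1 + p 2 - p 5 ∧
    2 * r 2 = p 1 - p 0 + p 2 + p 5 ∧ 2 * r 3 = p 0 + p 3 + p 4 + p 5 ∧
    2 * r 4 = - p 0 + p 3 + p 4 - p 5 ∧ 2 * r 5 = - p 1 + p 2 + p 3 - p 4 ∧
    r 6 = p 6 ∧ r 7 = p 7
  else
    r 0 = p 4 ∧ r 1 = p 5 ∧ r 2 = - p 6 ∧ r 3 = - p 7 ∧ r 4 = - p 0 ∧ r 5 = - p 1 ∧ r 6 = p 2 ∧ r 7 = p 3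

instance (k : Fin 4) (p r : Fin 8 → ℤ) : Decidable (stepOK k p r) := by
  unfold stepOK; infer_instance

/-- The generators. -/
noncomputable def mm : Fin 4 → Matrix (Fin 4) (Fin 4) ℝ := ![m1, m2, m3, m4]

theorem vec_m1 (v : Fin 4 → ℝ) : v ᵥ* m1 = ![-v 0, v 1, v 2, v 3] := by
  ext i
  rw [vecMul, dotProduct, Fin.sum_univ_four]
  fin_cases i <;> simp [m1]

theorem vec_m2 (v : Fin 4 → ℝ) : v ᵥ* m2 = ![v 0, -v 1, v 2, v 3] := by
  ext i
  rw [vecMul, dotProduct, Fin.sum_univ_four]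
  fin_cases i <;> simp [m2]

theorem vec_m3 (v : Fin 4 → ℝ) : v ᵥ* m3 = ![(gr * v 0 + (gr - 1) * v 1 - v 2) / 2, ((gr - 1) * v 0 + v 1 + gr * v 2) / 2,
      (-v 0 + gr * v 1 + (1 - gr) * v 2) / 2, v 3] := by
  ext i
  rw [vecMul, dotProduct, Fin.sum_univ_four]
  fin_cases i <;> simp [m3] <;> ring

theorem vec_m4 (v : Fin 4 → ℝ) : v ᵥ* m4 = ![v 2, -v 3, -v 0, v 1] := by
  ext i
  rw [vecMul, dotProduct, Fin.sum_univ_four]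
  fin_cases i <;> simp [m4]

theorem step_vec (k : Fin 4) (p r : Fin 8 → ℤ) (h : stepOK k p r) : rr p ᵥ* mm k = rr r := by
  have hg := gr_sq
  fin_cases k
  · obtain ⟨h0, h1, h2, h3, h4, h5, h6, h7⟩ := h
    have h0 := congrArg (Int.cast : ℤ → ℝ) h0
    have h1 := congrArg (Int.cast : ℤ → ℝ) h1
    have h2 := congrArg (Int.cast : ℤ → ℝ) h2
    have h3 := congrArg (Int.cast : ℤ → ℝ) h3
    have h4 := congrArg (Int.cast : ℤ → ℝ) h4
    have h5 := congrArg (Int.cast : ℤ → ℝ) h5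
    have h6 := congrArg (Int.cast : ℤ → ℝ) h6
    have h7 := congrArg (Int.cast : ℤ → ℝ) h7
    push_cast at h0 h1 h2 h3 h4 h5 h6 h7
    refine (vec_m1 _).trans ?_
    simp only [rr, Matrix.cons_val]
    refine congrArg₂ vecCons ?_ (congrArg₂ vecCons ?_ (congrArg₂ vecCons ?_ (congrArg₂ vecCons ?_ rfl))) <;> first
    | linear_combination - (1/2) * h0 - (1/2) * gr * h1
    | linear_combination - (1/2) * h2 - (1/2) * gr * h3
    | linear_combination - (1/2) * h4 - (1/2) * gr * h5
    | linear_combination - (1/2) * h6 - (1/2) * gr * h7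
  · obtain ⟨h0, h1, h2, h3, h4, h5, h6, h7⟩ := h
    have h0 := congrArg (Int.cast : ℤ → ℝ) h0
    have h1 := congrArg (Int.cast : ℤ → ℝ) h1
    have h2 := congrArg (Int.cast : ℤ → ℝ) h2
    have h3 := congrArg (Int.cast : ℤ → ℝ) h3
    have h4 := congrArg (Int.cast : ℤ → ℝ) h4
    have h5 := congrArg (Int.cast : ℤ → ℝ) h5
    have h6 := congrArg (Int.cast : ℤ → ℝ) h6
    have h7 := congrArg (Int.cast : ℤ → ℝ) h7
    push_cast at h0 h1 h2 h3 h4 h5 h6 h7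
    refine (vec_m2 _).trans ?_
    simp only [rr, Matrix.cons_val]
    refine congrArg₂ vecCons ?_ (congrArg₂ vecCons ?_ (congrArg₂ vecCons ?_ (congrArg₂ vecCons ?_ rfl))) <;> first
    | linear_combination - (1/2) * h0 - (1/2) * gr * h1
    | linear_combination - (1/2) * h2 - (1/2) * gr * h3
    | linear_combination - (1/2) * h4 - (1/2) * gr * h5
    | linear_combination - (1/2) * h6 - (1/2) * gr * h7
  · obtain ⟨h0, h1, h2, h3, h4, h5, h6, h7⟩ := h
    have h0 := congrArg (Int.cast : ℤ → ℝ) h0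
    have h1 := congrArg (Int.cast : ℤ → ℝ) h1
    have h2 := congrArg (Int.cast : ℤ → ℝ) h2
    have h3 := congrArg (Int.cast : ℤ → ℝ) h3
    have h4 := congrArg (Int.cast : ℤ → ℝ) h4
    have h5 := congrArg (Int.cast : ℤ → ℝ) h5
    have h6 := congrArg (Int.cast : ℤ → ℝ) h6
    have h7 := congrArg (Int.cast : ℤ → ℝ) h7
    push_cast at h0 h1 h2 h3 h4 h5 h6 h7
    refine (vec_m3 _).trans ?_
    simp only [rr, Matrix.cons_val]
    refine congrArg₂ vecCons ?_ (congrArg₂ vecCons ?_ (congrArg₂ vecCons ?_ (congrArg₂ vecCons ?_ rfl))) <;> first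
    | linear_combination (1/4) * (p 1 + p 3) * hg - (1/4) * h0 - (1/4) * gr * h1
    | linear_combination (1/4) * (p 1 + p 5) * hg - (1/4) * h2 - (1/4) * gr * h3
    | linear_combination (1/4) * (p 3 - p 5) * hg - (1/4) * h4 - (1/4) * gr * h5
    | linear_combination - (1/2) * h6 - (1/2) * gr * h7
  · obtain ⟨h0, h1, h2, h3, h4, h5, h6, h7⟩ := h
    have h0 := congrArg (Int.cast : ℤ → ℝ) h0
    have h1 := congrArg (Int.cast : ℤ → ℝ) h1
    have h2 := congrArg (Int.cast : ℤ → ℝ) h2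
    have h3 := congrArg (Int.cast : ℤ → ℝ) h3
    have h4 := congrArg (Int.cast : ℤ → ℝ) h4
    have h5 := congrArg (Int.cast : ℤ → ℝ) h5
    have h6 := congrArg (Int.cast : ℤ → ℝ) h6
    have h7 := congrArg (Int.cast : ℤ → ℝ) h7
    push_cast at h0 h1 h2 h3 h4 h5 h6 h7
    refine (vec_m4 _).trans ?_
    simp only [rr, Matrix.cons_val]
    refine congrArg₂ vecCons ?_ (congrArg₂ vecCons ?_ (congrArg₂ vecCons ?_ (congrArg₂ vecCons ?_ rfl))) <;> first
    | linear_combination - (1/2) * h0 - (1/2) * gr * h1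
    | linear_combination - (1/2) * h2 - (1/2) * gr * h3
    | linear_combination - (1/2) * h4 - (1/2) * gr * h5
    | linear_combination - (1/2) * h6 - (1/2) * gr * h7

theorem stepA : ∀ i : Fin 15, i ≠ 0 → rtAP i < i ∧ rtAK i ≠ 3 ∧ stepOK (rtAK i) (rtAR (rtAP i)) (rtAR i) := by
  decide +kernel

theorem stepB : ∀ i : Fin 60, i ≠ 0 → rtBP i < i ∧ stepOK (rtBK i) (rtBR (rtBP i)) (rtBR i) := by
  decide +kernel

theorem distA : ∀ i j : Fin 15, i ≠ j → rtAR i ≠ rtAR j ∧ rtAR i ≠ fun k => - rtAR j k := by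
  decide +kernel

theorem distB : ∀ i j : Fin 60, i ≠ j → rtBR i ≠ rtBR j ∧ rtBR i ≠ fun k => - rtBR j k := by
  decide +kernel

theorem gr_int (a b : ℤ) (h : (a : ℝ) + b * gr = 0) : a = 0 ∧ b = 0 := by
  have hb : b = 0 := by
    by_contra hb
    have hb' : (b : ℝ) ≠ 0 := by exact_mod_cast hb
    have h1 : gr = ((-a / b : ℚ) : ℝ) := by
      push_cast
      field_simp
      linarith
    have h2 : Irrational gr := Real.goldenRatio_irrational
    exact h2 ⟨_, h1.symm⟩
  refine ⟨?_, hb⟩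
  subst hb
  simpa using h

theorem rr_inj (p q : Fin 8 → ℤ) (h : rr p = rr q) : p = q := by
  have e0 := congrFun h 0
  have e1 := congrFun h 1
  have e2 := congrFun h 2
  have e3 := congrFun h 3
  simp [rr] at e0 e1 e2 e3
  have k0 := gr_int (p 0 - q 0) (p 1 - q 1) (by push_cast; linarith)
  have k1 := gr_int (p 2 - q 2) (p 3 - q 3) (by push_cast; linarith)
  have k2 := gr_int (p 4 - q 4) (p 5 - q 5) (by push_cast; linarith)
  have k3 := gr_int (p 6 - q 6) (p 7 - q 7) (by push_cast; linarith)
  ext k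
  fin_cases k
  exacts [sub_eq_zero.mp k0.1, sub_eq_zero.mp k0.2, sub_eq_zero.mp k1.1, sub_eq_zero.mp k1.2,
    sub_eq_zero.mp k2.1, sub_eq_zero.mp k2.2, sub_eq_zero.mp k3.1, sub_eq_zero.mp k3.2]

theorem rr_neg (p : Fin 8 → ℤ) : rr (fun k => - p k) = - rr p := by
  ext k
  fin_cases k <;> simp [rr] <;> ring

theorem lin_inj (r s : Fin 4 → ℝ) (h : lin r = lin s) : r = s := by
  ext k
  have := congrArg (coeff (Finsupp.single k 1)) h
  simpa [lin, coeff_sum, coeff_smul, coeff_X, Finsupp.single_left_inj] using this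

theorem lin_neg (r : Fin 4 → ℝ) : lin (-r) = - lin r := by
  simp [lin]

theorem lin_sq (p q : Fin 8 → ℤ) (h : lin (rr p) ^ 2 = lin (rr q) ^ 2) :
    p = q ∨ p = fun k => - q k := by
  rcases sq_eq_sq_iff_eq_or_eq_neg.mp h with h | h
  · exact Or.inl (rr_inj _ _ (lin_inj _ _ h))
  · right
    apply rr_inj
    rw [rr_neg]
    apply lin_inj
    rw [h, lin_neg]

/-- Polynomial invariance along the monoid generated by some matrices. -/
theorem act_closure (S : Set (Matrix (Fin 4) (Fin 4) ℝ)) (F : P4) (h : ∀ M ∈ S, act M F = F)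
    (M : Matrix (Fin 4) (Fin 4) ℝ) (hM : M ∈ Submonoid.closure S) : act M F = F := by
  induction hM using Submonoid.closure_induction with
  | mem x hx => exact h x hx
  | one => exact act_one F
  | mul x y _ _ hx hy => rw [← act_mul, hx, hy]

theorem orbA (i : Fin 15) : ∃ M ∈ Submonoid.closure {m1, m2, m3}, rr (rtAR 0) ᵥ* M = rr (rtAR i) := by
  induction i using WellFoundedLT.induction with
  | ind i ih =>
    by_cases hi : i = 0
    · subst hi
      exact ⟨1, Submonoid.one_mem _, by rw [vecMul_one]⟩
    · obtain ⟨h1, h3, h2⟩ := stepA i hi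
      obtain ⟨M, hM, e⟩ := ih _ h1
      refine ⟨M * mm (rtAK i), Submonoid.mul_mem _ hM (Submonoid.subset_closure ?_), ?_⟩
      · generalize rtAK i = k at h3
        fin_cases k <;> simp [mm] at h3 ⊢
      · rw [← vecMul_vecMul, e, step_vec _ _ _ h2]

theorem orbB (i : Fin 60) : ∃ M ∈ Submonoid.closure {m1, m2, m3, m4}, rr (rtBR 0) ᵥ* M = rr (rtBR i) := by
  induction i using WellFoundedLT.induction with
  | ind i ih =>
    by_cases hi : i = 0
    · subst hi
      exact ⟨1, Submonoid.one_mem _, by rw [vecMul_one]⟩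
    · obtain ⟨h1, h2⟩ := stepB i hi
      obtain ⟨M, hM, e⟩ := ih _ h1
      refine ⟨M * mm (rtBK i), Submonoid.mul_mem _ hM (Submonoid.subset_closure ?_), ?_⟩
      · generalize rtBK i = k
        fin_cases k <;> simp [mm]
      · rw [← vecMul_vecMul, e, step_vec _ _ _ h2]

theorem lin_start0 : lin (rr (rtAR 0)) = X 0 := by
  have h : rtAR 0 = ![2, 0, 0, 0, 0, 0, 0, 0] := by decide
  rw [h]
  simp [lin, rr, Fin.sum_univ_four]

theorem lin_start3 : lin (rr (rtBR 0)) = X 3 := by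
  have h : rtBR 0 = ![0, 0, 0, 0, 0, 0, 2, 0] := by decide
  rw [h]
  simp [lin, rr, Fin.sum_univ_four]

/-- Sign change of one coordinate. -/
noncomputable def sgn (i : Fin 4) : P4 →ₐ[ℝ] P4 :=
  aeval fun j => if j = i then -(X j : P4) else X j

theorem coeff_sgn (i : Fin 4) (F : P4) (μ : Fin 4 →₀ ℕ) :
    coeff μ (sgn i F) = (-1) ^ μ i * coeff μ F := by
  induction F using MvPolynomial.induction_on' with
  | add p q hp hq => rw [map_add, coeff_add, hp, hq, coeff_add]; ring
  | monomial ν r =>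
    have h : sgn i (monomial ν r) = monomial ν ((-1) ^ ν i * r) := by
      rw [sgn, aeval_monomial, monomial_eq, Finsupp.prod_fintype _ _ (fun _ => pow_zero _),
        Finsupp.prod_fintype _ _ (fun _ => pow_zero _)]
      have h1 : ∀ j : Fin 4, (if j = i then -(X j : P4) else X j) ^ ν j
          = (if j = i then C ((-1) ^ ν i) else 1) * X j ^ ν j := by
        intro j
        split_ifs with h
        · subst h
          rw [neg_pow]; simp
        · rw [one_mul]
      simp only [h1, Finset.prod_mul_distrib, Finset.prod_ite_eq', Finset.mem_univ, if_true,
        map_mul, algebraMap_eq]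
      ring
    rw [h, coeff_monomial, coeff_monomial]
    split_ifs with h
    · rw [h]
    · rw [mul_zero]

theorem expand_of_sgn (F : P4) (h : ∀ i, sgn i F = F) : ∃ F1 : P4, expand 2 F1 = F := by
  have hev : ∀ μ ∈ F.support, ∀ i, 2 * (μ i / 2) = μ i := by
    intro μ hμ i
    rw [mem_support_iff] at hμ
    have h1 := coeff_sgn i F μ
    rw [h i] at h1
    rcases Nat.even_or_odd (μ i) with h2 | h2
    · exact Nat.two_mul_div_two_of_even h2
    · exfalso
      rw [h2.neg_one_pow] at h1
      apply hμ; linarith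
  refine ⟨∑ μ ∈ F.support, monomial (μ.mapRange (· / 2) rfl) (coeff μ F), ?_⟩
  conv_rhs => rw [F.as_sum]
  rw [map_sum]
  refine Finset.sum_congr rfl fun μ hμ => ?_
  rw [expand_monomial]
  have h2 : 2 • Finsupp.mapRange (· / 2) rfl μ = μ := by
    ext i
    simpa using hev μ hμ i
  rw [h2]

theorem act_m4T {F : P4} (h : FixG F) : act m4ᵀ F = F := by
  conv_lhs => rw [← h.2.2.2]
  rw [act_mul, m4_orth, act_one]

theorem act_eq_sgn (M : Matrix (Fin 4) (Fin 4) ℝ) (i : Fin 4)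
    (h : M = Matrix.diagonal fun j => if j = i then -1 else 1) : act M = sgn i := by
  subst h
  apply MvPolynomial.algHom_ext
  intro j
  rw [act, aeval_X, sgn, aeval_X]
  simp [Matrix.diagonal_apply, ite_smul]

theorem diag1 : m1 = Matrix.diagonal fun j : Fin 4 => if j = 0 then (-1 : ℝ) else 1 := by
  ext i j
  fin_cases i <;> fin_cases j <;> simp [m1]

theorem diag2 : m2 = Matrix.diagonal fun j : Fin 4 => if j = 1 then (-1 : ℝ) else 1 := by
  ext i j
  fin_cases i <;> fin_cases j <;> simp [m2]

theorem diag3 : m4 * m1 * m4ᵀ = Matrix.diagonal fun j : Fin 4 => if j = 2 then (-1 : ℝ) else 1 := by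
  ext i j
  rw [Matrix.mul_apply, Fin.sum_univ_four]
  simp only [Matrix.mul_apply, Fin.sum_univ_four, Matrix.transpose_apply]
  fin_cases i <;> fin_cases j <;> simp [m1, m4]

theorem diag4 : m4 * m2 * m4ᵀ = Matrix.diagonal fun j : Fin 4 => if j = 3 then (-1 : ℝ) else 1 := by
  ext i j
  rw [Matrix.mul_apply, Fin.sum_univ_four]
  simp only [Matrix.mul_apply, Fin.sum_univ_four, Matrix.transpose_apply]
  fin_cases i <;> fin_cases j <;> simp [m2, m4]

theorem sgn_fix {F : P4} (h : FixG F) (i : Fin 4) : sgn i F = F := by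
  fin_cases i
  · change sgn 0 F = F
    rw [← act_eq_sgn m1 _ diag1, h.1]
  · change sgn 1 F = F
    rw [← act_eq_sgn m2 _ diag2, h.2.1]
  · change sgn 2 F = F
    rw [← act_eq_sgn _ _ diag3, ← act_mul, ← act_mul, h.2.2.2, h.1, act_m4T h]
  · change sgn 3 F = F
    rw [← act_eq_sgn _ _ diag4, ← act_mul, ← act_mul, h.2.2.2, h.2.1, act_m4T h]

/-- Basic invariants of `H3` (times a line). -/
noncomputable def g1 : Fin 4 → P4 := ![X 3 ^ 2, vS, uS, tS]
/-- Basic invariants of `H3` (times a line), first one the quadratic form. -/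
noncomputable def g2 : Fin 4 → P4 := ![aS, vS, uS, tS]
/-- Basic invariants of `H4`. -/
noncomputable def gH : Fin 4 → P4 := ![aS, bS, cS, eS]

theorem expand_f1 : ∀ i, expand 2 (f1 i) = g1 i := by
  intro i
  have hC : expand (R := ℝ) (σ := Fin 4) 2 (C gr) = C gr := expand_C 2 gr
  fin_cases i
  · simp [f1, g1]
  · simp [f1, g1, vS]
  · simp [f1, g1, uS, map_uF, hC]
  · simp [f1, g1, tS, map_tF, hC]

theorem fix_g1 (M : Matrix (Fin 4) (Fin 4) ℝ) (hM : M ∈ ({m1, m2, m3} : Set _)) (i : Fin 4) :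
    act M (g1 i) = g1 i := by
  have e : (X 3 ^ 2 : P4) = aS - vS := by simp [aS, vS]
  rcases hM with rfl | rfl | rfl <;> fin_cases i <;> simp only [g1, e, Fin.zero_eta, Fin.mk_one, Fin.reduceFinMk, Matrix.cons_val]
  · rw [map_sub, fix_a1, fix_v1]
  · exact fix_v1
  · exact fix_u1
  · exact fix_t1
  · rw [map_sub, fix_a2, fix_v2]
  · exact fix_v2
  · exact fix_u2
  · exact fix_t2
  · rw [map_sub, fix_a3, fix_v3]
  · exact fix_v3
  · exact fix_u3
  · exact fix_t3

theorem fix_gH (M : Matrix (Fin 4) (Fin 4) ℝ) (hM : M ∈ ({m1, m2, m3, m4} : Set _)) (i : Fin 4) :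
    act M (gH i) = gH i := by
  have : FixG (gH i) := by
    fin_cases i
    exacts [FixG_a, FixG_b, FixG_c, FixG_e]
  obtain ⟨h1, h2, h3, h4⟩ := this
  rcases hM with rfl | rfl | rfl | rfl
  exacts [h1, h2, h3, h4]

theorem descent1 (F : P4) (h : FixG F) : ∃ P : P4, F = aeval g1 P := by
  obtain ⟨F1, rfl⟩ := expand_of_sgn F (sgn_fix h)
  have hclosed := integrallyClosed_of_algInd f1 algInd1
  have hInt := integral_of_span A1 B1 span1'
  choose M hM hr using orbA
  have hmem : F1 ∈ A1 := by
    refine descend A1 15 (by simp) B1 span1' (expand 2 : P4 →ₐ[ℝ] P4).toRingHom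
      (expand_injective (by norm_num)) F1 (X 0) (fun i => (act (M i)).toRingHom) ?_ ?_ ?_
    · intro i x hx
      have hle : A1 ≤ (fixedBy (M i)).comap (expand 2 : P4 →ₐ[ℝ] P4) := by
        apply Algebra.adjoin_le
        rintro _ ⟨k, rfl⟩
        change act (M i) (expand 2 (f1 k)) = expand 2 (f1 k)
        rw [expand_f1]
        exact act_closure _ _ (fun N hN => fix_g1 N hN k) _ (hM i)
      exact hle hx
    · intro i
      refine act_closure _ _ ?_ _ (hM i)
      rintro N (rfl | rfl | rfl)
      exacts [h.1, h.2.1, h.2.2.1]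
    · intro i j hij
      by_contra hne
      have e : ∀ i, act (M i) (expand 2 (X 0)) = lin (rr (rtAR i)) ^ 2 := by
        intro i
        rw [expand_X, map_pow, ← lin_start0, act_lin, hr]
      have hij' : act (M i) (expand 2 (X 0)) = act (M j) (expand 2 (X 0)) := hij
      rw [e, e] at hij'
      rcases lin_sq _ _ hij' with h1 | h1
      · exact (distA i j hne).1 h1
      · exact (distA i j hne).2 h1
  unfold A1 at hmem
  rw [Algebra.adjoin_range_eq_range_aeval] at hmem
  obtain ⟨P, rfl⟩ := hmem
  refine ⟨P, ?_⟩
  have : (expand 2 : P4 →ₐ[ℝ] P4).comp (aeval f1) = aeval g1 := by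
    apply MvPolynomial.algHom_ext
    intro i
    rw [AlgHom.comp_apply, aeval_X, aeval_X, expand_f1]
  rw [← this]; rfl

theorem g1_g2 (P : P4) : aeval g1 P = aeval g2 (aeval ![X 0 - X 1, X 1, X 2, X 3] P : P4) := by
  have : aeval g1 = (aeval g2 : P4 →ₐ[ℝ] P4).comp (aeval ![X 0 - X 1, X 1, X 2, X 3]) := by
    apply MvPolynomial.algHom_ext
    intro i
    rw [AlgHom.comp_apply, aeval_X, aeval_X]
    fin_cases i <;> simp [g1, g2, aS, vS]
  rw [this]; rfl

theorem algInd_g1 : AlgebraicIndependent ℝ g1 := by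
  have : (expand 2 : P4 →ₐ[ℝ] P4).comp (aeval f1) = aeval g1 := by
    apply MvPolynomial.algHom_ext
    intro i
    rw [AlgHom.comp_apply, aeval_X, aeval_X, expand_f1]
  rw [AlgebraicIndependent, ← this, AlgHom.coe_comp]
  exact (expand_injective (by norm_num)).comp algInd1

theorem algInd_g2 : AlgebraicIndependent ℝ g2 := by
  have : aeval g2 = (aeval g1 : P4 →ₐ[ℝ] P4).comp (aeval ![X 0 + X 1, X 1, X 2, X 3]) := by
    apply MvPolynomial.algHom_ext
    intro i
    rw [AlgHom.comp_apply, aeval_X, aeval_X]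
    fin_cases i <;> simp [g1, g2, aS, vS] <;> ring
  rw [AlgebraicIndependent, this, AlgHom.coe_comp]
  refine Function.Injective.comp algInd_g1 ?_
  have h2 : (aeval ![X 0 - X 1, X 1, X 2, X 3] : P4 →ₐ[ℝ] P4).comp
      (aeval ![X 0 + X 1, X 1, X 2, X 3]) = AlgHom.id ℝ P4 := by
    apply MvPolynomial.algHom_ext
    intro i
    rw [AlgHom.comp_apply, aeval_X]
    fin_cases i <;> simp
  exact Function.LeftInverse.injective (g := (aeval ![X 0 - X 1, X 1, X 2, X 3] : P4 →ₐ[ℝ] P4))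
    (fun x => DFunLike.congr_fun h2 x)

theorem g2_f2 (i : Fin 4) : aeval g2 (f2 i) = gH i := by
  fin_cases i
  · simp [f2, gH, g2]
  · simp [f2, gH, g2, map_bF, bS]
  · simp [f2, gH, g2, map_cF, cS]
  · simp [f2, gH, g2, map_eF, eS]

theorem descent2 (F : P4) (h : FixG F) : ∃ P : P4, F = aeval gH P := by
  obtain ⟨P1, hP1⟩ := descent1 F h
  rw [g1_g2] at hP1
  generalize (aeval ![X 0 - X 1, X 1, X 2, X 3] P1 : P4) = P2 at hP1
  have hclosed := integrallyClosed_of_algInd f2 algInd2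
  have hInt := integral_of_span A2 B2 span2'
  choose M hM hr using orbB
  have hmem : P2 ∈ A2 := by
    refine descend A2 60 card_K60 B2 span2' (aeval g2 : P4 →ₐ[ℝ] P4).toRingHom
      algInd_g2 P2 (X 0 - X 1) (fun i => (act (M i)).toRingHom) ?_ ?_ ?_
    · intro i x hx
      have hle : A2 ≤ (fixedBy (M i)).comap (aeval g2 : P4 →ₐ[ℝ] P4) := by
        apply Algebra.adjoin_le
        rintro _ ⟨k, rfl⟩
        change act (M i) (aeval g2 (f2 k)) = aeval g2 (f2 k)
        rw [g2_f2]
        exact act_closure _ _ (fun N hN => fix_gH N hN k) _ (hM i)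
      exact hle hx
    · intro i
      change act (M i) (aeval g2 P2) = aeval g2 P2
      rw [← hP1]
      refine act_closure _ _ ?_ _ (hM i)
      rintro N (rfl | rfl | rfl | rfl)
      exacts [h.1, h.2.1, h.2.2.1, h.2.2.2]
    · intro i j hij
      by_contra hne
      have e : ∀ i, act (M i) (aeval g2 (X 0 - X 1 : P4)) = lin (rr (rtBR i)) ^ 2 := by
        intro i
        have e0 : aeval g2 (X 0 - X 1 : P4) = X 3 ^ 2 := by simp [g2, aS, vS]
        rw [e0, map_pow, ← lin_start3, act_lin, hr]
      have hij' : act (M i) (aeval g2 (X 0 - X 1 : P4)) = act (M j) (aeval g2 (X 0 - X 1 : P4)) := hij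
      rw [e, e] at hij'
      rcases lin_sq _ _ hij' with h1 | h1
      · exact (distB i j hne).1 h1
      · exact (distB i j hne).2 h1
  unfold A2 at hmem
  rw [Algebra.adjoin_range_eq_range_aeval] at hmem
  obtain ⟨P, rfl⟩ := hmem
  refine ⟨P, hP1.trans ?_⟩
  have : (aeval g2 : P4 →ₐ[ℝ] P4).comp (aeval f2) = aeval gH := by
    apply MvPolynomial.algHom_ext
    intro i
    rw [AlgHom.comp_apply, aeval_X, aeval_X, g2_f2]
  rw [← this]; rfl

theorem comp_aeval (w w' : Fin 4 → ℕ) (f : Fin 4 → P4)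
    (hf : ∀ i, IsWeightedHomogeneous w' (f i) (w i)) (n : ℕ) (P : P4) :
    weightedHomogeneousComponent w' n (aeval f P) =
      aeval f (weightedHomogeneousComponent w n P) := by
  induction P using MvPolynomial.induction_on' with
  | monomial μ r =>
    have h1 : IsWeightedHomogeneous w' (aeval f (monomial μ r)) (Finsupp.weight w μ) := by
      rw [aeval_monomial, Finsupp.prod_fintype _ _ (by simp), algebraMap_eq,
        Finsupp.weight_apply, Finsupp.sum_fintype _ _ (by simp)]
      exact (IsWeightedHomogeneous.prod _ _ _ fun i _ => (hf i).pow (μ i)).C_mul r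
    rw [weightedHomogeneousComponent_of_mem (m := n) h1,
      weightedHomogeneousComponent_of_mem (m := n) (isWeightedHomogeneous_monomial w μ r rfl)]
    split_ifs <;> simp
  | add p q hp hq => rw [map_add, map_add, hp, hq, map_add, map_add]

theorem algInd_gH : AlgebraicIndependent ℝ gH := by
  have : (aeval g2 : P4 →ₐ[ℝ] P4).comp (aeval f2) = aeval gH := by
    apply MvPolynomial.algHom_ext
    intro i
    rw [AlgHom.comp_apply, aeval_X, aeval_X, g2_f2]
  rw [AlgebraicIndependent, ← this, AlgHom.coe_comp]
  exact Function.Injective.comp algInd_g2 algInd2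

theorem scale_C (w : Fin 4 → ℕ) (r : ℝ) : scale w (C r) = Polynomial.C (C r) := by
  rw [scale, aeval_C]; rfl

theorem scale_X (w : Fin 4 → ℕ) (i : Fin 4) :
    scale w (X i) = Polynomial.X ^ w i * Polynomial.C (X i) := by
  rw [scale, aeval_X]

theorem gH_hom (i : Fin 4) : IsWeightedHomogeneous (1 : Fin 4 → ℕ) (gH i) (2 * d2 i) := by
  apply wh_of_scale
  have hX : ∀ i, scale 1 (X i) = Polynomial.X * Polynomial.C (X i) := by
    intro i; rw [scale_X]; simp
  have ha : scale 1 aS = Polynomial.X ^ 2 * Polynomial.C aS := by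
    simp only [aS, map_add, map_pow, hX]; ring
  have hv : scale 1 vS = Polynomial.X ^ 2 * Polynomial.C vS := by
    simp only [vS, map_add, map_pow, hX]; ring
  have hu : scale 1 uS = (Polynomial.X ^ 2) ^ 3 * Polynomial.C uS := by
    rw [uS, map_uF, map_uF, scale_C, ← scale_uF]
    simp only [map_pow, hX, mul_pow]
  have ht : scale 1 tS = (Polynomial.X ^ 2) ^ 5 * Polynomial.C tS := by
    rw [tS, map_tF, map_tF, scale_C, ← scale_tF]
    simp only [map_pow, hX, mul_pow]
  fin_cases i
  · change scale 1 aS = Polynomial.X ^ (2 * 1) * Polynomial.C aS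
    rw [ha]
  · change scale 1 bS = Polynomial.X ^ (2 * 6) * Polynomial.C bS
    rw [bS, map_bF, map_bF, ha, hv, hu, ht, scale_bF, ← pow_mul]
  · change scale 1 cS = Polynomial.X ^ (2 * 10) * Polynomial.C cS
    rw [cS, map_cF, map_cF, ha, hv, hu, ht, scale_cF, ← pow_mul]
  · change scale 1 eS = Polynomial.X ^ (2 * 15) * Polynomial.C eS
    rw [eS, map_eF, map_eF, ha, hv, hu, ht, scale_eF, ← pow_mul]

theorem exists_hom {F : P4} (h : FixG F) {d : ℕ} (hd : F.IsHomogeneous d) (h0 : F ≠ 0) :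
    ∃ (d' : ℕ) (P : P4), d = 2 * d' ∧ P ≠ 0 ∧ IsWeightedHomogeneous d2 P d' ∧
      F = aeval gH P := by
  obtain ⟨P, hP⟩ := descent2 F h
  set P1 := weightedHomogeneousComponent (fun i => 2 * d2 i) d P with hP1
  have e1 : F = aeval gH P1 := by
    rw [hP1, ← comp_aeval _ _ gH gH_hom, ← hP]
    exact (IsWeightedHomogeneous.weightedHomogeneousComponent_same hd).symm
  have h1 : P1 ≠ 0 := by
    intro h; rw [e1, h, map_zero] at h0; exact h0 rfl
  have h2 : IsWeightedHomogeneous (fun i => 2 * d2 i) P1 d :=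
    weightedHomogeneousComponent_isWeightedHomogeneous d P
  have hw : ∀ μ : Fin 4 →₀ ℕ, Finsupp.weight (fun i => 2 * d2 i) μ = 2 * Finsupp.weight d2 μ := by
    intro μ
    rw [Finsupp.weight_apply, Finsupp.sum_fintype _ _ (by simp), Finsupp.weight_apply,
      Finsupp.sum_fintype _ _ (by simp), Finset.mul_sum]
    refine Finset.sum_congr rfl fun i _ => ?_
    simp only [smul_eq_mul]; ring
  obtain ⟨μ, hμ⟩ := MvPolynomial.ne_zero_iff.mp h1
  refine ⟨Finsupp.weight d2 μ, P1, ?_, h1, ?_, e1⟩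
  · rw [← hw, h2 hμ]
  · intro ν hν
    have := h2 hν
    have h3 := h2 hμ
    rw [hw] at this h3
    omega

/-- Weights for the order of vanishing at `(0,0,0,1)`. -/
def w3 : Fin 4 → ℕ := ![1, 1, 1, 0]

theorem mem_pow_iff (F : P4) (m : ℕ) :
    F ∈ (Ideal.span {X 0, X 1, X 2} : Ideal P4) ^ m ↔ Polynomial.X ^ m ∣ scale w3 F := by
  constructor
  · intro h
    have h1 : Ideal.map (scale w3) (Ideal.span {X 0, X 1, X 2} : Ideal P4) ≤
        Ideal.span {Polynomial.X} := by
      rw [Ideal.map_span, Ideal.span_le]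
      rintro _ ⟨x, (rfl | rfl | rfl), rfl⟩ <;>
      · rw [SetLike.mem_coe, Ideal.mem_span_singleton, scale_X]
        simp [w3]
    have h2 := Ideal.mem_map_of_mem (scale w3) h
    rw [Ideal.map_pow] at h2
    have h3 := Ideal.pow_right_mono h1 m h2
    rwa [Ideal.span_singleton_pow, Ideal.mem_span_singleton] at h3
  · intro h
    rw [Polynomial.X_pow_dvd_iff] at h
    rw [F.as_sum]
    refine Ideal.sum_mem _ fun μ hμ => ?_
    have hw : m ≤ μ 0 + μ 1 + μ 2 := by
      by_contra hlt
      push Not at hlt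
      have h1 := h _ hlt
      rw [coeff_scale] at h1
      have h2 := congrArg (coeff μ) h1
      rw [coeff_weightedHomogeneousComponent, if_pos, coeff_zero] at h2
      · exact mem_support_iff.mp hμ h2
      · rw [Finsupp.weight_apply, Finsupp.sum_fintype _ _ (by simp)]
        simp [Fin.sum_univ_four, w3]
    have hm : ∀ i : Fin 4, i ∈ ({0, 1, 2} : Set (Fin 4)) →
        (X i : P4) ∈ (Ideal.span {X 0, X 1, X 2} : Ideal P4) := by
      rintro i (rfl | rfl | rfl) <;> exact Ideal.subset_span (by simp)
    rw [monomial_eq, Finsupp.prod_fintype _ _ (by simp), Fin.prod_univ_four]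
    refine Ideal.mul_mem_left _ _ (Ideal.mul_mem_right _ _ ?_)
    refine Ideal.pow_le_pow_right hw ?_
    rw [pow_add, pow_add]
    exact Ideal.mul_mem_mul (Ideal.mul_mem_mul (Ideal.pow_mem_pow (hm 0 (by simp)) _)
      (Ideal.pow_mem_pow (hm 1 (by simp)) _)) (Ideal.pow_mem_pow (hm 2 (by simp)) _)

theorem lead_b {R : Type*} [CommRing R] (T a v u t : R) : ∃ r : R, bF a (T * v) (T ^ 3 * u) (T ^ 5 * t) = T * (a ^ 5 * v + T * r) := by
  refine ⟨-15*T^4*v^6 - 54*T^4*v^3*u + 12*T^4*v*t - 3*T^4*u^2 + 45*T^3*a*v^5 + 154*T^3*a*v^2*u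
    - 11*T^3*a*t - 52*T^2*a^2*v^4 - 132*T^2*a^2*v*u + 29*T*a^3*v^3 + 33*T*a^3*u - 8*a^4*v^2, ?_⟩
  simp only [bF]; ring

/-- A part of the remainder. -/
def k0F {R : Type*} [CommRing R] (a v u t : R) : R :=
    -48*a^8*v^4 - 240*a^8*v*u + 330*a^7*v^5 + 1812*a^7*v^2*u + 90*a^7*t - 1287*a^6*v^6
    - 7782*a^6*v^3*u - 660*a^6*v*t - 795*a^6*u^2 + 3156*a^5*v^7 + 20424*a^5*v^4*u + 1776*a^5*v^2*t
    + 7236*a^5*v*u^2 - 5064*a^4*v^8 - 34056*a^4*v^5*u - 1944*a^4*v^3*t - 24672*a^4*v^2*u^2 + 840*a^4*u*t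

theorem k0_ord {R : Type*} [CommRing R] (T a v u t : R) : ∃ r : R, k0F a (T * v) (T ^ 3 * u) (T ^ 5 * t) = T ^ 4 * r := by
  refine ⟨-5064*T^4*a^4*v^8 - 34056*T^4*a^4*v^5*u - 1944*T^4*a^4*v^3*t - 24672*T^4*a^4*v^2*u^2 + 840*T^4*a^4*u*t + 3156*T^3*a^5*v^7
    + 20424*T^3*a^5*v^4*u + 1776*T^3*a^5*v^2*t + 7236*T^3*a^5*v*u^2 - 1287*T^2*a^6*v^6 - 7782*T^2*a^6*v^3*u - 660*T^2*a^6*v*t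
    - 795*T^2*a^6*u^2 + 330*T*a^7*v^5 + 1812*T*a^7*v^2*u + 90*T*a^7*t - 48*a^8*v^4 - 240*a^8*v*u, ?_⟩
  simp only [k0F]; ring

/-- A part of the remainder. -/
def k1F {R : Type*} [CommRing R] (a v u t : R) : R :=
    5325*a^3*v^9 + 36483*a^3*v^6*u + 60*a^3*v^4*t + 41715*a^3*v^3*u^2 - 3924*a^3*v*u*t + 141*a^3*u^3
    - 3540*a^2*v^10 - 24516*a^2*v^7*u + 1728*a^2*v^5*t - 37380*a^2*v^4*u^2 + 6672*a^2*v^2*u*t - 732*a^2*v*u^3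
    - 120*a^2*t^2 + 1350*a*v^11 + 9480*a*v^8*u - 1410*a*v^6*t + 16902*a*v^5*u^2 - 4884*a*v^3*u*t

theorem k1_ord {R : Type*} [CommRing R] (T a v u t : R) : ∃ r : R, k1F a (T * v) (T ^ 3 * u) (T ^ 5 * t) = T ^ 4 * r := by
  refine ⟨1350*T^7*a*v^11 + 9480*T^7*a*v^8*u - 1410*T^7*a*v^6*t + 16902*T^7*a*v^5*u^2 - 4884*T^7*a*v^3*u*t - 3540*T^6*a^2*v^10
    - 24516*T^6*a^2*v^7*u + 1728*T^6*a^2*v^5*t - 37380*T^6*a^2*v^4*u^2 + 6672*T^6*a^2*v^2*u*t - 732*T^6*a^2*v*u^3 - 120*T^6*a^2*t^2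
    + 5325*T^5*a^3*v^9 + 36483*T^5*a^3*v^6*u + 60*T^5*a^3*v^4*t + 41715*T^5*a^3*v^3*u^2 - 3924*T^5*a^3*v*u*t + 141*T^5*a^3*u^3, ?_⟩
  simp only [k1F]; ring

/-- A part of the remainder. -/
def k2F {R : Type*} [CommRing R] (a v u t : R) : R :=
    924*a*v^2*u^3 + 264*a*v*t^2 - 66*a*u^2*t - 225*v^12 - 1620*v^9*u + 360*v^7*t
    - 3006*v^6*u^2 + 1296*v^4*u*t - 324*v^3*u^3 - 144*v^2*t^2 + 72*v*u^2*t - 9*u^4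

theorem k2_ord {R : Type*} [CommRing R] (T a v u t : R) : ∃ r : R, k2F a (T * v) (T ^ 3 * u) (T ^ 5 * t) = T ^ 4 * r := by
  refine ⟨-225*T^8*v^12 - 1620*T^8*v^9*u + 360*T^8*v^7*t - 3006*T^8*v^6*u^2 + 1296*T^8*v^4*u*t - 324*T^8*v^3*u^3
    - 144*T^8*v^2*t^2 + 72*T^8*v*u^2*t - 9*T^8*u^4 + 924*T^7*a*v^2*u^3 + 264*T^7*a*v*t^2 - 66*T^7*a*u^2*t, ?_⟩
  simp only [k2F]; ring

set_option maxRecDepth 100000 in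
set_option maxHeartbeats 8000000 in
theorem expl_k {R : Type*} [CommRing R] (a v u t : R) :
    a ^ 2 * cF a v u t - bF a v u t ^ 2 =
      a ^ 9 * (15 * u + 3 * v ^ 3) + k0F a v u t + k1F a v u t + k2F a v u t := by
  simp only [bF, cF, k0F, k1F, k2F]; ring

/-- A part of the remainder. -/
def q0F {R : Type*} [CommRing R] (a v u t : R) : R :=
    -675*a^12*v^6 - 28350*a^12*v^3*u - 13500*a^12*v*t - 3375*a^12*u^2 + 7560*a^11*v^7 + 265680*a^11*v^4*u
    + 118800*a^11*v^2*t + 70200*a^11*v*u^2 - 50220*a^10*v^8 - 1474740*a^10*v^5*u - 607500*a^10*v^3*t - 675000*a^10*v^2*u^2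
    - 13500*a^10*u*t + 220860*a^9*v^9 + 5429700*a^9*v^6*u + 2006640*a^9*v^4*t + 3913380*a^9*v^3*u^2 + 183600*a^9*v*u*t

theorem q0_ord {R : Type*} [CommRing R] (T a v u t : R) : ∃ r : R, q0F a (T * v) (T ^ 3 * u) (T ^ 5 * t) = T ^ 6 * r := by
  refine ⟨220860*T^3*a^9*v^9 + 5429700*T^3*a^9*v^6*u + 2006640*T^3*a^9*v^4*t + 3913380*T^3*a^9*v^3*u^2 + 183600*T^3*a^9*v*u*t - 50220*T^2*a^10*v^8
    - 1474740*T^2*a^10*v^5*u - 607500*T^2*a^10*v^3*t - 675000*T^2*a^10*v^2*u^2 - 13500*T^2*a^10*u*t + 7560*T*a^11*v^7 + 265680*T*a^11*v^4*u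
    + 118800*T*a^11*v^2*t + 70200*T*a^11*v*u^2 - 675*a^12*v^6 - 28350*a^12*v^3*u - 13500*a^12*v*t - 3375*a^12*u^2, ?_⟩
  simp only [q0F]; ring

/-- A part of the remainder. -/
def q1F {R : Type*} [CommRing R] (a v u t : R) : R :=
    78300*a^9*u^3 - 679752*a^8*v^10 - 14070240*a^8*v^7*u - 4490640*a^8*v^5*t - 14934240*a^8*v^4*u^2 - 928800*a^8*v^2*u*t
    - 1166400*a^8*v*u^3 + 27000*a^8*t^2 + 1508490*a^7*v^11 + 26553960*a^7*v^8*u + 6907410*a^7*v^6*t + 39090330*a^7*v^5*u^2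
    + 2260980*a^7*v^3*u*t + 7069140*a^7*v^2*u^3 - 199800*a^7*v*t^2 - 190350*a^7*u^2*t - 2448090*a^6*v^12 - 37194120*a^6*v^9*u

theorem q1_ord {R : Type*} [CommRing R] (T a v u t : R) : ∃ r : R, q1F a (T * v) (T ^ 3 * u) (T ^ 5 * t) = T ^ 6 * r := by
  refine ⟨-2448090*T^6*a^6*v^12 - 37194120*T^6*a^6*v^9*u + 1508490*T^5*a^7*v^11 + 26553960*T^5*a^7*v^8*u + 6907410*T^5*a^7*v^6*t + 39090330*T^5*a^7*v^5*u^2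
    + 2260980*T^5*a^7*v^3*u*t + 7069140*T^5*a^7*v^2*u^3 - 199800*T^5*a^7*v*t^2 - 190350*T^5*a^7*u^2*t - 679752*T^4*a^8*v^10 - 14070240*T^4*a^8*v^7*u
    - 4490640*T^4*a^8*v^5*t - 14934240*T^4*a^8*v^4*u^2 - 928800*T^4*a^8*v^2*u*t - 1166400*T^4*a^8*v*u^3 + 27000*T^4*a^8*t^2 + 78300*T^3*a^9*u^3, ?_⟩
  simp only [q1F]; ring

/-- A part of the remainder. -/
def q2F {R : Type*} [CommRing R] (a v u t : R) : R :=
    -7163640*a^6*v^7*t - 71758980*a^6*v^6*u^2 - 2343600*a^6*v^4*u*t - 23437080*a^6*v^3*u^3 + 604800*a^6*v^2*t^2 + 1657800*a^6*v*u^2*t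
    + 28350*a^6*u^4 + 2910600*a^5*v^13 + 38934000*a^5*v^10*u + 4592160*a^5*v^8*t + 93266640*a^5*v^7*u^2 - 1136160*a^5*v^5*u*t
    + 47394720*a^5*v^4*u^3 - 935280*a^5*v^3*t^2 - 6056640*a^5*v^2*u^2*t + 61560*a^5*v*u^4 + 75600*a^5*u*t^2 - 2508300*a^4*v^14

theorem q2_ord {R : Type*} [CommRing R] (T a v u t : R) : ∃ r : R, q2F a (T * v) (T ^ 3 * u) (T ^ 5 * t) = T ^ 6 * r := by
  refine ⟨-2508300*T^8*a^4*v^14 + 2910600*T^7*a^5*v^13 + 38934000*T^7*a^5*v^10*u + 4592160*T^7*a^5*v^8*t + 93266640*T^7*a^5*v^7*u^2 - 1136160*T^7*a^5*v^5*u*t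
    + 47394720*T^7*a^5*v^4*u^3 - 935280*T^7*a^5*v^3*t^2 - 6056640*T^7*a^5*v^2*u^2*t + 61560*T^7*a^5*v*u^4 + 75600*T^7*a^5*u*t^2 - 7163640*T^6*a^6*v^7*t
    - 71758980*T^6*a^6*v^6*u^2 - 2343600*T^6*a^6*v^4*u*t - 23437080*T^6*a^6*v^3*u^3 + 604800*T^6*a^6*v^2*t^2 + 1657800*T^6*a^6*v*u^2*t + 28350*T^6*a^6*u^4, ?_⟩
  simp only [q2F]; ring

/-- A part of the remainder. -/
def q3F {R : Type*} [CommRing R] (a v u t : R) : R :=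
    -30283740*a^4*v^11*u - 1186380*a^4*v^9*t - 85564620*a^4*v^8*u^2 + 6413580*a^4*v^6*u*t - 60989220*a^4*v^5*u^3 + 710640*a^4*v^4*t^2
    + 12036060*a^4*v^3*u^2*t - 720360*a^4*v^2*u^4 - 421200*a^4*v*u*t^2 + 29700*a^4*u^3*t + 1525500*a^3*v^15 + 17109900*a^3*v^12*u
    - 669600*a^3*v^10*t + 54366120*a^3*v^9*u^2 - 8344080*a^3*v^7*u*t + 50089320*a^3*v^6*u^3 - 105840*a^3*v^5*t^2 - 14037840*a^3*v^4*u^2*t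

theorem q3_ord {R : Type*} [CommRing R] (T a v u t : R) : ∃ r : R, q3F a (T * v) (T ^ 3 * u) (T ^ 5 * t) = T ^ 6 * r := by
  refine ⟨1525500*T^9*a^3*v^15 + 17109900*T^9*a^3*v^12*u - 669600*T^9*a^3*v^10*t + 54366120*T^9*a^3*v^9*u^2 - 8344080*T^9*a^3*v^7*u*t + 50089320*T^9*a^3*v^6*u^3
    - 105840*T^9*a^3*v^5*t^2 - 14037840*T^9*a^3*v^4*u^2*t - 30283740*T^8*a^4*v^11*u - 1186380*T^8*a^4*v^9*t - 85564620*T^8*a^4*v^8*u^2 + 6413580*T^8*a^4*v^6*u*t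
    - 60989220*T^8*a^4*v^5*u^3 + 710640*T^8*a^4*v^4*t^2 + 12036060*T^8*a^4*v^3*u^2*t - 720360*T^8*a^4*v^2*u^4 - 421200*T^8*a^4*v*u*t^2 + 29700*T^8*a^4*u^3*t, ?_⟩
  simp only [q3F]; ring

/-- A part of the remainder. -/
def q4F {R : Type*} [CommRing R] (a v u t : R) : R :=
    1635660*a^3*v^3*u^4 + 928800*a^3*v^2*u*t^2 - 157680*a^3*v*u^3*t + 1836*a^3*u^5 - 6480*a^3*t^3 - 621000*a^2*v^16
    - 6674400*a^2*v^13*u + 745200*a^2*v^11*t - 22875480*a^2*v^10*u^2 + 5590080*a^2*v^8*u*t - 25341120*a^2*v^7*u^3 - 225720*a^2*v^6*t^2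
    + 9588240*a^2*v^5*u^2*t - 1626480*a^2*v^4*u^4 - 1013040*a^2*v^3*u*t^2 + 289440*a^2*v^2*u^3*t - 15120*a^2*v*u^5 + 21600*a^2*v*t^3

theorem q4_ord {R : Type*} [CommRing R] (T a v u t : R) : ∃ r : R, q4F a (T * v) (T ^ 3 * u) (T ^ 5 * t) = T ^ 6 * r := by
  refine ⟨-621000*T^10*a^2*v^16 - 6674400*T^10*a^2*v^13*u + 745200*T^10*a^2*v^11*t - 22875480*T^10*a^2*v^10*u^2 + 5590080*T^10*a^2*v^8*u*t - 25341120*T^10*a^2*v^7*u^3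
    - 225720*T^10*a^2*v^6*t^2 + 9588240*T^10*a^2*v^5*u^2*t - 1626480*T^10*a^2*v^4*u^4 - 1013040*T^10*a^2*v^3*u*t^2 + 289440*T^10*a^2*v^2*u^3*t - 15120*T^10*a^2*v*u^5
    + 21600*T^10*a^2*v*t^3 + 1635660*T^9*a^3*v^3*u^4 + 928800*T^9*a^3*v^2*u*t^2 - 157680*T^9*a^3*v*u^3*t + 1836*T^9*a^3*u^5 - 6480*T^9*a^3*t^3, ?_⟩
  simp only [q4F]; ring

/-- A part of the remainder. -/
def q5F {R : Type*} [CommRing R] (a v u t : R) : R :=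
    -5400*a^2*u^2*t^2 + 151875*a*v^17 + 1613250*a*v^14*u - 280125*a*v^12*t + 5771250*a*v^11*u^2 - 1973700*a*v^9*u*t
    + 7162560*a*v^8*u^3 + 156600*a*v^7*t^2 - 3538350*a*v^6*u^2*t + 754515*a*v^5*u^4 + 546480*a*v^4*u*t^2 - 219780*a*v^3*u^3*t
    + 20790*a*v^2*u^5 - 23760*a*v^2*t^3 + 11880*a*v*u^2*t^2 - 1485*a*u^4*t - 16875*v^18 - 182250*v^15*u

theorem q5_ord {R : Type*} [CommRing R] (T a v u t : R) : ∃ r : R, q5F a (T * v) (T ^ 3 * u) (T ^ 5 * t) = T ^ 6 * r := by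
  refine ⟨-16875*T^12*v^18 - 182250*T^12*v^15*u + 151875*T^11*a*v^17 + 1613250*T^11*a*v^14*u - 280125*T^11*a*v^12*t + 5771250*T^11*a*v^11*u^2
    - 1973700*T^11*a*v^9*u*t + 7162560*T^11*a*v^8*u^3 + 156600*T^11*a*v^7*t^2 - 3538350*T^11*a*v^6*u^2*t + 754515*T^11*a*v^5*u^4 + 546480*T^11*a*v^4*u*t^2
    - 219780*T^11*a*v^3*u^3*t + 20790*T^11*a*v^2*u^5 - 23760*T^11*a*v^2*t^3 + 11880*T^11*a*v*u^2*t^2 - 1485*T^11*a*u^4*t - 5400*T^10*a^2*u^2*t^2, ?_⟩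
  simp only [q5F]; ring

/-- A part of the remainder. -/
def q6F {R : Type*} [CommRing R] (a v u t : R) : R :=
    40500*v^13*t - 666225*v^12*u^2 + 291600*v^10*u*t - 860220*v^9*u^3 - 32400*v^8*t^2 + 541080*v^7*u^2*t
    - 133245*v^6*u^4 - 116640*v^5*u*t^2 + 58320*v^4*u^3*t - 7290*v^3*u^5 + 8640*v^3*t^3 - 6480*v^2*u^2*t^2
    + 1620*v*u^4*t - 135*u^6

theorem q6_ord {R : Type*} [CommRing R] (T a v u t : R) : ∃ r : R, q6F a (T * v) (T ^ 3 * u) (T ^ 5 * t) = T ^ 6 * r := by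
  refine ⟨40500*T^12*v^13*t - 666225*T^12*v^12*u^2 + 291600*T^12*v^10*u*t - 860220*T^12*v^9*u^3 - 32400*T^12*v^8*t^2 + 541080*T^12*v^7*u^2*t
    - 133245*T^12*v^6*u^4 - 116640*T^12*v^5*u*t^2 + 58320*T^12*v^4*u^3*t - 7290*T^12*v^3*u^5 + 8640*T^12*v^3*t^3 - 6480*T^12*v^2*u^2*t^2
    + 1620*T^12*v*u^4*t - 135*T^12*u^6, ?_⟩
  simp only [q6F]; ring

set_option maxRecDepth 100000 in
set_option maxHeartbeats 8000000 in
theorem expl_q {R : Type*} [CommRing R] (a v u t : R) :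
    a ^ 3 * eF a v u t + 5 * bF a v u t ^ 3 - 15 * a ^ 2 * bF a v u t * cF a v u t =
      a ^ 13 * (27 * (25 * t + 50 * v ^ 2 * u + v ^ 5)) + q0F a v u t + q1F a v u t + q2F a v u t + q3F a v u t + q4F a v u t + q5F a v u t + q6F a v u t := by
  simp only [bF, cF, eF, q0F, q1F, q2F, q3F, q4F, q5F, q6F]; ring

theorem lead_k {R : Type*} [CommRing R] (T a v u t : R) : ∃ r : R,
    a ^ 2 * cF a (T * v) (T ^ 3 * u) (T ^ 5 * t) - bF a (T * v) (T ^ 3 * u) (T ^ 5 * t) ^ 2 =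
      T ^ 3 * (a ^ 9 * (15 * u + 3 * v ^ 3) + T * r) := by
  obtain ⟨r0, h0⟩ := k0_ord T a v u t
  obtain ⟨r1, h1⟩ := k1_ord T a v u t
  obtain ⟨r2, h2⟩ := k2_ord T a v u t
  refine ⟨r0 + r1 + r2, ?_⟩
  rw [expl_k, h0, h1, h2]; ring

theorem lead_q {R : Type*} [CommRing R] (T a v u t : R) : ∃ r : R,
    a ^ 3 * eF a (T * v) (T ^ 3 * u) (T ^ 5 * t) + 5 * bF a (T * v) (T ^ 3 * u) (T ^ 5 * t) ^ 3 - 15 * a ^ 2 * bF a (T * v) (T ^ 3 * u) (T ^ 5 * t) * cF a (T * v) (T ^ 3 * u) (T ^ 5 * t) =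
      T ^ 5 * (a ^ 13 * (27 * (25 * t + 50 * v ^ 2 * u + v ^ 5)) + T * r) := by
  obtain ⟨r0, h0⟩ := q0_ord T a v u t
  obtain ⟨r1, h1⟩ := q1_ord T a v u t
  obtain ⟨r2, h2⟩ := q2_ord T a v u t
  obtain ⟨r3, h3⟩ := q3_ord T a v u t
  obtain ⟨r4, h4⟩ := q4_ord T a v u t
  obtain ⟨r5, h5⟩ := q5_ord T a v u t
  obtain ⟨r6, h6⟩ := q6_ord T a v u t
  refine ⟨r0 + r1 + r2 + r3 + r4 + r5 + r6, ?_⟩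
  rw [expl_q, h0, h1, h2, h3, h4, h5, h6]; ring

theorem monomial_map {σ τ : Type*} (φ : MvPolynomial σ ℝ →ₐ[ℝ] MvPolynomial τ ℝ)
    (e : (σ →₀ ℕ) → (τ →₀ ℕ)) (h : ∀ μ r, φ (monomial μ r) = monomial (e μ) r)
    (P : MvPolynomial σ ℝ) :
    (∀ ν ∈ (φ P).support, ∃ μ ∈ P.support, e μ = ν) ∧
    (P ≠ 0 → Set.InjOn e P.support → φ P ≠ 0) := by
  classical
  have h1 : φ P = ∑ μ ∈ P.support, monomial (e μ) (coeff μ P) := by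
    conv_lhs => rw [P.as_sum]
    rw [map_sum]
    exact Finset.sum_congr rfl fun μ _ => h _ _
  constructor
  · intro ν hν
    by_contra hne
    push Not at hne
    rw [mem_support_iff, h1, coeff_sum] at hν
    refine hν (Finset.sum_eq_zero fun μ hμ => ?_)
    rw [coeff_monomial, if_neg (hne μ hμ)]
  · intro h0 hinj h2
    obtain ⟨μ, hμ⟩ := MvPolynomial.ne_zero_iff.mp h0
    have h3 := congrArg (coeff (e μ)) h2
    rw [h1, coeff_sum, coeff_zero, Finset.sum_eq_single μ] at h3
    · rw [coeff_monomial, if_pos rfl] at h3; exact hμ h3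
    · intro ν hν hne
      rw [coeff_monomial, if_neg]
      intro he
      exact hne (hinj hν (mem_support_iff.mpr hμ) he)
    · intro hn
      exact absurd (mem_support_iff.mpr hμ) hn

/-- The monomial substitution. -/
noncomputable def dl : Fin 4 → P4 := ![X 0, X 0 ^ 5 * X 1, X 0 ^ 9 * X 2, X 0 ^ 13 * X 3]

theorem dl_inj : Function.Injective (aeval dl : P4 →ₐ[ℝ] P4) := by
  rw [injective_iff_map_eq_zero]
  intro P
  contrapose
  intro h0
  refine (monomial_map (aeval dl) (fun μ => Finsupp.equivFunOnFinite.symm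
    ![μ 0 + 5 * μ 1 + 9 * μ 2 + 13 * μ 3, μ 1, μ 2, μ 3]) ?_ P).2 h0 ?_
  · intro μ r
    rw [aeval_monomial, Finsupp.prod_fintype _ _ (by simp), monomial_eq,
      Finsupp.prod_fintype _ _ (by simp), algebraMap_eq]
    simp [Fin.prod_univ_four, dl, pow_add, pow_mul, mul_pow]
    left; ring
  · intro μ _ ν _ h
    have h' := fun i => DFunLike.congr_fun h i
    have a0 := h' 0
    have a1 := h' 1
    have a2 := h' 2
    have a3 := h' 3
    simp at a0 a1 a2 a3
    ext i
    fin_cases i <;> simp <;> omega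

/-- Leading coefficient of `k`. -/
noncomputable def k0 : P4 := 15 * uS + 3 * vS ^ 3

/-- Leading coefficient of `q`. -/
noncomputable def q0 : P4 := 27 * (25 * tS + 50 * vS ^ 2 * uS + vS ^ 5)

/-- Leading forms. -/
noncomputable def hh : Fin 4 → P4 :=
  ![X 3 ^ 2, (X 3 ^ 2) ^ 5 * vS, (X 3 ^ 2) ^ 9 * k0, (X 3 ^ 2) ^ 13 * q0]

/-- Triangular substitution. -/
noncomputable def tr : Fin 4 → P4 :=
  ![X 0, X 1, 15 * X 2 + 3 * X 1 ^ 3, 27 * (25 * X 3 + 50 * X 1 ^ 2 * X 2 + X 1 ^ 5)]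

/-- Its inverse. -/
noncomputable def trI : Fin 4 → P4 :=
  ![X 0, X 1, C (1/15) * (X 2 - 3 * X 1 ^ 3),
    C (1/25) * (C (1/27) * X 3 - 50 * X 1 ^ 2 * (C (1/15) * (X 2 - 3 * X 1 ^ 3)) - X 1 ^ 5)]

theorem C_inv_mul (n : ℕ) (hn : n ≠ 0) (x : P4) : C (1 / (n : ℝ)) * ((n : P4) * x) = x := by
  rw [← map_natCast (C : ℝ →+* P4) n, ← mul_assoc, ← map_mul, one_div,
    inv_mul_cancel₀ (by exact_mod_cast hn), map_one, one_mul]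

theorem algInd_hh : AlgebraicIndependent ℝ hh := by
  have e : (aeval g1 : P4 →ₐ[ℝ] P4).comp ((aeval tr : P4 →ₐ[ℝ] P4).comp (aeval dl)) = aeval hh := by
    apply MvPolynomial.algHom_ext
    intro i
    rw [AlgHom.comp_apply, AlgHom.comp_apply, aeval_X, aeval_X]
    fin_cases i
    · simp [g1, tr, dl, hh]
    · simp [g1, tr, dl, hh]
    · simp only [g1, tr, dl, hh, k0, map_add, map_mul, map_pow, aeval_X, Fin.reduceFinMk,
        Matrix.cons_val, map_ofNat]
    · simp only [g1, tr, dl, hh, q0, map_add, map_mul, map_pow, aeval_X, Fin.reduceFinMk,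
        Matrix.cons_val, map_ofNat]
  have e2 : (aeval trI : P4 →ₐ[ℝ] P4).comp (aeval tr) = AlgHom.id ℝ P4 := by
    have i15 := fun x => C_inv_mul 15 (by norm_num) x
    have i25 := fun x => C_inv_mul 25 (by norm_num) x
    have i27 := fun x => C_inv_mul 27 (by norm_num) x
    apply MvPolynomial.algHom_ext
    intro i
    rw [AlgHom.comp_apply, aeval_X]
    push_cast at i15 i25 i27
    fin_cases i
    · simp [tr, trI]
    · simp [tr, trI]
    · simp only [tr, trI, map_add, map_mul, map_pow, aeval_X, Fin.reduceFinMk, Matrix.cons_val,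
        map_ofNat, AlgHom.id_apply]
      linear_combination i15 (X 2 - 3 * X 1 ^ 3)
    · simp only [tr, trI, map_add, map_mul, map_pow, aeval_X, Fin.reduceFinMk, Matrix.cons_val,
        map_ofNat, AlgHom.id_apply]
      linear_combination i27 (X 3) + 27 * i25 (C (1/27) * X 3 - 50 * X 1 ^ 2 * (C (1/15) * (X 2 - 3 * X 1 ^ 3)) - X 1 ^ 5)
  rw [AlgebraicIndependent, ← e, AlgHom.coe_comp, AlgHom.coe_comp]
  refine Function.Injective.comp algInd_g1 (Function.Injective.comp ?_ dl_inj)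
  exact Function.LeftInverse.injective (g := (aeval trI : P4 →ₐ[ℝ] P4))
    (fun x => DFunLike.congr_fun e2 x)

/-- The image of `a` under the scaling. -/
noncomputable def al : Polynomial P4 := Polynomial.X ^ 2 * Polynomial.C vS + Polynomial.C (X 3 ^ 2)

theorem scale_v3 : scale w3 vS = Polynomial.X ^ 2 * Polynomial.C vS := by
  simp only [vS, map_add, map_pow, scale_X, w3, Matrix.cons_val]; ring

theorem scale_a3 : scale w3 aS = al := by
  have : aS = vS + X 3 ^ 2 := by simp only [aS, vS]
  rw [this, map_add, scale_v3, al, map_pow, scale_X]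
  simp [w3]

theorem scale_u3 : scale w3 uS = (Polynomial.X ^ 2) ^ 3 * Polynomial.C uS := by
  rw [uS, map_uF, map_uF, scale_C, ← scale_uF]
  simp only [map_pow, scale_X, w3, Matrix.cons_val, mul_pow, pow_one]

theorem scale_t3 : scale w3 tS = (Polynomial.X ^ 2) ^ 5 * Polynomial.C tS := by
  rw [tS, map_tF, map_tF, scale_C, ← scale_tF]
  simp only [map_pow, scale_X, w3, Matrix.cons_val, mul_pow, pow_one]

theorem al_coeff : al.coeff 0 = X 3 ^ 2 := by
  rw [Polynomial.coeff_zero_eq_eval_zero]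
  simp only [al, Polynomial.eval_add, Polynomial.eval_mul, Polynomial.eval_pow, Polynomial.eval_X,
    Polynomial.eval_C]
  ring

theorem coeff0_lead (n : ℕ) (y : P4) (r : Polynomial P4) :
    (al ^ n * Polynomial.C y + Polynomial.X ^ 2 * r).coeff 0 = (X 3 ^ 2) ^ n * y := by
  rw [Polynomial.coeff_zero_eq_eval_zero]
  simp only [al, Polynomial.eval_add, Polynomial.eval_mul, Polynomial.eval_pow, Polynomial.eval_X,
    Polynomial.eval_C]
  ring

theorem lead_data : ∃ b1 k1 q1 : Polynomial P4,
    scale w3 bS = Polynomial.X ^ 2 * b1 ∧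
    al ^ 2 * scale w3 cS - scale w3 bS ^ 2 = Polynomial.X ^ 6 * k1 ∧
    al ^ 3 * scale w3 eS + 5 * scale w3 bS ^ 3 - 15 * al ^ 2 * scale w3 bS * scale w3 cS =
      Polynomial.X ^ 10 * q1 ∧
    b1.coeff 0 = (X 3 ^ 2) ^ 5 * vS ∧ k1.coeff 0 = (X 3 ^ 2) ^ 9 * k0 ∧
    q1.coeff 0 = (X 3 ^ 2) ^ 13 * q0 := by
  have hb : scale w3 bS = bF al (Polynomial.X ^ 2 * Polynomial.C vS)
      ((Polynomial.X ^ 2) ^ 3 * Polynomial.C uS) ((Polynomial.X ^ 2) ^ 5 * Polynomial.C tS) := by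
    rw [bS, map_bF, scale_a3, scale_v3, scale_u3, scale_t3]
  have hc : scale w3 cS = cF al (Polynomial.X ^ 2 * Polynomial.C vS)
      ((Polynomial.X ^ 2) ^ 3 * Polynomial.C uS) ((Polynomial.X ^ 2) ^ 5 * Polynomial.C tS) := by
    rw [cS, map_cF, scale_a3, scale_v3, scale_u3, scale_t3]
  have he : scale w3 eS = eF al (Polynomial.X ^ 2 * Polynomial.C vS)
      ((Polynomial.X ^ 2) ^ 3 * Polynomial.C uS) ((Polynomial.X ^ 2) ^ 5 * Polynomial.C tS) := by
    rw [eS, map_eF, scale_a3, scale_v3, scale_u3, scale_t3]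
  obtain ⟨r1, h1⟩ := lead_b (Polynomial.X ^ 2) al (Polynomial.C vS) (Polynomial.C uS)
    (Polynomial.C tS)
  obtain ⟨r2, h2⟩ := lead_k (Polynomial.X ^ 2) al (Polynomial.C vS) (Polynomial.C uS)
    (Polynomial.C tS)
  obtain ⟨r3, h3⟩ := lead_q (Polynomial.X ^ 2) al (Polynomial.C vS) (Polynomial.C uS)
    (Polynomial.C tS)
  rw [← hb] at h1
  rw [← hb, ← hc] at h2
  rw [← hb, ← hc, ← he] at h3
  refine ⟨_, _, _, h1, h2.trans ?_, h3.trans ?_, coeff0_lead 5 vS r1, coeff0_lead 9 k0 r2,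
    coeff0_lead 13 q0 r3⟩
  · simp only [k0, map_add, map_mul, map_pow, map_ofNat]; ring
  · simp only [q0, map_add, map_mul, map_pow, map_ofNat]; ring

theorem dvd_iff_of {U V W : Polynomial P4} {n : ℕ} (h : V * W = Polynomial.X ^ n * U)
    (hV : V.coeff 0 ≠ 0) (hU : U.coeff 0 ≠ 0) (m : ℕ) : Polynomial.X ^ m ∣ W ↔ m ≤ n := by
  have hp : Prime (Polynomial.X : Polynomial P4) := Polynomial.prime_X
  constructor
  · intro hd
    by_contra hlt
    push Not at hlt
    have h1 : Polynomial.X ^ (n + 1) ∣ Polynomial.X ^ n * U := by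
      rw [← h]; exact ((pow_dvd_pow _ hlt).trans hd).mul_left V
    rw [pow_succ] at h1
    have h2 := (mul_dvd_mul_iff_left (pow_ne_zero n hp.ne_zero)).mp h1
    exact hU (Polynomial.X_dvd_iff.mp h2)
  · intro hle
    have h1 : Polynomial.X ^ m ∣ V * W := by
      rw [h]; exact (pow_dvd_pow _ hle).mul_right U
    exact hp.pow_dvd_of_dvd_mul_left m (fun hd => hV (Polynomial.X_dvd_iff.mp hd)) h1

/-- Weights of `a,b,k,q` (half of the order of vanishing). -/
def wO : Fin 4 → ℕ := ![0, 1, 3, 5]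

theorem lemmaO (b1 k1 q1 : Polynomial P4) (hb : b1.coeff 0 = (X 3 ^ 2) ^ 5 * vS)
    (hk : k1.coeff 0 = (X 3 ^ 2) ^ 9 * k0) (hq : q1.coeff 0 = (X 3 ^ 2) ^ 13 * q0)
    (Q : P4) (hQ : Q ≠ 0) : ∃ (r : ℕ) (U : Polynomial P4),
      (∀ μ ∈ Q.support, r ≤ Finsupp.weight wO μ) ∧ U.coeff 0 ≠ 0 ∧
      aeval ![al, Polynomial.X ^ 2 * b1, Polynomial.X ^ 6 * k1, Polynomial.X ^ 10 * q1] Q =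
        Polynomial.X ^ (2 * r) * U := by
  obtain ⟨μ0, hμ0, hmin⟩ := Finset.exists_min_image Q.support (Finsupp.weight wO)
    (support_nonempty.mpr hQ)
  set r := Finsupp.weight wO μ0
  set θ : P4 →ₐ[ℝ] Polynomial P4 := aeval ![al, b1, k1, q1] with hθ
  set Θ : Polynomial P4 →+* Polynomial P4 :=
    Polynomial.eval₂RingHom θ.toRingHom (Polynomial.X ^ 2) with hΘ
  have hΘX : Θ Polynomial.X = Polynomial.X ^ 2 := by
    rw [hΘ, Polynomial.coe_eval₂RingHom, Polynomial.eval₂_X]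
  have hΘC : ∀ p, Θ (Polynomial.C p) = θ p := by
    intro p
    rw [hΘ, Polynomial.coe_eval₂RingHom, Polynomial.eval₂_C]; rfl
  have h1 : ∀ P : P4, aeval ![al, Polynomial.X ^ 2 * b1, Polynomial.X ^ 6 * k1,
      Polynomial.X ^ 10 * q1] P = Θ (scale wO P) := by
    intro P
    induction P using MvPolynomial.induction_on with
    | C a =>
      rw [scale_C, hΘC, hθ, aeval_C, aeval_C]
    | add p q hp hq => rw [map_add, hp, hq, map_add, map_add]
    | mul_X p i hp =>
      rw [map_mul, hp, map_mul, map_mul, scale_X, map_mul, map_pow, hΘX, hΘC, hθ, aeval_X, aeval_X]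
      congr 1
      fin_cases i <;> simp only [wO, Fin.reduceFinMk, Matrix.cons_val, Fin.zero_eta,
        Fin.mk_one] <;> ring
  have h2 : Polynomial.X ^ r ∣ scale wO Q := by
    rw [Polynomial.X_pow_dvd_iff]
    intro n hn
    rw [coeff_scale]
    apply weightedHomogeneousComponent_eq_zero'
    intro μ hμ he
    have := hmin μ hμ
    omega
  obtain ⟨S, hS⟩ := h2
  have hS0 : S.coeff 0 ≠ 0 := by
    have h3 : (scale wO Q).coeff r = S.coeff 0 := by
      rw [hS, Polynomial.coeff_X_pow_mul', if_pos le_rfl, Nat.sub_self]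
    rw [← h3, coeff_scale]
    intro h4
    have h5 := congrArg (coeff μ0) h4
    rw [coeff_weightedHomogeneousComponent, if_pos rfl, coeff_zero] at h5
    exact mem_support_iff.mp hμ0 h5
  refine ⟨r, Θ S, hmin, ?_, ?_⟩
  · have h3 : ∀ p : P4, (θ p).coeff 0 = aeval hh p := by
      intro p
      have : (Polynomial.constantCoeff : Polynomial P4 →+* P4).comp θ.toRingHom =
          (aeval hh : P4 →ₐ[ℝ] P4).toRingHom := by
        apply MvPolynomial.ringHom_ext
        · intro x
          change Polynomial.constantCoeff (θ (C x)) = aeval hh (C x)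
          rw [hθ, aeval_C, aeval_C]
          exact Polynomial.coeff_C_zero
        · intro i
          change (θ (X i)).coeff 0 = aeval hh (X i)
          rw [hθ, aeval_X, aeval_X]
          fin_cases i
          · exact al_coeff
          · exact hb
          · exact hk
          · exact hq
      exact RingHom.congr_fun this p
    have h4 : (Θ S).coeff 0 = aeval hh (S.coeff 0) := by
      rw [← h3]
      conv_lhs => rw [← Polynomial.divX_mul_X_add S]
      rw [map_add, map_mul, hΘX, hΘC, Polynomial.coeff_add, ← mul_one (Polynomial.X ^ 2),
        ← mul_assoc, mul_one, Polynomial.mul_coeff_zero]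
      simp
    rw [h4]
    intro h5
    exact hS0 (algInd_hh (h5.trans (map_zero _).symm))
  · rw [h1, hS, map_mul, map_pow, hΘX, ← pow_mul]

/-- Clearing denominators. -/
noncomputable def fst : Fin 4 → P4 := ![X 0, X 1, X 0 ^ 2 * X 2, X 0 ^ 3 * X 3]

theorem exists_star (P : P4) : ∃ (M : ℕ) (Ps : P4), X 0 ^ M * P = aeval fst Ps := by
  induction P using MvPolynomial.induction_on with
  | C a => exact ⟨0, C a, by rw [aeval_C, pow_zero, one_mul]; rfl⟩
  | add p q hp hq =>
    obtain ⟨M, p', hp⟩ := hp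
    obtain ⟨N, q', hq⟩ := hq
    refine ⟨M + N, X 0 ^ N * p' + X 0 ^ M * q', ?_⟩
    rw [map_add, map_mul, map_mul, ← hp, ← hq, map_pow, map_pow, aeval_X]
    simp only [fst, Matrix.cons_val]; ring
  | mul_X p i hp =>
    obtain ⟨M, p', hp⟩ := hp
    refine ⟨M + 3, p' * ![X 0 ^ 4, X 0 ^ 3 * X 1, X 0 * X 2, X 3] i, ?_⟩
    rw [map_mul, ← hp]
    fin_cases i <;> simp [fst] <;> ring

/-- The change of variables from `a,b,a²c,a³e` to `a,b,k,q`. -/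
noncomputable def Ph : Fin 4 → P4 :=
  ![X 0, X 1, X 2 + X 1 ^ 2, X 3 + 10 * X 1 ^ 3 + 15 * X 1 * X 2]

theorem Ph_inj : Function.Injective (aeval Ph : P4 →ₐ[ℝ] P4) := by
  have e2 : (aeval ![X 0, X 1, X 2 - X 1 ^ 2, X 3 - 10 * X 1 ^ 3 - 15 * X 1 * (X 2 - X 1 ^ 2)] :
      P4 →ₐ[ℝ] P4).comp (aeval Ph) = AlgHom.id ℝ P4 := by
    apply MvPolynomial.algHom_ext
    intro i
    rw [AlgHom.comp_apply, aeval_X]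
    fin_cases i <;> simp only [Ph, map_add, map_mul, map_pow, aeval_X, Fin.reduceFinMk,
      Matrix.cons_val, map_ofNat, AlgHom.id_apply, Fin.zero_eta, Fin.mk_one] <;> ring
  exact Function.LeftInverse.injective (g := (aeval _ : P4 →ₐ[ℝ] P4))
    (fun x => DFunLike.congr_fun e2 x)

theorem ord_spec (P : P4) (hP : P ≠ 0) : ∃ (M : ℕ) (Ps : P4) (r : ℕ),
    X 0 ^ M * P = aeval fst Ps ∧
    (∀ μ ∈ (aeval Ph Ps : P4).support, r ≤ Finsupp.weight wO μ) ∧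
    ∀ m, Polynomial.X ^ m ∣ scale w3 (aeval gH P) ↔ m ≤ 2 * r := by
  obtain ⟨M, Ps, hM⟩ := exists_star P
  obtain ⟨b1, k1, q1, hb, hk, hq, cb, ck, cq⟩ := lead_data
  have hPs : (aeval Ph Ps : P4) ≠ 0 := by
    intro h
    have h1 : Ps = 0 := Ph_inj (h.trans (map_zero _).symm)
    rw [h1, map_zero, mul_eq_zero] at hM
    exact hM.elim (pow_ne_zero _ (X_ne_zero 0)) hP
  obtain ⟨r, U, h1, h2, h3⟩ := lemmaO b1 k1 q1 cb ck cq _ hPs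
  refine ⟨M, Ps, r, hM, h1, fun m => ?_⟩
  refine dvd_iff_of (V := al ^ M) (U := U) ?_ ?_ h2 m
  · rw [← h3]
    have e1 : (scale w3).comp (aeval gH : P4 →ₐ[ℝ] P4) =
        aeval ![al, scale w3 bS, scale w3 cS, scale w3 eS] := by
      apply MvPolynomial.algHom_ext
      intro i
      rw [AlgHom.comp_apply, aeval_X, aeval_X]
      fin_cases i
      · exact scale_a3
      · rfl
      · rfl
      · rfl
    have e2 : (aeval ![al, scale w3 bS, scale w3 cS, scale w3 eS] : P4 →ₐ[ℝ] Polynomial P4).comp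
        (aeval fst : P4 →ₐ[ℝ] P4) =
        (aeval ![al, Polynomial.X ^ 2 * b1, Polynomial.X ^ 6 * k1, Polynomial.X ^ 10 * q1] :
          P4 →ₐ[ℝ] Polynomial P4).comp (aeval Ph : P4 →ₐ[ℝ] P4) := by
      rw [← hb, ← hk, ← hq]
      apply MvPolynomial.algHom_ext
      intro i
      rw [AlgHom.comp_apply, aeval_X, AlgHom.comp_apply, aeval_X]
      fin_cases i <;> simp only [Ph, fst, map_add, map_mul, map_pow, aeval_X, Fin.reduceFinMk,
        Matrix.cons_val, map_ofNat, Fin.zero_eta, Fin.mk_one] <;> ring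
    rw [← AlgHom.comp_apply (aeval _) (aeval Ph), ← e2, AlgHom.comp_apply, ← hM, ← AlgHom.comp_apply,
      e1, map_mul, map_pow, aeval_X]
    rfl
  · rw [Polynomial.coeff_zero_eq_eval_zero, Polynomial.eval_pow,
      ← Polynomial.coeff_zero_eq_eval_zero, al_coeff]
    exact pow_ne_zero _ (pow_ne_zero _ (X_ne_zero 3))

/-- Polynomials in two variables. -/
abbrev P2 := MvPolynomial (Fin 2) ℝ

/-- Weighted scaling with weights `2, 3`. -/
noncomputable def scB : P2 →ₐ[ℝ] Polynomial P2 :=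
  aeval ![Polynomial.X ^ 2 * Polynomial.C (X 0), Polynomial.X ^ 3 * Polynomial.C (X 1)]

theorem scB_monomial (μ : Fin 2 →₀ ℕ) (r : ℝ) :
    scB (monomial μ r) = Polynomial.monomial (2 * μ 0 + 3 * μ 1) (monomial μ r) := by
  rw [scB, aeval_monomial, Finsupp.prod_fintype _ _ (by simp), monomial_eq,
    Finsupp.prod_fintype _ _ (by simp), ← Polynomial.C_mul_X_pow_eq_monomial]
  simp only [Fin.prod_univ_two, mul_pow, map_mul, map_pow, pow_add, Matrix.cons_val, pow_mul]
  rw [show algebraMap ℝ (Polynomial P2) r = Polynomial.C (C r) from rfl]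
  ring

theorem coeff_scB (p : P2) (m : ℕ) (ν : Fin 2 →₀ ℕ) :
    coeff ν ((scB p).coeff m) = if 2 * ν 0 + 3 * ν 1 = m then coeff ν p else 0 := by
  classical
  induction p using MvPolynomial.induction_on' with
  | monomial μ r =>
    rw [scB_monomial, Polynomial.coeff_monomial]
    by_cases h : μ = ν
    · subst h
      split_ifs <;> simp
    · rw [coeff_monomial, if_neg h]
      split_ifs <;> simp [coeff_monomial, h]
  | add p q hp hq =>
    rw [map_add, Polynomial.coeff_add, coeff_add, hp, hq, coeff_add]
    split_ifs <;> simp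

theorem scB_le_iff (p : P2) (n : ℕ) :
    (∀ ν ∈ p.support, 2 * ν 0 + 3 * ν 1 ≤ n) ↔ (scB p).natDegree ≤ n := by
  rw [Polynomial.natDegree_le_iff_coeff_eq_zero]
  constructor
  · intro h N hN
    ext ν
    rw [coeff_scB, coeff_zero]
    split_ifs with h1
    · by_contra h2
      have := h ν (mem_support_iff.mpr h2)
      omega
    · rfl
  · intro h ν hν
    by_contra hlt
    push Not at hlt
    have h1 := congrArg (coeff ν) (h _ hlt)
    rw [coeff_scB, if_pos rfl, coeff_zero] at h1
    exact mem_support_iff.mp hν h1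

theorem scB_ge_iff (p : P2) (L : ℕ) :
    (∀ ν ∈ p.support, L ≤ 2 * ν 0 + 3 * ν 1) ↔ Polynomial.X ^ L ∣ scB p := by
  rw [Polynomial.X_pow_dvd_iff]
  constructor
  · intro h N hN
    ext ν
    rw [coeff_scB, coeff_zero]
    split_ifs with h1
    · by_contra h2
      have := h ν (mem_support_iff.mpr h2)
      omega
    · rfl
  · intro h ν hν
    by_contra hlt
    push Not at hlt
    have h1 := congrArg (coeff ν) (h _ hlt)
    rw [coeff_scB, if_pos rfl, coeff_zero] at h1
    exact mem_support_iff.mp hν h1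

/-- Expansion at the point `(1,10)`. -/
noncomputable def rh : P2 →ₐ[ℝ] Polynomial P2 :=
  aeval ![1 + Polynomial.C (X 0) * Polynomial.X,
    10 + 15 * Polynomial.C (X 0) * Polynomial.X + Polynomial.C (X 1) * Polynomial.X ^ 2]

/-- Restriction to the parabola. -/
noncomputable def pb : P2 →ₐ[ℝ] Polynomial ℝ :=
  aeval ![Polynomial.X, 5 * Polynomial.X ^ 2 + 5 * Polynomial.X]

/-- The equation of the parabola. -/
noncomputable def gpb : P2 := X 1 - (5 * X 0 ^ 2 + 5 * X 0)

theorem gpb_dvd (p : P2) (h : pb p = 0) : gpb ∣ p := by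
  set η : P2 →ₐ[ℝ] P2 := aeval ![X 0, 5 * X 0 ^ 2 + 5 * X 0]
  have h1 : (Polynomial.aeval (X 0 : P2)).comp pb = η := by
    apply MvPolynomial.algHom_ext
    intro i
    rw [AlgHom.comp_apply, pb, aeval_X, aeval_X]
    fin_cases i
    · simp
    · simp only [Fin.mk_one, Matrix.cons_val, map_add, map_mul, map_pow, map_ofNat,
        Polynomial.aeval_X]
  have h2 : η p = 0 := by rw [← h1, AlgHom.comp_apply, h, map_zero]
  have h3 : (Ideal.Quotient.mkₐ ℝ (Ideal.span {gpb})).comp η =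
      Ideal.Quotient.mkₐ ℝ (Ideal.span {gpb}) := by
    apply MvPolynomial.algHom_ext
    intro i
    rw [AlgHom.comp_apply, aeval_X]
    fin_cases i
    · rfl
    · symm
      rw [Ideal.Quotient.mkₐ_eq_mk]
      exact Ideal.Quotient.eq.mpr (Ideal.mem_span_singleton_self gpb)
  have h4 := DFunLike.congr_fun h3 p
  rw [AlgHom.comp_apply, h2, map_zero] at h4
  rw [← Ideal.mem_span_singleton, ← Ideal.Quotient.eq_zero_iff_mem]
  exact h4.symm

theorem rh_gpb : rh gpb = Polynomial.X ^ 2 * Polynomial.C (X 1 - 5 * X 0 ^ 2) := by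
  simp only [rh, gpb, map_sub, map_add, map_mul, map_pow, map_ofNat, aeval_X, Matrix.cons_val]
  ring

theorem scB_gpb : scB gpb = Polynomial.X ^ 2 * (Polynomial.X * Polynomial.C (X 1) -
    Polynomial.X ^ 2 * Polynomial.C (5 * X 0 ^ 2) - Polynomial.C (5 * X 0)) := by
  simp only [scB, gpb, map_sub, map_add, map_mul, map_pow, map_ofNat, aeval_X, Matrix.cons_val]
  ring

theorem five_ne (p : P2) (hp : p ≠ 0) : 5 * p ≠ 0 := by
  have : (5 : P2) ≠ 0 := by exact_mod_cast (by norm_num : (5 : ℕ) ≠ 0)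
  exact mul_ne_zero this hp

theorem scB_gpb_deg : 4 ≤ (scB gpb).natDegree := by
  apply Polynomial.le_natDegree_of_ne_zero
  rw [scB_gpb, Polynomial.coeff_X_pow_mul', if_pos (by norm_num)]
  have : (Polynomial.X * Polynomial.C (X 1 : P2) -
    Polynomial.X ^ 2 * Polynomial.C (5 * X 0 ^ 2) - Polynomial.C (5 * X 0)).coeff 2 =
      -(5 * X 0 ^ 2) := by
    rw [Polynomial.coeff_sub, Polynomial.coeff_sub, Polynomial.coeff_mul_C, Polynomial.coeff_mul_C,
      Polynomial.coeff_X_pow, Polynomial.coeff_X, Polynomial.coeff_C]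
    simp
  rw [show 4 - 2 = 2 from rfl, this]
  exact neg_ne_zero.mpr (five_ne _ (pow_ne_zero _ (X_ne_zero 0)))

/-- The minimal half degree of an invariant with half order `m`. -/
def Em (m : ℕ) : ℕ :=
  18 * (m / 5) + (if m % 5 = 0 then 0 else if m % 5 = 1 then 4 else if m % 5 = 2 then 8
    else if m % 5 = 3 then 12 else 15) +
  (if m = 1 then 2 else if m = 2 then 2 else if m = 4 then 1 else if m = 7 then 1 else 0)

theorem Em_big (m : ℕ) (h : 8 ≤ m) : Em m + (m % 5) / 4 = 18 * (m / 5) + 4 * (m % 5) := by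
  have h1 : ¬ m = 1 := by omega
  have h2 : ¬ m = 2 := by omega
  have h4 : ¬ m = 4 := by omega
  have h7 : ¬ m = 7 := by omega
  simp only [Em, if_neg h1, if_neg h2, if_neg h4, if_neg h7]
  split_ifs <;> omega

theorem Em_step (m : ℕ) : Em m ≤ Em (m + 1) := by
  rcases lt_or_ge m 8 with h | h
  · interval_cases m <;> decide
  · have h1 := Em_big m h
    have h2 := Em_big (m + 1) (by omega)
    omega

theorem Em_mono : Monotone Em := monotone_nat_of_le_succ Em_step

theorem Em_six (m : ℕ) : Em m ≤ Em (m - 6) + 22 := by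
  rcases lt_or_ge m 14 with h | h
  · interval_cases m <;> decide
  · have h1 := Em_big m (by omega)
    have h2 := Em_big (m - 6) (by omega)
    omega

theorem Em_arith (n L s B : ℕ) (h1 : 3 * (B + s) ≤ 2 * n) (h2 : L ≤ 3 * B) (h3 : L ≤ n)
    (h4 : ¬ (n = 3 ∧ L = 3 ∧ s = 1)) : Em (n + s) + L ≤ 6 * n := by
  rcases lt_or_ge (n + s) 8 with h | h
  · have hE : ∀ m < 8, Em m = [0, 6, 10, 12, 16, 18, 22, 27].getD m 0 := by decide
    rw [hE _ h]
    generalize hm : n + s = m at h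
    interval_cases m <;> simp only [List.getD_cons_zero, List.getD_cons_succ] <;> omega
  · have h5 := Em_big _ h
    have h6 : (n + s) % 5 < 5 := Nat.mod_lt _ (by norm_num)
    have h7 := Nat.div_add_mod (n + s) 5
    generalize (n + s) % 5 = j at *
    generalize (n + s) / 5 = k at *
    interval_cases j <;> omega

theorem pb_monomial (μ : Fin 2 →₀ ℕ) (r : ℝ) : pb (monomial μ r) =
    Polynomial.C r * (Polynomial.X ^ μ 0 * (5 * Polynomial.X ^ 2 + 5 * Polynomial.X) ^ μ 1) := by
  rw [pb, aeval_monomial, Finsupp.prod_fintype _ _ (by simp)]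
  simp only [Fin.prod_univ_two, Matrix.cons_val]
  rfl

theorem pb_sum (p : P2) : pb p = ∑ μ ∈ p.support, Polynomial.C (coeff μ p) *
    (Polynomial.X ^ μ 0 * (5 * Polynomial.X ^ 2 + 5 * Polynomial.X) ^ μ 1) := by
  conv_lhs => rw [p.as_sum]
  rw [map_sum]
  exact Finset.sum_congr rfl fun μ _ => pb_monomial _ _

theorem pb_deg (p : P2) (n : ℕ) (h : ∀ ν ∈ p.support, 2 * ν 0 + 3 * ν 1 ≤ n) :
    3 * (pb p).natDegree ≤ 2 * n := by
  have : (pb p).natDegree ≤ 2 * n / 3 := by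
    rw [pb_sum]
    apply Polynomial.natDegree_sum_le_of_forall_le
    intro μ hμ
    have h1 := h μ hμ
    have h2 : (5 * Polynomial.X ^ 2 + 5 * Polynomial.X : Polynomial ℝ).natDegree ≤ 2 := by
      compute_degree
    refine (Polynomial.natDegree_C_mul_le _ _).trans (Polynomial.natDegree_mul_le.trans ?_)
    have h3 := Polynomial.natDegree_pow_le_of_le (μ 1) h2
    rw [Polynomial.natDegree_X_pow]
    omega
  omega

theorem pb_dvd (p : P2) (L : ℕ) (h : ∀ ν ∈ p.support, L ≤ 2 * ν 0 + 3 * ν 1) :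
    Polynomial.X ^ ((L + 2) / 3) ∣ pb p := by
  rw [pb_sum]
  refine Finset.dvd_sum fun μ hμ => Dvd.dvd.mul_left ?_ _
  have h1 := h μ hμ
  have h2 : (5 * Polynomial.X ^ 2 + 5 * Polynomial.X : Polynomial ℝ) =
    Polynomial.X * (5 * Polynomial.X + 5) := by ring
  rw [h2, mul_pow, ← mul_assoc, ← pow_add]
  exact (pow_dvd_pow _ (by omega)).mul_right _

theorem pb_one_dvd (p : P2) (s : ℕ) (h : Polynomial.X ^ s ∣ rh p) :
    (Polynomial.X - 1) ^ s ∣ pb p := by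
  set ψ : Polynomial P2 →+* Polynomial ℝ := Polynomial.eval₂RingHom
    (aeval ![1, 5] : P2 →ₐ[ℝ] Polynomial ℝ).toRingHom (Polynomial.X - 1) with hψ
  have hX : ψ Polynomial.X = Polynomial.X - 1 := by
    rw [hψ, Polynomial.coe_eval₂RingHom, Polynomial.eval₂_X]
  have hC : ∀ q, ψ (Polynomial.C q) = aeval ![1, 5] q := by
    intro q
    rw [hψ, Polynomial.coe_eval₂RingHom, Polynomial.eval₂_C]; rfl
  have h1 : ∀ q, ψ (rh q) = pb q := by
    intro q
    induction q using MvPolynomial.induction_on with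
    | C a =>
      rw [rh, pb, aeval_C, aeval_C, show algebraMap ℝ (Polynomial P2) a = Polynomial.C (C a) from rfl,
        hC, aeval_C]
    | add p q hp hq => rw [map_add, map_add, hp, hq, map_add]
    | mul_X p i hp =>
      rw [map_mul, map_mul, hp, map_mul]
      congr 1
      rw [rh, pb, aeval_X, aeval_X]
      fin_cases i
      · simp only [Fin.zero_eta, Matrix.cons_val, map_add, map_mul, hX, hC, map_one, aeval_X]
        ring
      · simp only [Fin.mk_one, Matrix.cons_val, map_add, map_mul, map_pow, hX, hC, map_ofNat,
          aeval_X]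
        ring
  obtain ⟨y, hy⟩ := h
  rw [← h1, hy, map_mul, map_pow, hX]
  exact dvd_mul_right _ _

theorem key (n : ℕ) : ∀ (L s : ℕ) (p : P2), p ≠ 0 →
    (∀ ν ∈ p.support, L ≤ 2 * ν 0 + 3 * ν 1) → (∀ ν ∈ p.support, 2 * ν 0 + 3 * ν 1 ≤ n) →
    Polynomial.X ^ s ∣ rh p → Em (n + s) + L ≤ 6 * n := by
  induction n using Nat.strong_induction_on with
  | _ n ih =>
  intro L s p hp hL hn hs
  by_cases hf : pb p = 0
  · obtain ⟨p1, rfl⟩ := gpb_dvd p hf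
    have hp1 : p1 ≠ 0 := right_ne_zero_of_mul hp
    have hpr : Prime (Polynomial.X : Polynomial P2) := Polynomial.prime_X
    have hinj : scB p1 ≠ 0 := by
      intro h0
      obtain ⟨ν, hν⟩ := MvPolynomial.ne_zero_iff.mp hp1
      have h1 := coeff_scB p1 (2 * ν 0 + 3 * ν 1) ν
      rw [h0, if_pos rfl] at h1
      simp at h1
      exact hν h1.symm
    have hg := scB_gpb_deg
    have hg0 : scB gpb ≠ 0 := by
      intro h0; rw [h0] at hg; simp at hg
    rw [scB_le_iff, map_mul, Polynomial.natDegree_mul hg0 hinj] at hn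
    rw [scB_ge_iff, map_mul, scB_gpb, mul_assoc] at hL
    rw [map_mul, rh_gpb, mul_assoc] at hs
    have cancel : ∀ (j : ℕ) (y z : Polynomial P2), y.coeff 0 ≠ 0 →
        Polynomial.X ^ j ∣ Polynomial.X ^ 2 * (y * z) → Polynomial.X ^ (j - 2) ∣ z := by
      intro j y z hy hd
      rcases le_or_gt j 2 with hj | hj
      · rw [Nat.sub_eq_zero_of_le hj, pow_zero]; exact one_dvd _
      · obtain ⟨i, rfl⟩ := Nat.exists_eq_add_of_lt hj
        have e : 2 + i + 1 - 2 = i + 1 := by omega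
        rw [e]
        rw [add_assoc, pow_add] at hd
        have h2 := (mul_dvd_mul_iff_left (pow_ne_zero 2 hpr.ne_zero)).mp hd
        exact hpr.pow_dvd_of_dvd_mul_left _ (fun hd => hy (Polynomial.X_dvd_iff.mp hd)) h2
    have hL' := cancel L _ _ (by
      rw [Polynomial.coeff_sub, Polynomial.coeff_sub, Polynomial.coeff_mul_C,
        Polynomial.coeff_mul_C, Polynomial.coeff_X_pow, Polynomial.coeff_X, Polynomial.coeff_C]
      simp) hL
    have hs' := cancel s _ _ (by
      rw [Polynomial.coeff_C_zero]
      intro h0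
      have := congrArg (eval ![0, 1]) h0
      simp at this) hs
    have := ih (n - 4) (by omega) (L - 2) (s - 2) p1 hp1 ((scB_ge_iff _ _).mpr hL')
      ((scB_le_iff _ _).mpr (by omega)) hs'
    have h6 := Em_six (n + s)
    have h7 : Em (n + s - 6) ≤ Em (n - 4 + (s - 2)) := Em_mono (by omega)
    omega
  · have h1 := pb_deg p n hn
    have h2 := pb_dvd p L hL
    have h3 := pb_one_dvd p s hs
    have hcop : IsCoprime (Polynomial.X ^ ((L + 2) / 3) : Polynomial ℝ) ((Polynomial.X - 1) ^ s) := by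
      apply IsCoprime.pow
      exact ⟨1, -1, by ring⟩
    have h4 := hcop.mul_dvd h2 h3
    have h5 := Polynomial.natDegree_le_of_dvd h4 hf
    have hm : (Polynomial.X - 1 : Polynomial ℝ).Monic := Polynomial.monic_X_sub_C 1
    rw [(Polynomial.monic_X_pow _).natDegree_mul (hm.pow s), Polynomial.natDegree_X_pow,
      hm.natDegree_pow, show (Polynomial.X - 1 : Polynomial ℝ).natDegree = 1 from
        Polynomial.natDegree_X_sub_C 1] at h5
    obtain ⟨ν, hν⟩ := MvPolynomial.ne_zero_iff.mp hp
    have h6 := hL ν (mem_support_iff.mpr hν)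
    have h7 := hn ν (mem_support_iff.mpr hν)
    refine Em_arith n L s ((L + 2) / 3) (by omega) (by omega) (by omega) ?_
    rintro ⟨rfl, rfl, rfl⟩
    rw [pow_one] at h3
    have h8 : (pb p).eval 1 = 0 := by
      obtain ⟨y, hy⟩ := h3
      rw [hy]; simp
    have h9 : p.support ⊆ {ν} := by
      intro κ hκ
      have a1 := hL κ hκ
      have a2 := hn κ hκ
      rw [Finset.mem_singleton]
      ext i
      fin_cases i <;> simp <;> omega
    rw [pb_sum, Finset.sum_subset h9 (fun x _ hx => by
      rw [notMem_support_iff.mp hx, map_zero, zero_mul]), Finset.sum_singleton] at h8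
    norm_num at h8
    exact hν h8

/-- The grading preserved by the substitutions. -/
def wN : Fin 4 → ℕ := ![0, 1, 2, 3]

theorem wN_weight (μ : Fin 4 →₀ ℕ) : Finsupp.weight wN μ = μ 1 + 2 * μ 2 + 3 * μ 3 := by
  rw [Finsupp.weight_apply, Finsupp.sum_fintype _ _ (by simp), Fin.sum_univ_four]
  simp only [wN, Matrix.cons_val, smul_eq_mul]; ring

theorem wO_weight (μ : Fin 4 →₀ ℕ) : Finsupp.weight wO μ = μ 1 + 3 * μ 2 + 5 * μ 3 := by
  rw [Finsupp.weight_apply, Finsupp.sum_fintype _ _ (by simp), Fin.sum_univ_four]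
  simp only [wO, Matrix.cons_val, smul_eq_mul]; ring

theorem d2_weight (μ : Fin 4 →₀ ℕ) :
    Finsupp.weight d2 μ = μ 0 + 6 * μ 1 + 10 * μ 2 + 15 * μ 3 := by
  rw [Finsupp.weight_apply, Finsupp.sum_fintype _ _ (by simp), Fin.sum_univ_four]
  simp only [d2, Matrix.cons_val, smul_eq_mul]; ring

theorem fst_hom (i : Fin 4) : IsWeightedHomogeneous wN (fst i) (wN i) := by
  apply wh_of_scale
  fin_cases i <;> simp only [fst, wN, map_mul, map_pow, scale_X, Matrix.cons_val, Fin.zero_eta,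
    Fin.mk_one, Fin.reduceFinMk] <;> ring

theorem Ph_hom (i : Fin 4) : IsWeightedHomogeneous wN (Ph i) (wN i) := by
  apply wh_of_scale
  fin_cases i <;> simp only [Ph, wN, map_add, map_mul, map_pow, map_ofNat, scale_X, Matrix.cons_val,
    Fin.zero_eta, Fin.mk_one, Fin.reduceFinMk] <;> ring

theorem comp_X0 (n M : ℕ) (P : P4) : weightedHomogeneousComponent wN n (X 0 ^ M * P) =
    X 0 ^ M * weightedHomogeneousComponent wN n P := by
  rw [← coeff_scale, ← coeff_scale, map_mul, map_pow, scale_X]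
  simp only [wN, Matrix.cons_val, pow_zero, one_mul]
  rw [← map_pow, Polynomial.coeff_C_mul]

/-- Dehomogenisation. -/
noncomputable def dh : P4 →ₐ[ℝ] P2 := aeval ![1, 1, X 0, X 1]

theorem dh_monomial (μ : Fin 4 →₀ ℕ) (r : ℝ) : dh (monomial μ r) =
    monomial (Finsupp.equivFunOnFinite.symm ![μ 2, μ 3]) r := by
  rw [dh, aeval_monomial, Finsupp.prod_fintype _ _ (by simp), monomial_eq,
    Finsupp.prod_fintype _ _ (by simp), algebraMap_eq]
  simp [Fin.prod_univ_four]

theorem upper (P : P4) (hP : P ≠ 0) (d' : ℕ) (hd : IsWeightedHomogeneous d2 P d') (M r : ℕ)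
    (Ps : P4) (hM : X 0 ^ M * P = aeval fst Ps)
    (hr : ∀ μ ∈ (aeval Ph Ps : P4).support, r ≤ Finsupp.weight wO μ) : Em r ≤ d' := by
  obtain ⟨μ0, hμ0⟩ := MvPolynomial.ne_zero_iff.mp hP
  set n := Finsupp.weight wN μ0 with hn
  set Pn := weightedHomogeneousComponent wN n P with hPn
  set Psn := weightedHomogeneousComponent wN n Ps with hPsn
  have hPn0 : Pn ≠ 0 := by
    intro h
    have h1 := congrArg (coeff μ0) h
    rw [hPn, coeff_weightedHomogeneousComponent, if_pos rfl, coeff_zero] at h1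
    exact hμ0 h1
  have hsub : ∀ (F : P4), ∀ μ ∈ (weightedHomogeneousComponent wN n F).support,
      μ ∈ F.support ∧ Finsupp.weight wN μ = n := by
    intro F μ hμ
    rw [mem_support_iff, coeff_weightedHomogeneousComponent] at hμ
    split_ifs at hμ with h1
    · exact ⟨mem_support_iff.mpr hμ, h1⟩
    · exact absurd rfl hμ
  have hM' : X 0 ^ M * Pn = aeval fst Psn := by
    rw [hPn, hPsn, ← comp_X0, hM, comp_aeval wN wN fst fst_hom]
  have hQ : (aeval Ph Psn : P4) = weightedHomogeneousComponent wN n (aeval Ph Ps) := by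
    rw [hPsn, comp_aeval wN wN Ph Ph_hom]
  have hsup : ∀ μ ∈ Pn.support, μ 1 + 2 * μ 2 + 3 * μ 3 = n ∧
      μ 0 + 6 * μ 1 + 10 * μ 2 + 15 * μ 3 = d' := by
    intro μ hμ
    obtain ⟨h1, h2⟩ := hsub P μ hμ
    rw [← wN_weight, ← d2_weight]
    exact ⟨h2, hd (mem_support_iff.mp h1)⟩
  obtain ⟨hs1, hs2⟩ := monomial_map dh _ dh_monomial Pn
  have hp0 : dh Pn ≠ 0 := by
    apply hs2 hPn0
    intro μ hμ ν hν h
    have a2 := DFunLike.congr_fun h 0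
    have a3 := DFunLike.congr_fun h 1
    simp at a2 a3
    have b1 := hsup μ hμ
    have b2 := hsup ν hν
    ext i
    fin_cases i <;> simp <;> omega
  have hdh : dh Pn = dh Psn := by
    have h1 := congrArg dh hM'
    rw [map_mul, map_pow, ← AlgHom.comp_apply dh] at h1
    have h2 : dh.comp (aeval fst : P4 →ₐ[ℝ] P4) = dh := by
      apply MvPolynomial.algHom_ext
      intro i
      rw [AlgHom.comp_apply, aeval_X]
      fin_cases i <;> simp [fst, dh]
    rw [h2] at h1
    rw [← h1]
    simp [dh]
  have hrho : rh (dh Psn) = aeval ![1, 1, Polynomial.C (X 0) * Polynomial.X,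
      Polynomial.C (X 1) * Polynomial.X ^ 2] (aeval Ph Psn : P4) := by
    rw [← AlgHom.comp_apply, ← AlgHom.comp_apply]
    congr 1
    apply MvPolynomial.algHom_ext
    intro i
    rw [AlgHom.comp_apply, AlgHom.comp_apply, aeval_X, dh, aeval_X]
    fin_cases i <;> simp only [rh, Ph, map_add, map_mul, map_pow, map_ofNat, map_one, aeval_X,
      Matrix.cons_val, Fin.zero_eta, Fin.mk_one, Fin.reduceFinMk] <;> ring
  have hdvd : Polynomial.X ^ (r - n) ∣ rh (dh Pn) := by
    rw [hdh, hrho]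
    generalize hy : (aeval Ph Psn : P4) = Y at *
    rw [aeval_def, eval₂_eq']
    refine Finset.dvd_sum fun μ hμ => Dvd.dvd.mul_left ?_ _
    rw [hQ] at hμ
    obtain ⟨h1, h2⟩ := hsub _ μ hμ
    have h3 := hr μ h1
    rw [wN_weight] at h2
    rw [wO_weight] at h3
    simp only [Fin.prod_univ_four, Matrix.cons_val, mul_pow, one_pow, one_mul]
    have e : ((Polynomial.C (X 0 : P2)) ^ μ 2 * Polynomial.X ^ μ 2 *
      ((Polynomial.C (X 1)) ^ μ 3 * (Polynomial.X ^ 2) ^ μ 3)) =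
      Polynomial.X ^ (μ 2 + 2 * μ 3) * (Polynomial.C (X 0) ^ μ 2 * Polynomial.C (X 1) ^ μ 3) := by
      rw [pow_add, pow_mul]; ring
    rw [e]
    exact (pow_dvd_pow _ (by omega)).mul_right _
  have hfin := key n (6 * n - d') (r - n) (dh Pn) hp0 (by
      intro ν hν
      obtain ⟨μ, hμ, rfl⟩ := hs1 ν hν
      have := hsup μ hμ
      simp
      omega) (by
      intro ν hν
      obtain ⟨μ, hμ, rfl⟩ := hs1 ν hν
      have := hsup μ hμ
      simp
      omega) hdvd
  have hmono : Em r ≤ Em (n + (r - n)) := Em_mono (by omega)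
  omega

/-- The submonoid of the statement. -/
def SM : AddSubmonoid (ℕ × ℕ) := AddSubmonoid.closure
  ({(2,0), (12,2), (20,4), (24,6), (30,6), (32,8), (36,10), (42,10),
    (44,12), (54,14), (60,16), (66,18)} : Set (ℕ × ℕ))

theorem mem_pad (d m j : ℕ) (h : (d, m) ∈ SM) : (d + 2 * j, m) ∈ SM := by
  induction j with
  | zero => exact h
  | succ j ih =>
    have h1 : ((2, 0) : ℕ × ℕ) ∈ SM := AddSubmonoid.subset_closure (by simp)
    have := SM.add_mem ih h1
    rwa [Prod.mk_add_mk] at this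

theorem mem_min (m : ℕ) : (2 * Em m, 2 * m) ∈ SM := by
  have g1 : ((12, 2) : ℕ × ℕ) ∈ SM := AddSubmonoid.subset_closure (by simp)
  have g2 : ((20, 4) : ℕ × ℕ) ∈ SM := AddSubmonoid.subset_closure (by simp)
  have g3 : ((24, 6) : ℕ × ℕ) ∈ SM := AddSubmonoid.subset_closure (by simp)
  have g4 : ((32, 8) : ℕ × ℕ) ∈ SM := AddSubmonoid.subset_closure (by simp)
  have g5 : ((36, 10) : ℕ × ℕ) ∈ SM := AddSubmonoid.subset_closure (by simp)
  have g6 : ((44, 12) : ℕ × ℕ) ∈ SM := AddSubmonoid.subset_closure (by simp)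
  have g7 : ((54, 14) : ℕ × ℕ) ∈ SM := AddSubmonoid.subset_closure (by simp)
  have g9 : ((66, 18) : ℕ × ℕ) ∈ SM := AddSubmonoid.subset_closure (by simp)
  induction m using Nat.strong_induction_on with
  | _ m ih =>
  rcases lt_or_ge m 13 with h | h
  · interval_cases m
    · exact SM.zero_mem
    · exact g1
    · exact g2
    · exact g3
    · exact g4
    · exact g5
    · exact g6
    · exact g7
    · exact SM.add_mem g5 g3
    · exact g9
    · exact SM.add_mem g5 g5
    · exact SM.add_mem g5 g6
    · exact SM.add_mem g6 g6
  · have h1 := SM.add_mem (ih (m - 5) (by omega)) g5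
    rw [Prod.mk_add_mk] at h1
    have h2 := Em_big m (by omega)
    have h3 := Em_big (m - 5) (by omega)
    have e1 : 2 * Em m = 2 * Em (m - 5) + 36 := by omega
    have e2 : 2 * m = 2 * (m - 5) + 10 := by omega
    rw [e1, e2]
    exact h1

theorem mem_of_le (d m : ℕ) (h : Em m ≤ d) : (2 * d, 2 * m) ∈ SM := by
  obtain ⟨j, rfl⟩ := Nat.exists_eq_add_of_le h
  rw [mul_add]
  exact mem_pad _ _ _ (mem_min m)

/-- Evaluation of the constant coefficient at the point `(1,0,0,1)`. -/
noncomputable def th : Polynomial P4 →+* ℝ :=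
  (MvPolynomial.eval ![1, 0, 0, 1]).comp Polynomial.constantCoeff

theorem th_apply (U : Polynomial P4) : th U = MvPolynomial.eval ![1, 0, 0, 1] (U.coeff 0) := by
  simp [th, Polynomial.constantCoeff_apply]

theorem th_ne {U : Polynomial P4} (h : th U ≠ 0) : U.coeff 0 ≠ 0 := by
  intro h0
  rw [th_apply, h0, map_zero] at h
  exact h rfl

theorem th_X : th Polynomial.X = 0 := by simp [th_apply]

theorem th_al : th al = 1 := by
  rw [th_apply, al_coeff]; simp

theorem ev_v : MvPolynomial.eval ![1, 0, 0, 1] vS = 1 := by simp [vS]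

theorem ev_u : MvPolynomial.eval ![1, 0, 0, 1] uS = 0 := by
  rw [uS]; unfold uF; simp

theorem ev_t : MvPolynomial.eval ![1, 0, 0, 1] tS = 0 := by
  rw [tS]; unfold tF; simp

theorem lead_th : ∃ b1 k1 q1 : Polynomial P4,
    scale w3 bS = Polynomial.X ^ 2 * b1 ∧
    al ^ 2 * scale w3 cS = Polynomial.X ^ 6 * k1 + (Polynomial.X ^ 2 * b1) ^ 2 ∧
    al ^ 3 * scale w3 eS = Polynomial.X ^ 10 * q1 + 10 * (Polynomial.X ^ 2 * b1) ^ 3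
      + 15 * (Polynomial.X ^ 2 * b1) * (Polynomial.X ^ 6 * k1) ∧
    th b1 = 1 ∧ th k1 = 3 ∧ th q1 = 27 := by
  obtain ⟨b1, k1, q1, hb, hk, hq, cb, ck, cq⟩ := lead_data
  rw [hb] at hk hq
  refine ⟨b1, k1, q1, hb, ?_, ?_, ?_, ?_, ?_⟩
  · linear_combination hk
  · linear_combination hq + 15 * (Polynomial.X ^ 2 * b1) * hk
  · rw [th_apply, cb]; simp [ev_v]
  · rw [th_apply, ck]; simp [k0, ev_v, ev_u]
  · rw [th_apply, cq]; simp [q0, ev_v, ev_u, ev_t]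

/-- The pairs realised by an invariant with a certificate for its order of vanishing. -/
def Good (d m : ℕ) : Prop := ∃ (F : P4) (U V : Polynomial P4), FixG F ∧ F.IsHomogeneous d ∧
  V * scale w3 F = Polynomial.X ^ m * U ∧ th V ≠ 0 ∧ th U ≠ 0

theorem FixG.mul {F H : P4} (h : FixG F) (k : FixG H) : FixG (F * H) := by
  obtain ⟨h1, h2, h3, h4⟩ := h
  obtain ⟨k1, k2, k3, k4⟩ := k
  exact ⟨by rw [map_mul, h1, k1], by rw [map_mul, h2, k2], by rw [map_mul, h3, k3],
    by rw [map_mul, h4, k4]⟩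

theorem FixG.add {F H : P4} (h : FixG F) (k : FixG H) : FixG (F + H) := by
  obtain ⟨h1, h2, h3, h4⟩ := h
  obtain ⟨k1, k2, k3, k4⟩ := k
  exact ⟨by rw [map_add, h1, k1], by rw [map_add, h2, k2], by rw [map_add, h3, k3],
    by rw [map_add, h4, k4]⟩

theorem FixG_C (r : ℝ) : FixG (C r) :=
  ⟨(act m1).commutes r, (act m2).commutes r, (act m3).commutes r, (act m4).commutes r⟩

theorem Good.add {d m d' m' : ℕ} (h : Good d m) (k : Good d' m') : Good (d + d') (m + m') := by
  obtain ⟨F, U, V, h1, h2, h3, h4, h5⟩ := h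
  obtain ⟨F', U', V', k1, k2, k3, k4, k5⟩ := k
  refine ⟨F * F', U * U', V * V', h1.mul k1, h2.mul k2, ?_, ?_, ?_⟩
  · rw [map_mul, pow_add]
    linear_combination (V' * scale w3 F') * h3 + (Polynomial.X ^ m * U) * k3
  · rw [map_mul]; exact mul_ne_zero h4 k4
  · rw [map_mul]; exact mul_ne_zero h5 k5

theorem Good.zero : Good 0 0 :=
  ⟨1, 1, 1, by simpa using FixG_C 1, isHomogeneous_one _ _, by simp, by simp, by simp⟩

/-- Invariant homogeneous polynomials of degree `d`. -/
def IH (d : ℕ) (F : P4) : Prop := FixG F ∧ F.IsHomogeneous d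

theorem IH.mul {d d' e : ℕ} {F H : P4} (h : IH d F) (k : IH d' H) (he : d + d' = e) :
    IH e (F * H) := ⟨h.1.mul k.1, he ▸ h.2.mul k.2⟩

theorem IH.add {d : ℕ} {F H : P4} (h : IH d F) (k : IH d H) :
    IH d (F + H) := ⟨h.1.add k.1, h.2.add k.2⟩

theorem IH.smul {d : ℕ} {F : P4} (r : ℝ) (h : IH d F) : IH d (C r * F) :=
  ⟨(FixG_C r).mul h.1, by simpa using (isHomogeneous_C (Fin 4) r).mul h.2⟩

theorem IH_a : IH 2 aS := ⟨FixG_a, gH_hom 0⟩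
theorem IH_b : IH 12 bS := ⟨FixG_b, gH_hom 1⟩
theorem IH_c : IH 20 cS := ⟨FixG_c, gH_hom 2⟩
theorem IH_e : IH 30 eS := ⟨FixG_e, gH_hom 3⟩

/-- Monomials in the basic invariants. -/
theorem IH_mon (i j k l d : ℕ) (hd : 2 * i + 12 * j + 20 * k + 30 * l = d) :
    IH d (aS ^ i * bS ^ j * cS ^ k * eS ^ l) := by
  have hp : ∀ {n : ℕ} {F : P4}, IH n F → ∀ t : ℕ, IH (n * t) (F ^ t) := by
    intro n F h t
    induction t with
    | zero => exact ⟨by simpa using FixG_C 1, by simpa using isHomogeneous_one _ _⟩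
    | succ t ih => rw [pow_succ]; exact ih.mul h (by ring)
  exact (((hp IH_a i).mul (hp IH_b j) rfl).mul (hp IH_c k) rfl).mul (hp IH_e l) hd

theorem sc_C (r : ℝ) : scale w3 (C r) = algebraMap ℝ (Polynomial P4) r := (scale w3).commutes r

theorem good_a : Good 2 0 :=
  ⟨aS, al, 1, IH_a.1, IH_a.2, by rw [scale_a3]; ring, by simp, by rw [th_al]; simp⟩

theorem good_b : Good 12 2 := by
  obtain ⟨b1, k1, q1, hb, hc, he, tb, tk, tq⟩ := lead_th
  exact ⟨bS, b1, 1, IH_b.1, IH_b.2, by rw [hb]; ring, by simp, by rw [tb]; simp⟩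

theorem good_c : Good 20 4 := by
  obtain ⟨b1, k1, q1, hb, hc, he, tb, tk, tq⟩ := lead_th
  refine ⟨cS, Polynomial.X ^ 2 * k1 + b1 ^ 2, al ^ 2, IH_c.1, IH_c.2, by rw [hc]; ring, ?_, ?_⟩
  · simp [th_al]
  · simp [th_X, tb]

theorem good_k : Good 24 6 := by
  obtain ⟨b1, k1, q1, hb, hc, he, tb, tk, tq⟩ := lead_th
  have h := (IH_mon 2 0 1 0 24 (by norm_num)).add (IH.smul (-1) (IH_mon 0 2 0 0 24 (by norm_num)))
  refine ⟨_, k1, 1, h.1, h.2, ?_, by simp, by rw [tk]; simp⟩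
  simp only [map_add, map_mul, map_pow, sc_C, scale_a3, hb, map_neg, map_one]
  linear_combination hc

theorem good_g16 : Good 32 8 := by
  obtain ⟨b1, k1, q1, hb, hc, he, tb, tk, tq⟩ := lead_th
  have h := (IH_mon 1 0 0 1 32 (by norm_num)).add (IH.smul (-10) (IH_mon 0 1 1 0 32 (by norm_num)))
  refine ⟨_, Polynomial.X ^ 2 * q1 + 5 * b1 * k1, al ^ 2, h.1, h.2, ?_, by simp [th_al], ?_⟩
  · simp only [map_add, map_mul, map_pow, sc_C, scale_a3, hb, map_neg, map_ofNat]
    linear_combination he - 10 * (Polynomial.X ^ 2 * b1) * hc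
  · simp only [map_add, map_mul, map_pow, map_ofNat, tb, tk, th_X]; norm_num

theorem good_q : Good 36 10 := by
  obtain ⟨b1, k1, q1, hb, hc, he, tb, tk, tq⟩ := lead_th
  have h := ((IH_mon 3 0 0 1 36 (by norm_num)).add
    (IH.smul 5 (IH_mon 0 3 0 0 36 (by norm_num)))).add
    (IH.smul (-15) (IH_mon 2 1 1 0 36 (by norm_num)))
  refine ⟨_, q1, 1, h.1, h.2, ?_, by simp, by rw [tq]; simp⟩
  simp only [map_add, map_mul, map_pow, sc_C, scale_a3, hb, map_neg, map_ofNat]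
  linear_combination he - 15 * (Polynomial.X ^ 2 * b1) * hc

theorem good_g22 : Good 44 12 := by
  obtain ⟨b1, k1, q1, hb, hc, he, tb, tk, tq⟩ := lead_th
  have h := ((IH_mon 1 1 0 1 44 (by norm_num)).add
    (IH.smul (-5) (IH_mon 2 0 2 0 44 (by norm_num)))).add
    (IH.smul (-5) (IH_mon 0 2 1 0 44 (by norm_num)))
  refine ⟨_, b1 * q1 - 5 * k1 ^ 2, al ^ 2, h.1, h.2, ?_, by simp [th_al], ?_⟩
  · simp only [map_add, map_mul, map_pow, sc_C, scale_a3, hb, map_neg, map_ofNat]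
    linear_combination (Polynomial.X ^ 2 * b1) * he
      - 5 * (al ^ 2 * scale w3 cS + (Polynomial.X ^ 6 * k1 + (Polynomial.X ^ 2 * b1) ^ 2)) * hc
      - 5 * (Polynomial.X ^ 2 * b1) ^ 2 * hc
  · simp only [map_sub, map_mul, map_pow, map_ofNat, tb, tk, tq]; norm_num

theorem good_g27 : Good 54 14 := by
  obtain ⟨b1, k1, q1, hb, hc, he, tb, tk, tq⟩ := lead_th
  have h := ((IH_mon 0 2 0 1 54 (by norm_num)).add
    (IH_mon 2 0 1 1 54 (by norm_num))).add
    (IH.smul (-20) (IH_mon 1 1 2 0 54 (by norm_num)))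
  refine ⟨_, 2 * b1 ^ 2 * q1 - 5 * b1 * k1 ^ 2 + Polynomial.X ^ 2 * k1 * q1, al ^ 3, h.1, h.2, ?_,
    by simp [th_al], ?_⟩
  · simp only [map_add, map_mul, map_pow, sc_C, scale_a3, hb, map_neg, map_ofNat]
    linear_combination (Polynomial.X ^ 2 * b1) ^ 2 * he + al ^ 2 * scale w3 cS * he
      + (Polynomial.X ^ 10 * q1 + 10 * (Polynomial.X ^ 2 * b1) ^ 3
      + 15 * (Polynomial.X ^ 2 * b1) * (Polynomial.X ^ 6 * k1)) * hc
      - 20 * (Polynomial.X ^ 2 * b1) *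
        (al ^ 2 * scale w3 cS + (Polynomial.X ^ 6 * k1 + (Polynomial.X ^ 2 * b1) ^ 2)) * hc
  · simp only [map_sub, map_add, map_mul, map_pow, map_ofNat, tb, tk, tq, th_X]; norm_num

theorem good_g33 : Good 66 18 := by
  obtain ⟨b1, k1, q1, hb, hc, he, tb, tk, tq⟩ := lead_th
  have h := ((((IH.smul (-50) (IH_mon 3 0 3 0 66 (by norm_num))).add
    (IH.smul (-15) (IH_mon 2 1 1 1 66 (by norm_num)))).add
    (IH_mon 3 0 0 2 66 (by norm_num))).add
    (IH.smul 150 (IH_mon 1 2 2 0 66 (by norm_num)))).add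
    (IH.smul (-5) (IH_mon 0 3 0 1 66 (by norm_num)))
  refine ⟨_, -50 * k1 ^ 3 + 15 * b1 * k1 * q1 + Polynomial.X ^ 2 * q1 ^ 2, al ^ 3, h.1, h.2, ?_,
    by simp [th_al], ?_⟩
  · simp only [map_add, map_mul, map_pow, sc_C, scale_a3, hb, map_neg, map_ofNat]
    generalize hB : Polynomial.X ^ 2 * b1 = B at *
    generalize hK : Polynomial.X ^ 6 * k1 = K at *
    generalize hQ : Polynomial.X ^ 10 * q1 = Q at *
    have e1 : Polynomial.X ^ 18 * (-50 * k1 ^ 3 + 15 * b1 * k1 * q1 + Polynomial.X ^ 2 * q1 ^ 2)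
        = -50 * K ^ 3 + 15 * B * K * Q + Q ^ 2 := by
      rw [← hB, ← hK, ← hQ]; ring
    rw [e1]
    generalize scale w3 cS = c at *
    generalize scale w3 eS = e at *
    have e2 : -50 * (al ^ 2 * c) ^ 3 - 15 * B * (al ^ 2 * c) * (al ^ 3 * e) + (al ^ 3 * e) ^ 2
        + 150 * B ^ 2 * (al ^ 2 * c) ^ 2 - 5 * B ^ 3 * (al ^ 3 * e)
        = -50 * K ^ 3 + 15 * B * K * Q + Q ^ 2 := by
      rw [hc, he]; ring
    linear_combination e2
  · simp only [map_neg, map_add, map_mul, map_pow, map_ofNat, tb, tk, tq, th_X]; norm_num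

theorem good_of_mem (p : ℕ × ℕ) (h : p ∈ SM) : Good p.1 p.2 := by
  have a3 : Good 6 0 := (good_a.add good_a).add good_a
  unfold SM at h
  induction h using AddSubmonoid.closure_induction with
  | mem x hx =>
    simp only [Set.mem_insert_iff, Set.mem_singleton_iff] at hx
    rcases hx with rfl | rfl | rfl | rfl | rfl | rfl | rfl | rfl | rfl | rfl | rfl | rfl
    · exact good_a
    · exact good_b
    · exact good_c
    · exact good_k
    · exact good_k.add a3
    · exact good_g16
    · exact good_q
    · exact good_q.add a3
    · exact good_g22
    · exact good_g27
    · exact good_q.add good_k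
    · exact good_g33
  | zero => exact Good.zero
  | add x y _ _ hx hy => exact hx.add hy

/-- There is a `W(H4)`-invariant homogeneous polynomial of degree `d` vanishing to order
exactly `m` at `(0,0,0,1)` if and only if `(d,m)` lies in the additive submonoid of
`ℕ × ℕ` generated by the twelve pairs `(2,0), (12,2), (20,4), (24,6), (30,6), (32,8),
(36,10), (42,10), (44,12), (54,14), (60,16), (66,18)`. -/
theorem WH4_invariants_bidegrees (d m : ℕ) :
    (∃ F : MvPolynomial (Fin 4) ℝ, F ≠ 0 ∧ F.IsHomogeneous d ∧
      (∀ g ∈ WH4, polyActR g F = F) ∧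
      F ∈ (Ideal.span {X 0, X 1, X 2} : Ideal (MvPolynomial (Fin 4) ℝ)) ^ m ∧
      F ∉ (Ideal.span {X 0, X 1, X 2} : Ideal (MvPolynomial (Fin 4) ℝ)) ^ (m + 1))
    ↔ (d, m) ∈ AddSubmonoid.closure
        ({(2,0), (12,2), (20,4), (24,6), (30,6), (32,8), (36,10), (42,10),
          (44,12), (54,14), (60,16), (66,18)} : Set (ℕ × ℕ)) := by
  constructor
  · rintro ⟨F, h0, hd, hG, hm, hm1⟩
    obtain ⟨d', P, rfl, hP, hPd, rfl⟩ := exists_hom (inv_of_polyActR hG) hd h0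
    obtain ⟨M, Ps, r, hM, hr, hord⟩ := ord_spec P hP
    rw [mem_pow_iff, hord] at hm hm1
    have hmr : m = 2 * r := by omega
    subst hmr
    exact mem_of_le d' r (upper P hP d' hPd M r Ps hM hr)
  · intro h
    obtain ⟨F, U, V, h1, h2, h3, h4, h5⟩ := good_of_mem (d, m) h
    have hdv := dvd_iff_of h3 (th_ne h4) (th_ne h5)
    have hnot : F ∉ (Ideal.span {X 0, X 1, X 2} : Ideal (MvPolynomial (Fin 4) ℝ)) ^ (m + 1) := by
      rw [mem_pow_iff, hdv]; simp
    refine ⟨F, ?_, h2, fun g hg => polyActR_of_inv h1 g hg, ?_, hnot⟩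
    · rintro rfl
      exact hnot (Ideal.zero_mem _)
    · rw [mem_pow_iff, hdv]
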